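/- Fix a totally real number field K₀ of class number one. Consider the family of all CM-fields K whose maximal totally real subfield is K₀. Then log h_K ∼ (1/2)·log Δ_K as Δ_K → ∞ through this family; precisely, for every ε > 0 there are only finitely many CM-fields K with maximal totally real subfield K₀ such that |log h_K − (1/2)·log Δ_K| > ε·log Δ_K. -/

import Mathlib

open NumberField
open scoped Classical

/-- The class number of an intermediate field of `ℂ/ℚ` (junk value `0` if it is not finite
dimensional over `ℚ`, i.e. not a number field). -/
noncomputable def clsNum (K : IntermediateField ℚ ℂ) : ℕ :=
  if h : FiniteDimensional ℚ K then
    letI := h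
    letI : NumberField K := ⟨⟩
    NumberField.classNumber K
  else 0

/-- The absolute value of the discriminant of an intermediate field of `ℂ/ℚ` (junk value `0`
if it is not finite dimensional over `ℚ`). -/
noncomputable def absDisc (K : IntermediateField ℚ ℂ) : ℕ :=
  if h : FiniteDimensional ℚ K then
    letI := h
    letI : NumberField K := ⟨⟩
    (NumberField.discr K).natAbs
  else 0

/-- `K` is a CM-field with maximal totally real subfield `K₀`: it is a number field which is
totally imaginary (it has no real embedding) and is a quadratic extension of the totally real
field `K₀`. -/
def IsCMover (K₀ K : IntermediateField ℚ ℂ) : Prop :=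
  FiniteDimensional ℚ K ∧ K₀ ≤ K ∧
    Module.finrank ℚ K = 2 * Module.finrank ℚ K₀ ∧
    IsEmpty (K →+* ℝ)

section LatticeCount

open MeasureTheory

variable {E : Type*} [AddCommGroup E] [MeasurableSpace E] [MeasurableAdd E]
  {μ : Measure E} [μ.IsAddLeftInvariant] {Λ : AddSubgroup E} [Countable Λ] {F : Set E}

theorem lintegral_tsum_indicator_eq_measure (hF : IsAddFundamentalDomain Λ F μ) {S : Set E}
    (hS : MeasurableSet S) :
    ∫⁻ y in F, ∑' l : Λ, S.indicator (fun _ ↦ (1 : ENNReal)) (l + y) ∂μ = μ S := by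
  have hm : Measurable (S.indicator (fun _ ↦ (1 : ENNReal))) := measurable_const.indicator hS
  have h := hF.lintegral_eq_tsum'' (S.indicator (fun _ ↦ (1 : ENNReal)))
  rw [lintegral_indicator_const hS, one_mul] at h
  rw [h, lintegral_tsum]
  · rfl
  · intro l
    exact (hm.comp (measurable_const_add (l : E))).aemeasurable

/-- Comparison of the number of lattice points in a family of bodies `B t` with volumes, under the
assumption that `B D` meets every translate of the lattice. -/
theorem count_mul_measure_le (hF : IsAddFundamentalDomain Λ F μ) {B : NNReal → Set E}
    (hB : ∀ t, MeasurableSet (B t)) (hadd : ∀ s t x y, x ∈ B s → y ∈ B t → x + y ∈ B (s + t))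
    {D : NNReal} (hcov : ∀ y, ∃ l ∈ Λ, l + y ∈ B D) (t : NNReal) :
    (∑' l : Λ, (B t).indicator (fun _ ↦ (1 : ENNReal)) l) * μ F ≤ μ (B (t + D)) := by
  rw [← lintegral_tsum_indicator_eq_measure hF (hB (t + D)), ← setLIntegral_const]
  refine lintegral_mono fun y ↦ ?_
  obtain ⟨l₀, hl₀, hy⟩ := hcov y
  rw [← (Equiv.addRight (⟨l₀, hl₀⟩ : Λ)).tsum_eq
    (fun l : Λ ↦ (B (t + D)).indicator (fun _ ↦ (1 : ENNReal)) (l + y))]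
  refine ENNReal.tsum_le_tsum fun l ↦ ?_
  by_cases hl : (l : E) ∈ B t
  · have : ((l : E) + l₀) + y ∈ B (t + D) := by
      rw [add_assoc]; exact hadd _ _ _ _ hl hy
    simp [hl, this]
  · simp [hl]

theorem measure_le_count_mul (hF : IsAddFundamentalDomain Λ F μ) {B : NNReal → Set E}
    (hB : ∀ t, MeasurableSet (B t)) (hadd : ∀ s t x y, x ∈ B s → y ∈ B t → x + y ∈ B (s + t))
    (hneg : ∀ t x, x ∈ B t → -x ∈ B t)
    {D : NNReal} (hcov : ∀ y, ∃ l ∈ Λ, l + y ∈ B D) (t : NNReal) :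
    μ (B t) ≤ (∑' l : Λ, (B (t + D)).indicator (fun _ ↦ (1 : ENNReal)) l) * μ F := by
  rw [← lintegral_tsum_indicator_eq_measure hF (hB t), ← setLIntegral_const]
  refine lintegral_mono fun y ↦ ?_
  obtain ⟨l₀, hl₀, hy⟩ := hcov y
  dsimp only
  rw [← (Equiv.addRight (⟨l₀, hl₀⟩ : Λ)).tsum_eq
    (fun l : Λ ↦ (B t).indicator (fun _ ↦ (1 : ENNReal)) (l + y))]
  refine ENNReal.tsum_le_tsum fun l ↦ ?_
  by_cases hl : ((l : E) + l₀) + y ∈ B t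
  · have : (l : E) ∈ B (t + D) := by
      have := hadd _ _ _ _ hl (hneg _ _ hy)
      convert this using 1
      abel
    simp [hl, this]
  · simp [hl]

end LatticeCount

section Covering

open NumberField.mixedEmbedding NumberField.InfinitePlace MeasureTheory Module
open scoped nonZeroDivisors

variable {K : Type*} [Field K]

theorem mem_convexBodyLT_iff {f : InfinitePlace K → NNReal} {x : mixedSpace K} :
    x ∈ convexBodyLT K f ↔ ∀ w, normAtPlace w x < f w := by
  constructor
  · rintro ⟨h₁, h₂⟩ w
    obtain hw | hw := isReal_or_isComplex w
    · rw [normAtPlace_apply_of_isReal hw]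
      simpa using h₁ ⟨w, hw⟩ trivial
    · rw [normAtPlace_apply_of_isComplex hw]
      simpa using h₂ ⟨w, hw⟩ trivial
  · intro h
    refine ⟨fun w _ ↦ ?_, fun w _ ↦ ?_⟩
    · have := h w
      rw [normAtPlace_apply_of_isReal w.2] at this
      simpa using this
    · have := h w
      rw [normAtPlace_apply_of_isComplex w.2] at this
      simpa using this

variable [NumberField K]

theorem span_mixedEmbedding_mul_pow_eq_top {θ a : K} (hθ : IntermediateField.adjoin ℚ {θ} = ⊤)
    (ha : a ≠ 0) :
    Submodule.span ℝ (Set.range fun i : Fin (finrank ℚ K) ↦ mixedEmbedding K (a * θ ^ (i : ℕ))) =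
      ⊤ := by
  have hdeg := (Field.primitive_element_iff_minpoly_natDegree_eq ℚ θ).mp hθ
  have hli : LinearIndependent ℚ (fun i : Fin (finrank ℚ K) ↦ θ ^ (i : ℕ)) := by
    have := linearIndependent_pow (K := ℚ) θ
    rwa [hdeg] at this
  have hsp : Submodule.span ℚ (Set.range fun i : Fin (finrank ℚ K) ↦ θ ^ (i : ℕ)) = ⊤ :=
    hli.span_eq_top_of_card_eq_finrank' (by simp)
  rw [eq_top_iff, ← (latticeBasis K).span_eq, Submodule.span_le]
  rintro _ ⟨i, rfl⟩
  rw [latticeBasis_apply]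
  have h : a⁻¹ * integralBasis K i ∈ Submodule.span ℚ
      (Set.range fun i : Fin (finrank ℚ K) ↦ θ ^ (i : ℕ)) := hsp ▸ Submodule.mem_top
  obtain ⟨c, hc⟩ := (Submodule.mem_span_range_iff_exists_fun ℚ).mp h
  have : integralBasis K i = ∑ j, c j • (a * θ ^ (j : ℕ)) := by
    rw [← mul_inv_cancel_left₀ ha (integralBasis K i), ← hc, Finset.mul_sum]
    simp_rw [mul_smul_comm]
  rw [this, map_sum]
  refine Submodule.sum_mem _ fun j _ ↦ ?_
  rw [map_rat_smul (mixedEmbedding K)]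
  have : (c j) • mixedEmbedding K (a * θ ^ (j : ℕ)) =
    ((c j : ℝ)) • mixedEmbedding K (a * θ ^ (j : ℕ)) := by
    exact (Rat.cast_smul_eq_qsmul ℝ _ _).symm
  rw [this]
  exact Submodule.smul_mem _ _ (Submodule.subset_span ⟨j, rfl⟩)

omit [NumberField K] in
theorem normAtPlace_sum_le (w : InfinitePlace K) {ι : Type*} (s : Finset ι) (x : ι → mixedSpace K) :
    normAtPlace w (∑ i ∈ s, x i) ≤ ∑ i ∈ s, normAtPlace w (x i) := by
  induction s using Finset.induction_on with
  | empty => simp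
  | insert i s hi ih =>
    rw [Finset.sum_insert hi, Finset.sum_insert hi]
    exact (normAtPlace_add_le w _ _).trans (by gcongr)

theorem one_le_abs_discr : (1 : ℝ) ≤ |(discr K : ℝ)| := by
  rw [← Int.cast_abs]
  exact_mod_cast Int.one_le_abs (discr_ne_zero K)

theorem one_le_sqrt_abs_discr : (1 : ℝ) ≤ Real.sqrt |(discr K : ℝ)| :=
  Real.one_le_sqrt.mpr one_le_abs_discr

theorem exists_primitive_element_le :
    ∃ θ : 𝓞 K, IntermediateField.adjoin ℚ {(θ : K)} = ⊤ ∧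
      ∀ w : InfinitePlace K, w θ ≤ 2 ^ (finrank ℚ K + 2) * Real.sqrt |discr K| := by
  set B : NNReal := 2 ^ (finrank ℚ K + 1) * NNReal.sqrt ‖discr K‖₊ with hBdef
  have hs : (1 : ℝ) ≤ Real.sqrt |discr K| := one_le_sqrt_abs_discr
  have hBcoe : (B : ℝ) = 2 ^ (finrank ℚ K + 1) * Real.sqrt |discr K| := by
    rw [hBdef]; push_cast; simp [Int.norm_eq_abs]
  have hB1 : (1 : ℝ) ≤ B := by
    rw [hBcoe]; exact one_le_mul_of_one_le_of_one_le (one_le_pow₀ one_le_two) hs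
  have hmk : ∀ c : NNReal, 1 ≤ c → minkowskiBound K ↑1 < c * B := by
    intro c hc
    rw [minkowskiBound, volume_fundamentalDomain_fractionalIdealLatticeBasis, Units.val_one,
      FractionalIdeal.absNorm_one, Rat.cast_one, ENNReal.ofReal_one, one_mul,
      mixedEmbedding.finrank, volume_fundamentalDomain_latticeBasis]
    have hs' : (NNReal.sqrt ‖discr K‖₊ : ENNReal) ≠ 0 := by
      simp [discr_ne_zero K]
    calc _ ≤ 1 * (NNReal.sqrt ‖discr K‖₊ : ENNReal) * 2 ^ finrank ℚ K := by
          gcongr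
          exact pow_le_one₀ (by positivity) (by simp)
      _ < 1 * (NNReal.sqrt ‖discr K‖₊ : ENNReal) * 2 ^ (finrank ℚ K + 1) := by
          refine ENNReal.mul_lt_mul_right ?_ ?_ ?_
          · simpa using hs'
          · simp
          · have : (2 : NNReal) ^ finrank ℚ K < 2 ^ (finrank ℚ K + 1) :=
              pow_lt_pow_right₀ one_lt_two (Nat.lt_succ_self _)
            exact_mod_cast this
      _ = 1 * (B : ENNReal) := by rw [hBdef]; push_cast; ring
      _ ≤ c * B := by gcongr; exact_mod_cast hc
  obtain ⟨w₀⟩ : Nonempty (InfinitePlace K) := inferInstance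
  obtain hw | hw := isReal_or_isComplex w₀
  · obtain ⟨θ, h1, h2⟩ := exists_primitive_element_lt_of_isReal K hw
      (hmk _ (one_le_convexBodyLTFactor K))
    refine ⟨θ, h1, fun w ↦ (h2 w).le.trans ?_⟩
    rw [NNReal.coe_max, max_eq_left (by simpa using hB1), hBcoe]
    gcongr <;> simp
  · obtain ⟨θ, h1, h2⟩ := exists_primitive_element_lt_of_isComplex K hw
      (hmk _ (one_le_convexBodyLT'Factor K))
    refine ⟨θ, h1, fun w ↦ (h2 w).le.trans ?_⟩
    rw [Real.sqrt_le_left (by positivity)]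
    have : (2 : ℝ) ^ (finrank ℚ K + 2) * Real.sqrt |discr K| = 2 * B := by rw [hBcoe]; ring
    rw [this]
    nlinarith

variable (K) in
/-- An upper bound, up to normalization, for the covering radius of ideal lattices. -/
noncomputable def coverBound : NNReal :=
  finrank ℚ K * (2 ^ (finrank ℚ K + 2) * NNReal.sqrt ‖discr K‖₊) ^ finrank ℚ K

theorem prod_mul_pow_mult (c : NNReal) (g : InfinitePlace K → NNReal) :
    ∏ w, (c * g w) ^ mult w = c ^ finrank ℚ K * ∏ w, g w ^ mult w := by
  simp_rw [mul_pow, Finset.prod_mul_distrib, Finset.prod_pow_eq_pow_sum, sum_mult_eq]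

theorem exists_mem_ideal_add_mem_convexBodyLT {J : Ideal (𝓞 K)} (hJ : J ≠ ⊥)
    {g : InfinitePlace K → NNReal} (hg : ∏ w, g w ^ mult w = 1) (y : mixedSpace K) :
    ∃ b ∈ J, mixedEmbedding K b + y ∈ convexBodyLT K
      (fun w ↦ (Ideal.absNorm J : NNReal) ^ (1 / finrank ℚ K : ℝ) * coverBound K * g w) := by
  set d := finrank ℚ K with hd
  have hd0 : 0 < d := finrank_pos
  set n : NNReal := (Ideal.absNorm J : NNReal) with hn
  set M : NNReal := 2 ^ (d + 2) * NNReal.sqrt ‖discr K‖₊ with hM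
  have hMcoe : (M : ℝ) = 2 ^ (d + 2) * Real.sqrt |(discr K : ℝ)| := by
    rw [hM]; push_cast; simp [Int.norm_eq_abs]
  have hM1 : 1 ≤ M := by
    rw [← NNReal.coe_le_coe, hMcoe]
    exact one_le_mul_of_one_le_of_one_le (one_le_pow₀ one_le_two) one_le_sqrt_abs_discr
  have hn0 : n ≠ 0 := by simpa [hn, Ideal.absNorm_eq_zero_iff] using hJ
  set D : NNReal := (n * M) ^ (1 / d : ℝ) with hD
  have hDd : D ^ d = n * M := by
    rw [hD, ← NNReal.rpow_natCast, ← NNReal.rpow_mul, one_div,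
      inv_mul_cancel₀ (by exact_mod_cast hd0.ne'), NNReal.rpow_one]
  have hgpos : ∀ w, 0 < g w := by
    intro w
    refine pos_iff_ne_zero.mpr fun h ↦ ?_
    have : ∏ w, g w ^ mult w = 0 :=
      Finset.prod_eq_zero (Finset.mem_univ w) (by rw [h, zero_pow (mult_ne_zero)])
    rw [hg] at this
    exact one_ne_zero this
  let I : (FractionalIdeal (𝓞 K)⁰ K)ˣ :=
    FractionalIdeal.mk0 K ⟨J, mem_nonZeroDivisors_of_ne_zero hJ⟩
  have hIcoe : (I : FractionalIdeal (𝓞 K)⁰ K) = (J : FractionalIdeal (𝓞 K)⁰ K) := rfl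
  have hmk : minkowskiBound K I < volume (convexBodyLT K fun w ↦ D * g w) := by
    rw [convexBodyLT_volume, prod_mul_pow_mult, hg, ← hd, hDd, mul_one, minkowskiBound,
      volume_fundamentalDomain_fractionalIdealLatticeBasis, hIcoe,
      FractionalIdeal.coeIdeal_absNorm, Rat.cast_natCast, mixedEmbedding.finrank,
      volume_fundamentalDomain_latticeBasis, ← hd]
    have hs' : (NNReal.sqrt ‖discr K‖₊ : ENNReal) ≠ 0 := by
      simp [discr_ne_zero K]
    have hn' : (n : ENNReal) ≠ 0 := by exact_mod_cast hn0
    calc _ ≤ (n * (1 * (NNReal.sqrt ‖discr K‖₊)) * 2 ^ d : ENNReal) := by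
          gcongr
          · simp [hn]
          · exact pow_le_one₀ (by positivity) (by simp)
      _ < (n * (1 * (NNReal.sqrt ‖discr K‖₊)) * 2 ^ (d + 2) : ENNReal) := by
          refine ENNReal.mul_lt_mul_right ?_ ?_ ?_
          · simp [hs', hn']
          · exact ENNReal.mul_ne_top (by simp) (by simp)
          · have : (2 : NNReal) ^ d < 2 ^ (d + 2) :=
              pow_lt_pow_right₀ one_lt_two (by omega)
            exact_mod_cast this
      _ = 1 * (n * M : NNReal) := by rw [hM]; push_cast; ring
      _ ≤ _ := by
          gcongr
          exact_mod_cast one_le_convexBodyLTFactor K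
  obtain ⟨a, haI, ha0, ha⟩ := exists_ne_zero_mem_ideal_lt K I hmk
  rw [hIcoe, FractionalIdeal.mem_coeIdeal] at haI
  obtain ⟨a, haJ, rfl⟩ := haI
  obtain ⟨θ, hθ, hθM⟩ := exists_primitive_element_le (K := K)
  have hy : -y ∈ Submodule.span ℝ
      (Set.range fun i : Fin d ↦ mixedEmbedding K ((a : K) * (θ : K) ^ (i : ℕ))) := by
    rw [hd, span_mixedEmbedding_mul_pow_eq_top hθ ha0]; trivial
  obtain ⟨c, hc⟩ := (Submodule.mem_span_range_iff_exists_fun ℝ).mp hy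
  refine ⟨∑ i, ⌊c i⌋ • (a * θ ^ (i : ℕ)), ?_, ?_⟩
  · exact Submodule.sum_mem _ fun i _ ↦ zsmul_mem (Ideal.mul_mem_right _ _ haJ) _
  have hyc : mixedEmbedding K ((∑ i, ⌊c i⌋ • (a * θ ^ (i : ℕ)) : 𝓞 K) : K) + y =
      ∑ i, (-Int.fract (c i)) • mixedEmbedding K ((a : K) * (θ : K) ^ (i : ℕ)) := by
    have hcoe : ((∑ i, ⌊c i⌋ • (a * θ ^ (i : ℕ)) : 𝓞 K) : K) =
        ∑ i, ⌊c i⌋ • ((a : K) * (θ : K) ^ (i : ℕ)) := by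
      simp [map_sum]
    rw [hcoe, ← neg_neg y, ← hc, ← sub_eq_add_neg, map_sum (mixedEmbedding K),
      ← Finset.sum_sub_distrib]
    refine Finset.sum_congr rfl fun i _ ↦ ?_
    rw [Int.fract, neg_sub, sub_smul, map_zsmul, Int.cast_smul_eq_zsmul]
  rw [hyc, mem_convexBodyLT_iff]
  intro w
  have hterm : ∀ i : Fin d, normAtPlace w
      ((-Int.fract (c i)) • mixedEmbedding K ((a : K) * (θ : K) ^ (i : ℕ))) ≤
        w (a : K) * M ^ (d - 1) := by
    intro i
    rw [normAtPlace_smul, normAtPlace_apply, map_mul, map_pow, abs_neg,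
      abs_of_nonneg (Int.fract_nonneg _)]
    have h1 : w (θ : K) ^ (i : ℕ) ≤ M ^ (d - 1) := by
      calc w (θ : K) ^ (i : ℕ) ≤ (M : ℝ) ^ (i : ℕ) := by
            gcongr
            rw [hMcoe]; exact hθM w
        _ ≤ (M : ℝ) ^ (d - 1) := pow_le_pow_right₀ (by exact_mod_cast hM1) (by omega)
    calc _ ≤ 1 * (w (a : K) * M ^ (d - 1)) := by
          gcongr
          exact (Int.fract_lt_one _).le
      _ = _ := one_mul _
  have hDle : D ≤ n ^ (1 / d : ℝ) * M := by
    rw [hD, NNReal.mul_rpow]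
    gcongr
    calc M ^ (1 / d : ℝ) ≤ M ^ (1 : ℝ) := by
          refine NNReal.rpow_le_rpow_of_exponent_le hM1 ?_
          rw [div_le_one (by exact_mod_cast hd0)]
          exact_mod_cast hd0
      _ = M := NNReal.rpow_one M
  have hM0 : (0 : ℝ) < M := by exact_mod_cast zero_lt_one.trans_le hM1
  calc _ ≤ ∑ i : Fin d, w (a : K) * M ^ (d - 1) :=
        (normAtPlace_sum_le w _ _).trans (Finset.sum_le_sum fun i _ ↦ hterm i)
    _ = d * (w (a : K) * M ^ (d - 1)) := by simp
    _ < d * ((D * g w : NNReal) * M ^ (d - 1)) := by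
        have : (0 : ℝ) < d := by exact_mod_cast hd0
        gcongr
        exact ha w
    _ ≤ d * ((n ^ (1 / d : ℝ) * M * g w : NNReal) * M ^ (d - 1)) := by gcongr
    _ = _ := by
        rw [coverBound, ← hd, ← hM]
        push_cast
        obtain ⟨e, he⟩ : ∃ e, d = e + 1 := ⟨d - 1, by omega⟩
        rw [he, Nat.add_sub_cancel, pow_succ]
        ring

end Covering

section IdealCount

open NumberField.mixedEmbedding NumberField.InfinitePlace MeasureTheory Module
open scoped nonZeroDivisors

variable {K : Type*} [Field K] [NumberField K]

/-- The number of elements `a` of the ideal `J` with `w a < N(J) ^ (1 / d) * t * g w` for all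
infinite places `w`. -/
noncomputable def boxCount (J : Ideal (𝓞 K)) (g : InfinitePlace K → NNReal) (t : NNReal) : ENNReal :=
  ∑' a : J, if ∀ w : InfinitePlace K,
    w ((a : 𝓞 K) : K) < (Ideal.absNorm J : NNReal) ^ (1 / finrank ℚ K : ℝ) * t * g w then 1 else 0

variable (K) in
/-- The constant `2 ^ r₁ * (2 * π) ^ r₂`. -/
noncomputable def boxFactor : NNReal := convexBodyLTFactor K * 2 ^ nrComplexPlaces K

omit [NumberField K] in
theorem mem_convexBodyLT_add {f g : InfinitePlace K → NNReal} {x y : mixedSpace K}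
    (hx : x ∈ convexBodyLT K f) (hy : y ∈ convexBodyLT K g) :
    x + y ∈ convexBodyLT K (f + g) := by
  rw [mem_convexBodyLT_iff] at *
  intro w
  refine (normAtPlace_add_le w x y).trans_lt ?_
  simpa using add_lt_add (hx w) (hy w)

theorem idealLattice_tsum_eq (J : (Ideal (𝓞 K))⁰) (g : InfinitePlace K → NNReal) (t : NNReal) :
    ∑' l : (idealLattice K (FractionalIdeal.mk0 K J)).toAddSubgroup,
      (convexBodyLT K (fun w ↦ (Ideal.absNorm (J : Ideal (𝓞 K)) : NNReal) ^
        (1 / finrank ℚ K : ℝ) * t * g w)).indicator (fun _ ↦ (1 : ENNReal)) l =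
      boxCount (J : Ideal (𝓞 K)) g t := by
  let e : ↥(J : Ideal (𝓞 K)) → (idealLattice K (FractionalIdeal.mk0 K J)).toAddSubgroup :=
    fun a ↦ ⟨mixedEmbedding K ((a : 𝓞 K) : K), by
      rw [Submodule.mem_toAddSubgroup, mem_idealLattice]
      exact ⟨_, by simp, rfl⟩⟩
  have he : Function.Bijective e := by
    constructor
    · intro a b hab
      have := mixedEmbedding_injective K (congrArg Subtype.val hab)
      exact Subtype.ext (RingOfIntegers.ext this)
    · rintro ⟨x, hx⟩
      rw [Submodule.mem_toAddSubgroup, mem_idealLattice] at hx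
      obtain ⟨y, hy, rfl⟩ := hx
      obtain ⟨a, ha, rfl⟩ := by simpa using hy
      exact ⟨⟨a, ha⟩, rfl⟩
  rw [← (Equiv.ofBijective e he).tsum_eq, boxCount]
  refine tsum_congr fun a ↦ ?_
  rw [Set.indicator_apply]
  refine if_congr ?_ rfl rfl
  rw [mem_convexBodyLT_iff]
  simp [e, normAtPlace_apply]

theorem boxCount_bounds {J : Ideal (𝓞 K)} (hJ : J ≠ ⊥) {g : InfinitePlace K → NNReal}
    (hg : ∏ w, g w ^ mult w = 1) (t : NNReal) :
    boxCount J g t * NNReal.sqrt ‖discr K‖₊ ≤ boxFactor K * (t + coverBound K) ^ finrank ℚ K ∧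
    (boxFactor K * t ^ finrank ℚ K : ENNReal) ≤
      boxCount J g (t + coverBound K) * NNReal.sqrt ‖discr K‖₊ := by
  let J' : (Ideal (𝓞 K))⁰ := ⟨J, mem_nonZeroDivisors_of_ne_zero hJ⟩
  set n : NNReal := (Ideal.absNorm J : NNReal) with hn
  have hn0 : n ≠ 0 := by simpa [hn, Ideal.absNorm_eq_zero_iff] using hJ
  let Λ : AddSubgroup (mixedSpace K) := (idealLattice K (FractionalIdeal.mk0 K J')).toAddSubgroup
  let F := ZSpan.fundamentalDomain (fractionalIdealLatticeBasis K (FractionalIdeal.mk0 K J'))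
  have hF : IsAddFundamentalDomain Λ F := fundamentalDomain_idealLattice K _
  let B : NNReal → Set (mixedSpace K) := fun t ↦
    convexBodyLT K (fun w ↦ n ^ (1 / finrank ℚ K : ℝ) * t * g w)
  have hB : ∀ t, MeasurableSet (B t) := by
    intro t
    refine MeasurableSet.prod ?_ ?_ <;>
    exact MeasurableSet.univ_pi fun _ ↦ Metric.isOpen_ball.measurableSet
  have hadd : ∀ s t x y, x ∈ B s → y ∈ B t → x + y ∈ B (s + t) := by
    intro s t x y hx hy
    have := mem_convexBodyLT_add hx hy
    convert this using 2
    ext w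
    simp [mul_add, add_mul]
  have hneg : ∀ t x, x ∈ B t → -x ∈ B t := fun t x hx ↦ convexBodyLT_neg_mem K _ x hx
  have hcov : ∀ y, ∃ l ∈ Λ, l + y ∈ B (coverBound K) := by
    intro y
    obtain ⟨b, hb, hby⟩ := exists_mem_ideal_add_mem_convexBodyLT hJ hg y
    refine ⟨_, ?_, hby⟩
    rw [Submodule.mem_toAddSubgroup, mem_idealLattice]
    exact ⟨_, by simpa [J'] using hb, rfl⟩
  have : Countable Λ := by
    exact (inferInstance : Countable (idealLattice K (FractionalIdeal.mk0 K J')))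
  have hvol : ∀ t : NNReal, volume (B t) =
      n * (convexBodyLTFactor K * t ^ finrank ℚ K : ENNReal) := by
    intro t
    rw [convexBodyLT_volume, prod_mul_pow_mult, hg, mul_pow, ← NNReal.rpow_natCast,
      ← NNReal.rpow_mul, one_div, inv_mul_cancel₀ (by exact_mod_cast finrank_pos.ne'),
      NNReal.rpow_one]
    push_cast
    ring
  have hvF : volume F = n * (2⁻¹ ^ nrComplexPlaces K * NNReal.sqrt ‖discr K‖₊ : ENNReal) := by
    rw [volume_fundamentalDomain_fractionalIdealLatticeBasis,
      volume_fundamentalDomain_latticeBasis]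
    congr 1
    rw [FractionalIdeal.coe_mk0, FractionalIdeal.coeIdeal_absNorm, Rat.cast_natCast,
      ENNReal.ofReal_natCast]
    simp [hn, J']
  have key : ∀ t s : NNReal, (boxCount J g t * volume F ≤ volume (B s) ↔
      boxCount J g t * NNReal.sqrt ‖discr K‖₊ ≤ boxFactor K * s ^ finrank ℚ K) ∧
      (volume (B s) ≤ boxCount J g t * volume F ↔
      (boxFactor K * s ^ finrank ℚ K : ENNReal) ≤ boxCount J g t * NNReal.sqrt ‖discr K‖₊) := by
    intro t s
    have h2 : (2⁻¹ : ENNReal) ^ nrComplexPlaces K * 2 ^ nrComplexPlaces K = 1 := by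
      rw [← mul_pow, ENNReal.inv_mul_cancel (by simp) (by simp), one_pow]
    have e1 : (boxCount J g t * volume F) = (n * 2⁻¹ ^ nrComplexPlaces K) *
        (boxCount J g t * NNReal.sqrt ‖discr K‖₊) := by
      rw [hvF]; ring
    have e2 : volume (B s) = (n * 2⁻¹ ^ nrComplexPlaces K) *
        (boxFactor K * s ^ finrank ℚ K : ENNReal) := by
      rw [hvol, boxFactor]
      generalize convexBodyLTFactor K = c
      rw [ENNReal.coe_mul, ENNReal.coe_pow, ENNReal.coe_ofNat]
      calc _ = n * (2⁻¹ ^ nrComplexPlaces K * 2 ^ nrComplexPlaces K) *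
            (c * s ^ finrank ℚ K : ENNReal) := by rw [h2]; ring
        _ = _ := by ring
    have h0 : (n * 2⁻¹ ^ nrComplexPlaces K : ENNReal) ≠ 0 := by
      refine mul_ne_zero (by exact_mod_cast hn0) (pow_ne_zero _ (by simp))
    have ht : (n * 2⁻¹ ^ nrComplexPlaces K : ENNReal) ≠ ⊤ := by
      refine ENNReal.mul_ne_top (by simp) (ENNReal.pow_ne_top (by simp))
    rw [e1, e2, ENNReal.mul_le_mul_iff_right h0 ht, ENNReal.mul_le_mul_iff_right h0 ht]
    exact ⟨Iff.rfl, Iff.rfl⟩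
  constructor
  · have := (key t (t + coverBound K)).1.mp (by
      rw [← idealLattice_tsum_eq J']
      exact count_mul_measure_le hF hB hadd hcov t)
    exact_mod_cast this
  · refine (key (t + coverBound K) t).2.mp ?_
    rw [← idealLattice_tsum_eq J']
    exact measure_le_count_mul hF hB hadd hneg hcov t

end IdealCount

section Unfolding

open NumberField.mixedEmbedding NumberField.InfinitePlace MeasureTheory Module
  NumberField.Units NumberField.Units.dirichletUnitTheorem
open scoped nonZeroDivisors

theorem AddMonoidHom.tsum_comp_eq_card_ker_mul {G H : Type*} [AddCommGroup G] [AddCommGroup H]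
    (φ : G →+ H) (hφ : Function.Surjective φ) [Finite φ.ker] (f : H → ENNReal) :
    ∑' g, f (φ g) = Nat.card φ.ker * ∑' h, f h := by
  choose s hs using hφ
  let e : φ.ker × H ≃ G :=
    { toFun := fun p ↦ p.1 + s p.2
      invFun := fun g ↦ (⟨g - s (φ g), by simp [AddMonoidHom.mem_ker, hs]⟩, φ g)
      left_inv := by
        rintro ⟨⟨k, hk⟩, h⟩
        have hk' : φ k = 0 := hk
        ext <;> simp [hs, hk']
      right_inv := fun g ↦ by simp }
  have : ∀ (k : φ.ker) (h : H), φ (e (k, h)) = h := by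
    rintro ⟨k, hk⟩ h
    have hk' : φ k = 0 := hk
    simp [e, hs, hk']
  have h2 : ∑' p : φ.ker × H, f (φ (e p)) = ∑' (_ : φ.ker) (h : H), f h := by
    rw [← ENNReal.tsum_prod (f := fun (_ : φ.ker) h ↦ f h)]
    exact tsum_congr fun p ↦ by rw [this]
  have : Fintype φ.ker := Fintype.ofFinite _
  rw [← e.tsum_eq, h2, tsum_fintype, Finset.sum_const, Finset.card_univ, nsmul_eq_mul,
    Nat.card_eq_fintype_card]

variable {K : Type*} [Field K] [NumberField K]

/-- Extension of a vector of the logarithmic space to all infinite places with sum `0`. -/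
noncomputable def logExt (v : logSpace K) (w : InfinitePlace K) : ℝ :=
  if h : w ≠ w₀ then v ⟨w, h⟩ else -∑ i, v i

theorem logExt_add (v v' : logSpace K) (w : InfinitePlace K) :
    logExt (v + v') w = logExt v w + logExt v' w := by
  unfold logExt
  split_ifs
  · rfl
  · simp [Finset.sum_add_distrib]; ring

theorem sum_logExt (v : logSpace K) : ∑ w, logExt v w = 0 := by
  rw [Fintype.sum_eq_add_sum_subtype_ne _ w₀]
  have : ∀ i : {w : InfinitePlace K // w ≠ w₀}, logExt v i = v i := by
    intro i
    simp [logExt, i.2]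
  simp_rw [this]
  simp [logExt]

theorem logExt_logEmbedding (u : (𝓞 K)ˣ) (w : InfinitePlace K) :
    logExt (logEmbedding K (Additive.ofMul u)) w = mult w * Real.log (w (u : K)) := by
  unfold logExt
  split_ifs with h
  · rfl
  · rw [not_not] at h
    rw [sum_logEmbedding_component, h]; ring

/-- The positive vector with logarithm determined by `v`. -/
noncomputable def boxShape (v : logSpace K) (w : InfinitePlace K) : NNReal :=
  ⟨Real.exp (-(logExt v w) / mult w), (Real.exp_pos _).le⟩

theorem prod_boxShape (v : logSpace K) : ∏ w, boxShape v w ^ mult w = 1 := by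
  rw [← NNReal.coe_inj]
  push_cast
  have : ∀ w : InfinitePlace K, (boxShape v w : ℝ) ^ mult w = Real.exp (-(logExt v w)) := by
    intro w
    change Real.exp _ ^ _ = _
    rw [← Real.exp_nat_mul, mul_div_cancel₀]
    exact_mod_cast mult_coe_ne_zero
  simp_rw [this, ← Real.exp_sum, Finset.sum_neg_distrib, sum_logExt, neg_zero, Real.exp_zero]

theorem lt_mul_boxShape_iff {x : K} (hx : x ≠ 0) {c : ℝ} (hc : 0 < c) (v : logSpace K)
    (w : InfinitePlace K) :
    w x < c * boxShape v w ↔ mult w * Real.log (w x) + logExt v w < mult w * Real.log c := by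
  have hx' : 0 < w x := pos_iff.mpr hx
  have hm : (0 : ℝ) < mult w := by exact_mod_cast mult_pos
  change w x < c * Real.exp _ ↔ _
  rw [← Real.log_lt_log_iff hx' (by positivity), Real.log_mul hc.ne' (Real.exp_pos _).ne',
    Real.log_exp, ← mul_lt_mul_iff_right₀ hm, mul_add, mul_div_cancel₀ _ hm.ne']
  constructor <;> intro h <;> linarith

variable (K) in
/-- The volume of a simplex in the logarithmic space. -/
noncomputable def simplexVol (y : ℝ) : ENNReal :=
  volume {v : logSpace K | (∀ w, v w < 0) ∧ -∑ w, v w < y}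

theorem sum_mult_mul_log_eq {x : 𝓞 K} (hx : x ≠ 0) :
    ∑ w : InfinitePlace K, mult w * Real.log (w (x : K)) =
      Real.log (Ideal.absNorm (Ideal.span {x})) := by
  have hx' : (x : K) ≠ 0 := by simpa using hx
  have h1 := prod_eq_abs_norm (x : K)
  have : (Ideal.absNorm (Ideal.span {x}) : ℝ) = ∏ w : InfinitePlace K, w (x : K) ^ mult w := by
    rw [h1, Ideal.absNorm_span_singleton, ← Algebra.coe_norm_int, Nat.cast_natAbs]
    push_cast
    rfl
  rw [this, Real.log_prod]
  · simp
  · exact fun w _ ↦ pow_ne_zero _ (by simpa using hx)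

theorem lintegral_box_eq {x : 𝓞 K} (hx : x ≠ 0) {c : ℝ} (hc : 0 < c) :
    ∫⁻ v : logSpace K, (if ∀ w : InfinitePlace K, w (x : K) < c * boxShape v w then 1 else 0) =
      simplexVol K (finrank ℚ K * Real.log c - Real.log (Ideal.absNorm (Ideal.span {x}))) := by
  have hx' : (x : K) ≠ 0 := by simpa using hx
  let b : InfinitePlace K → ℝ := fun w ↦ mult w * Real.log c - mult w * Real.log (w (x : K))
  have hb : ∑ w, b w =
      finrank ℚ K * Real.log c - Real.log (Ideal.absNorm (Ideal.span {x})) := by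
    simp only [b]
    rw [Finset.sum_sub_distrib, sum_mult_mul_log_eq hx, ← Finset.sum_mul, ← Nat.cast_sum,
      sum_mult_eq]
  let b' : logSpace K := fun w ↦ b w
  let S := {v : logSpace K | (∀ w, v w < 0) ∧ -∑ w, v w < ∑ w, b w}
  have hS : MeasurableSet S := by
    have : S = (⋂ w, {v : logSpace K | v w < 0}) ∩ {v : logSpace K | -∑ w, v w < ∑ w, b w} := by
      ext v
      simp [S]
    rw [this]
    refine (MeasurableSet.inter ?_ ?_)
    · exact MeasurableSet.iInter fun w ↦ measurableSet_lt (measurable_pi_apply w) measurable_const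
    · refine measurableSet_lt (Measurable.neg (f := fun v : logSpace K ↦ ∑ w, v w) ?_) measurable_const
      exact Finset.measurable_sum _ fun i _ ↦ measurable_pi_apply i
  rw [← hb]
  have hcond : ∀ v : logSpace K, (∀ w : InfinitePlace K, w (x : K) < c * boxShape v w) ↔
      v - b' ∈ S := by
    intro v
    simp_rw [lt_mul_boxShape_iff hx' hc]
    have h0 : ∑ w, b w = b w₀ + ∑ w, b' w := Fintype.sum_eq_add_sum_subtype_ne _ w₀
    constructor
    · intro h
      refine ⟨fun w ↦ ?_, ?_⟩
      · have := h w
        simp only [logExt, w.2, ne_eq, not_false_eq_true, dite_true] at this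
        simp only [Pi.sub_apply, b', b]
        linarith
      · have := h w₀
        simp only [logExt, ne_eq, not_true_eq_false, dite_false] at this
        simp only [Pi.sub_apply, Finset.sum_sub_distrib]
        rw [h0]
        simp only [b]
        linarith
    · rintro ⟨h1, h2⟩ w
      by_cases hw : w = w₀
      · subst hw
        simp only [logExt, ne_eq, not_true_eq_false, dite_false]
        simp only [Pi.sub_apply, Finset.sum_sub_distrib] at h2
        rw [h0] at h2
        simp only [b] at h2
        linarith
      · have := h1 ⟨w, hw⟩
        simp only [logExt, hw, ne_eq, not_false_eq_true, dite_true]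
        simp only [Pi.sub_apply, b', b] at this
        linarith
  calc _ = ∫⁻ v : logSpace K, S.indicator 1 (v - b') := by
        refine lintegral_congr fun v ↦ ?_
        rw [Set.indicator_apply]
        exact if_congr (hcond v) rfl rfl
    _ = ∫⁻ v : logSpace K, S.indicator 1 v :=
        lintegral_sub_right_eq_self (fun v ↦ S.indicator (1 : logSpace K → ENNReal) v) b'
    _ = volume S := lintegral_indicator_one hS

theorem tsum_units_lintegral_box_eq {F : Set (logSpace K)}
    (hF : IsAddFundamentalDomain (unitLattice K).toAddSubgroup F) {x : 𝓞 K} (hx : x ≠ 0) {c : ℝ} (hc : 0 < c) :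
    ∑' u : (𝓞 K)ˣ, ∫⁻ v in F, (if ∀ w : InfinitePlace K,
      w ((x * u : 𝓞 K) : K) < c * boxShape v w then 1 else 0) =
      torsionOrder K * simplexVol K
        (finrank ℚ K * Real.log c - Real.log (Ideal.absNorm (Ideal.span {x}))) := by
  have hx' : (x : K) ≠ 0 := by simpa using hx
  let f : logSpace K → ENNReal := fun v ↦
    if ∀ w : InfinitePlace K, w (x : K) < c * boxShape v w then 1 else 0
  have hf : ∀ (u : (𝓞 K)ˣ) (v : logSpace K), (if ∀ w : InfinitePlace K,
      w ((x * u : 𝓞 K) : K) < c * boxShape v w then (1 : ENNReal) else 0) =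
        f (logEmbedding K (Additive.ofMul u) + v) := by
    intro u v
    refine if_congr (forall_congr' fun w ↦ ?_) rfl rfl
    have hxu : ((x * u : 𝓞 K) : K) ≠ 0 := by simp [hx]
    rw [lt_mul_boxShape_iff hxu hc, lt_mul_boxShape_iff hx' hc, logExt_add, logExt_logEmbedding,
      show ((x * u : 𝓞 K) : K) = (x : K) * ((u : 𝓞 K) : K) from map_mul (algebraMap (𝓞 K) K) _ _,
      map_mul w, Real.log_mul]
    · rw [mul_add, add_assoc]
    · simpa using hx
    · simp
  simp_rw [hf]
  let φ : Additive (𝓞 K)ˣ →+ (unitLattice K).toAddSubgroup :=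
    (logEmbedding K).codRestrict (unitLattice K).toAddSubgroup
      (fun u ↦ Submodule.mem_map.mpr ⟨u, trivial, rfl⟩)
  have hφ : Function.Surjective φ := by
    rintro ⟨v, hv⟩
    obtain ⟨u, -, hu⟩ := Submodule.mem_map.mp hv
    exact ⟨u, Subtype.ext hu⟩
  have hker : φ.ker = (torsion K).toAddSubgroup := by
    rw [← logEmbedding_ker]
    ext u
    simp only [AddMonoidHom.mem_ker, φ]
    exact Subtype.ext_iff
  have hcard : Nat.card φ.ker = torsionOrder K := by
    rw [hker]; rfl
  have : Finite φ.ker := by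
    rw [hker]; exact (inferInstance : Finite (torsion K))
  have h1 := AddMonoidHom.tsum_comp_eq_card_ker_mul φ hφ (fun l ↦ ∫⁻ v in F, f (l + v))
  rw [hcard] at h1
  have h2 : ∑' u : (𝓞 K)ˣ, ∫⁻ v in F, f (logEmbedding K (Additive.ofMul u) + v) =
    ∑' u : Additive (𝓞 K)ˣ, ∫⁻ v in F, f ((φ u : logSpace K) + v) := rfl
  have : Countable (unitLattice K).toAddSubgroup :=
    (inferInstance : Countable (unitLattice K))
  rw [h2, h1, ← lintegral_box_eq hx hc]
  congr 1
  exact (hF.lintegral_eq_tsum'' f).symm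

end Unfolding

section ClassSum

open NumberField.mixedEmbedding NumberField.InfinitePlace MeasureTheory Module
  NumberField.Units NumberField.Units.dirichletUnitTheorem
open scoped nonZeroDivisors

variable {K : Type*} [Field K] [NumberField K]

variable (K) in
theorem exists_isAddFundamentalDomain_unitLattice :
    ∃ F : Set (logSpace K), IsAddFundamentalDomain (unitLattice K).toAddSubgroup F ∧
      volume F = ENNReal.ofReal (regulator K) := by
  let b := Free.chooseBasis ℤ (unitLattice K)
  let F := ZSpan.fundamentalDomain (b.ofZLatticeBasis ℝ)
  have hF : IsAddFundamentalDomain (unitLattice K) F := ZLattice.isAddFundamentalDomain b volume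
  refine ⟨F, hF, ?_⟩
  rw [regulator, ZLattice.covolume_eq_measure_fundamentalDomain _ _ hF, measureReal_def,
    ENNReal.ofReal_toReal]
  exact (Bornology.IsBounded.measure_lt_top (ZSpan.fundamentalDomain_isBounded _)).ne

theorem continuous_boxShape (w : InfinitePlace K) :
    Continuous fun v : logSpace K ↦ (boxShape v w : ℝ) := by
  change Continuous fun v : logSpace K ↦ Real.exp (-(logExt v w) / mult w)
  refine Real.continuous_exp.comp (Continuous.div_const (Continuous.neg ?_) _)
  unfold logExt
  split_ifs <;> fun_prop

theorem measurableSet_box (x : K) (c : ℝ) :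
    MeasurableSet {v : logSpace K | ∀ w : InfinitePlace K, w x < c * boxShape v w} := by
  have : {v : logSpace K | ∀ w : InfinitePlace K, w x < c * boxShape v w} =
      ⋂ w, {v : logSpace K | w x < c * boxShape v w} := by ext v; simp
  rw [this]
  refine MeasurableSet.iInter fun w ↦ (isOpen_lt continuous_const ?_).measurableSet
  exact continuous_const.mul (continuous_boxShape w)

theorem measurable_box (x : K) (c : ℝ) : Measurable fun v : logSpace K ↦
    (if ∀ w : InfinitePlace K, w x < c * boxShape v w then 1 else 0 : ENNReal) :=
  Measurable.ite (measurableSet_box x c) measurable_const measurable_const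

theorem exists_generator_equiv {R : Type*} [CommRing R] [IsDedekindDomain R] (J : (Ideal R)⁰) :
    ∃ (x : {a : (Ideal R)⁰ // ((J : Ideal R) * (a : Ideal R)).IsPrincipal} → R),
      (∀ a, x a ≠ 0 ∧ Ideal.span {x a} = (J : Ideal R) * (a.1 : Ideal R)) ∧
      ∃ e : {a : (Ideal R)⁰ // ((J : Ideal R) * (a : Ideal R)).IsPrincipal} × Rˣ ≃
        ({0}ᶜ : Set ↥(J : Ideal R)), ∀ p, ((e p).1 : R) = x p.1 * p.2 := by
  have hprin : ∀ a : {a : (Ideal R)⁰ // ((J : Ideal R) * (a : Ideal R)).IsPrincipal},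
      ∃ x : R, Ideal.span {x} = (J : Ideal R) * (a.1 : Ideal R) := by
    rintro ⟨a, ha⟩
    obtain ⟨x, hx⟩ := ha.principal
    exact ⟨x, hx.symm⟩
  choose x hx using hprin
  have hx0 : ∀ a, x a ≠ 0 := by
    intro a h
    have := hx a
    rw [h, Ideal.span_singleton_zero] at this
    exact mul_ne_zero (nonZeroDivisors.coe_ne_zero J) (nonZeroDivisors.coe_ne_zero a.1) this.symm
  have hmem : ∀ a, x a ∈ (J : Ideal R) := by
    intro a
    have : x a ∈ (J : Ideal R) * (a.1 : Ideal R) := by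
      rw [← hx a]
      exact Ideal.mem_span_singleton_self _
    exact Ideal.mul_le_left this
  let e : {a : (Ideal R)⁰ // ((J : Ideal R) * (a : Ideal R)).IsPrincipal} × Rˣ →
      ({0}ᶜ : Set ↥(J : Ideal R)) := fun p ↦
    ⟨⟨x p.1 * p.2, Ideal.mul_mem_right _ _ (hmem p.1)⟩, by
      simp [hx0 p.1]⟩
  have he : Function.Bijective e := by
    constructor
    · rintro ⟨a, u⟩ ⟨a', u'⟩ h
      have h' : x a * u = x a' * u' := congrArg (fun z ↦ ((z.1 : ↥(J : Ideal R)) : R)) h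
      have hs : Ideal.span {x a} = Ideal.span {x a'} := by
        rw [← Ideal.span_singleton_mul_right_unit u.isUnit, h',
          Ideal.span_singleton_mul_right_unit u'.isUnit]
      have haa : a = a' := by
        rw [hx, hx] at hs
        have := mul_left_cancel₀ (nonZeroDivisors.coe_ne_zero J) hs
        exact Subtype.ext (Subtype.ext this)
      subst haa
      congr 1
      exact Units.ext (mul_left_cancel₀ (hx0 a) h')
    · rintro ⟨⟨y, hyJ⟩, hy0⟩
      have hy0' : y ≠ 0 := by
        rintro rfl
        exact hy0 rfl
      obtain ⟨a, ha⟩ := Ideal.dvd_span_singleton.mpr hyJ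
      have ha0 : a ≠ 0 := by
        rintro rfl
        rw [mul_zero] at ha
        exact hy0' (Ideal.span_singleton_eq_bot.mp ha)
      let a' : (Ideal R)⁰ := ⟨a, mem_nonZeroDivisors_of_ne_zero ha0⟩
      have ha1 : ((J : Ideal R) * (a' : Ideal R)).IsPrincipal := ⟨y, ha.symm⟩
      have : Ideal.span {x ⟨a', ha1⟩} = Ideal.span {y} := by
        rw [hx, ha]
      obtain ⟨u, hu⟩ := Ideal.span_singleton_eq_span_singleton.mp this
      exact ⟨⟨⟨a', ha1⟩, u⟩, Subtype.ext (Subtype.ext hu)⟩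
  exact ⟨x, fun a ↦ ⟨hx0 a, hx a⟩, Equiv.ofBijective e he, fun p ↦ rfl⟩

theorem exists_generator_tsum_eq {R : Type*} [CommRing R] [IsDedekindDomain R]
    (J : (Ideal R)⁰) :
    ∃ (x : {a : (Ideal R)⁰ // ((J : Ideal R) * (a : Ideal R)).IsPrincipal} → R),
      (∀ a, x a ≠ 0 ∧ Ideal.span {x a} = (J : Ideal R) * (a.1 : Ideal R)) ∧
      ∀ f : R → ENNReal, ∑' y : ↥(J : Ideal R), f y = f 0 + ∑' a, ∑' u : Rˣ, f (x a * u) := by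
  obtain ⟨x, hx, e, he⟩ := exists_generator_equiv J
  refine ⟨x, hx, fun f ↦ ?_⟩
  let g : ↥(J : Ideal R) → ENNReal := fun y ↦ f y
  have h1 : ∑' y : ({0} : Set ↥(J : Ideal R)), g y = f 0 :=
    tsum_singleton (0 : ↥(J : Ideal R)) g
  have h2 : ∑' y : ({0}ᶜ : Set ↥(J : Ideal R)), g y = ∑' a, ∑' u : Rˣ, f (x a * u) := by
    rw [← e.tsum_eq, ENNReal.tsum_prod']
    simp only [g, he]
  rw [← h1, ← h2]
  have h3 := ENNReal.summable.tsum_add_tsum_compl (f := g) (s := {0}) ENNReal.summable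
  exact h3.symm

theorem lintegral_boxCount_eq {F : Set (logSpace K)}
    (hF : IsAddFundamentalDomain (unitLattice K).toAddSubgroup F) (J : (Ideal (𝓞 K))⁰)
    {t : NNReal} (ht : 0 < t) :
    ∫⁻ v in F, boxCount (J : Ideal (𝓞 K)) (boxShape v) t = volume F +
      ∑' a : {a : (Ideal (𝓞 K))⁰ // ((J : Ideal (𝓞 K)) * (a : Ideal (𝓞 K))).IsPrincipal},
        torsionOrder K * simplexVol K (finrank ℚ K * Real.log t - Real.log (Ideal.absNorm (a.1 : Ideal (𝓞 K)))) := by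
  set n : NNReal := (Ideal.absNorm (J : Ideal (𝓞 K)) : NNReal) with hn
  have hn0 : 0 < n := by
    rw [hn, pos_iff_ne_zero]
    simpa [Ideal.absNorm_eq_zero_iff] using nonZeroDivisors.coe_ne_zero J
  set c : ℝ := n ^ (1 / finrank ℚ K : ℝ) * t with hc
  have hc0 : 0 < c := by positivity
  have hd : (finrank ℚ K : ℝ) ≠ 0 := by exact_mod_cast finrank_pos.ne'
  have hlogc : finrank ℚ K * Real.log c = Real.log n + finrank ℚ K * Real.log t := by
    have hn1 : (0 : ℝ) < n := NNReal.coe_pos.mpr hn0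
    have ht1 : (0 : ℝ) < t := NNReal.coe_pos.mpr ht
    rw [hc, Real.log_mul (Real.rpow_pos_of_pos hn1 _).ne' ht1.ne', Real.log_rpow hn1, mul_add,
      ← mul_assoc, mul_one_div_cancel hd, one_mul]
  have : Countable (𝓞 K) := (RingOfIntegers.basis K).equivFun.injective.countable
  let f : 𝓞 K → ENNReal := fun x ↦ ∫⁻ v in F,
    (if ∀ w : InfinitePlace K, w (x : K) < c * boxShape v w then 1 else 0)
  have h1 : ∫⁻ v in F, boxCount (J : Ideal (𝓞 K)) (boxShape v) t =
      ∑' x : ↥(J : Ideal (𝓞 K)), f x :=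
    lintegral_tsum fun x ↦ (measurable_box _ _).aemeasurable
  obtain ⟨x, hx, h2⟩ := exists_generator_tsum_eq J
  rw [h1, h2 f]
  congr 1
  · have hpos : ∀ (v : logSpace K) (w : InfinitePlace K), 0 < boxShape v w := fun v w ↦
      Real.exp_pos _
    have : ∀ v : logSpace K, ∀ w : InfinitePlace K,
        w ((0 : 𝓞 K) : K) < c * boxShape v w := by
      intro v w
      simpa using mul_pos hc0 (NNReal.coe_pos.mpr (hpos v w))
    simp only [f, if_pos (this _)]
    simp
  · refine tsum_congr fun a ↦ ?_
    have h := tsum_units_lintegral_box_eq hF (hx a).1 hc0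
    rw [(hx a).2, hlogc, map_mul] at h
    have ha : (Ideal.absNorm (a.1 : Ideal (𝓞 K)) : ℝ) ≠ 0 := by
      simpa [Ideal.absNorm_eq_zero_iff] using nonZeroDivisors.coe_ne_zero a.1
    have hn' : ((Ideal.absNorm (J : Ideal (𝓞 K)) : ℕ) : ℝ) = n := by simp [hn]
    rw [Nat.cast_mul, hn', Real.log_mul (by positivity) ha, add_sub_add_left_eq_sub] at h
    rw [← h]

variable (K) in
/-- The sum of `simplexVol K (y - log (N a))` over all nonzero ideals `a`. -/
noncomputable def idealSimplexSum (y : ℝ) : ENNReal :=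
  ∑' a : (Ideal (𝓞 K))⁰, simplexVol K (y - Real.log (Ideal.absNorm (a : Ideal (𝓞 K))))

theorem sum_lintegral_boxCount_eq {F : Set (logSpace K)}
    (hF : IsAddFundamentalDomain (unitLattice K).toAddSubgroup F)
    {J : ClassGroup (𝓞 K) → (Ideal (𝓞 K))⁰} (hJ : ∀ C, ClassGroup.mk0 (J C) = C)
    {t : NNReal} (ht : 0 < t) :
    ∑ C, ∫⁻ v in F, boxCount (J C : Ideal (𝓞 K)) (boxShape v) t = classNumber K * volume F +
      torsionOrder K * idealSimplexSum K (finrank ℚ K * Real.log t) := by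
  simp_rw [lintegral_boxCount_eq hF _ ht]
  rw [Finset.sum_add_distrib, Finset.sum_const, Finset.card_univ, nsmul_eq_mul]
  congr 1
  simp_rw [ENNReal.tsum_mul_left]
  rw [← Finset.mul_sum, idealSimplexSum]
  congr 1
  have key : ∀ I a : (Ideal (𝓞 K))⁰, ((I : Ideal (𝓞 K)) * (a : Ideal (𝓞 K))).IsPrincipal ↔
      ClassGroup.mk0 I = (ClassGroup.mk0 a)⁻¹ := by
    intro I a
    rw [← mul_eq_one_iff_eq_inv, ← map_mul]
    exact (ClassGroup.mk0_eq_one_iff (I * a).2).symm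
  let e : (Σ C, {a : (Ideal (𝓞 K))⁰ // ((J C : Ideal (𝓞 K)) * (a : Ideal (𝓞 K))).IsPrincipal}) ≃ (Ideal (𝓞 K))⁰ :=
    { toFun := fun p ↦ p.2.1
      invFun := fun a ↦ ⟨(ClassGroup.mk0 a)⁻¹, a, by rw [key, hJ]⟩
      left_inv := by
        rintro ⟨C, a, ha⟩
        rw [key, hJ] at ha
        obtain rfl := ha
        rfl
      right_inv := fun a ↦ rfl }
  rw [← e.tsum_eq, ENNReal.tsum_sigma', tsum_fintype]
  rfl

theorem idealSimplexSum_bounds {t : NNReal} (ht : 0 < t) :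
    (classNumber K * ENNReal.ofReal (regulator K) +
      torsionOrder K * idealSimplexSum K (finrank ℚ K * Real.log t)) * NNReal.sqrt ‖discr K‖₊ ≤
      classNumber K * ENNReal.ofReal (regulator K) *
        (boxFactor K * (t + coverBound K) ^ finrank ℚ K) ∧
    classNumber K * ENNReal.ofReal (regulator K) * (boxFactor K * t ^ finrank ℚ K : ENNReal) ≤
      (classNumber K * ENNReal.ofReal (regulator K) +
        torsionOrder K * idealSimplexSum K (finrank ℚ K * Real.log (t + coverBound K))) *
          NNReal.sqrt ‖discr K‖₊ := by
  obtain ⟨F, hF, hvF⟩ := exists_isAddFundamentalDomain_unitLattice K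
  choose J hJ using ClassGroup.mk0_surjective (R := 𝓞 K)
  have hcard : (classNumber K : ENNReal) = ∑ _C : ClassGroup (𝓞 K), 1 := by
    simp [classNumber]
  have ht' : 0 < t + coverBound K := by positivity
  have h2 := sum_lintegral_boxCount_eq hF hJ ht'
  rw [NNReal.coe_add] at h2
  rw [← hvF, ← sum_lintegral_boxCount_eq hF hJ ht, ← h2]
  simp_rw [hcard, Finset.sum_mul, one_mul]
  have hs : (NNReal.sqrt ‖discr K‖₊ : ENNReal) ≠ ⊤ := by simp
  constructor
  · refine Finset.sum_le_sum fun C _ ↦ ?_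
    rw [← lintegral_mul_const' _ _ hs, mul_comm (volume F), ← setLIntegral_const]
    exact lintegral_mono fun v ↦ (boxCount_bounds (nonZeroDivisors.coe_ne_zero (J C))
      (prod_boxShape v) t).1
  · refine Finset.sum_le_sum fun C _ ↦ ?_
    rw [← lintegral_mul_const' _ _ hs, mul_comm (volume F), ← setLIntegral_const]
    exact lintegral_mono fun v ↦ (boxCount_bounds (nonZeroDivisors.coe_ne_zero (J C))
      (prod_boxShape v) t).2

end ClassSum

section LaplaceTransform

open NumberField.mixedEmbedding NumberField.InfinitePlace MeasureTheory Module Set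
  NumberField.Units NumberField.Units.dirichletUnitTheorem
open scoped nonZeroDivisors

variable {K : Type*} [Field K] [NumberField K]

theorem simplexVol_mono : Monotone (simplexVol K) := fun _ _ h ↦
  measure_mono fun _ hv ↦ ⟨hv.1, hv.2.trans_le h⟩

theorem pow_le_simplexVol {y : ℝ} (hy : 0 < y) :
    ENNReal.ofReal ((y / (rank K + 1)) ^ rank K) ≤ simplexVol K y := by
  have hcard : Fintype.card {w : InfinitePlace K // w ≠ w₀} = rank K := by
    rw [rank, Fintype.card_subtype_compl, Fintype.card_subtype_eq]
  have h1 : (univ.pi fun _ : {w : InfinitePlace K // w ≠ w₀} ↦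
      Ioo (-(y / (rank K + 1))) 0) ⊆ {v : logSpace K | (∀ w, v w < 0) ∧ -∑ w, v w < y} := by
    intro v hv
    refine ⟨fun w ↦ (hv w (mem_univ _)).2, ?_⟩
    have : ∑ w, -v w ≤ ∑ _w : {w : InfinitePlace K // w ≠ w₀}, y / (rank K + 1) :=
      Finset.sum_le_sum fun w _ ↦ by linarith [(hv w (mem_univ _)).1]
    rw [Finset.sum_const, Finset.card_univ, hcard, nsmul_eq_mul, Finset.sum_neg_distrib] at this
    refine this.trans_lt ?_
    rw [mul_div_assoc', div_lt_iff₀ (by positivity)]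
    nlinarith
  refine le_trans (le_of_eq ?_) (measure_mono h1)
  rw [volume_pi_pi]
  simp only [Real.volume_Ioo, sub_neg_eq_add, zero_add, Finset.prod_const, Finset.card_univ, hcard]
  rw [ENNReal.ofReal_pow (by positivity)]

theorem lintegral_Ioi_rpow_neg_sub_one {c s : ℝ} (hc : 0 < c) (hs : 0 < s) :
    ∫⁻ x in Ioi c, ENNReal.ofReal (x ^ (-s - 1)) = ENNReal.ofReal (c ^ (-s) / s) := by
  rw [← ofReal_integral_eq_lintegral_ofReal]
  · rw [integral_Ioi_rpow_of_lt (by linarith) hc]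
    congr 1
    rw [sub_add_cancel]
    field_simp
  · exact integrableOn_Ioi_rpow_of_lt (by linarith) hc
  · filter_upwards [ae_restrict_mem measurableSet_Ioi] with x hx
    exact Real.rpow_nonneg (hc.trans hx).le _

theorem lintegral_logSpace_exp {s : ℝ} (hs : 0 < s) :
    ∫⁻ v : logSpace K, (if ∀ w, v w < 0 then ENNReal.ofReal (Real.exp (s * ∑ w, v w)) else 0) =
      ENNReal.ofReal ((s ^ rank K)⁻¹) := by
  have hcard : Fintype.card {w : InfinitePlace K // w ≠ w₀} = rank K := by
    rw [rank, Fintype.card_subtype_compl, Fintype.card_subtype_eq]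
  let g : ℝ → ℝ := (Iio 0).indicator fun x ↦ Real.exp (s * x)
  have hg : Integrable g := by
    rw [integrable_indicator_iff measurableSet_Iio]
    exact (integrableOn_exp_mul_Iic hs 0).mono_set Iio_subset_Iic_self
  have hg0 : ∀ x, 0 ≤ g x := fun x ↦ indicator_nonneg (fun _ _ ↦ (Real.exp_pos _).le) _
  have hgi : ∫ x, g x = s⁻¹ := by
    rw [integral_indicator measurableSet_Iio, ← integral_Iic_eq_integral_Iio,
      integral_exp_mul_Iic hs]
    simp
  have h : ∀ v : logSpace K, (if ∀ w, v w < 0 then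
      ENNReal.ofReal (Real.exp (s * ∑ w, v w)) else 0) = ENNReal.ofReal (∏ w, g (v w)) := by
    intro v
    split_ifs with hv
    · congr 1
      rw [Finset.mul_sum, Real.exp_sum]
      refine Finset.prod_congr rfl fun w _ ↦ ?_
      exact (indicator_of_mem (s := Iio (0 : ℝ)) (hv w) fun x ↦ Real.exp (s * x)).symm
    · push Not at hv
      obtain ⟨w, hw⟩ := hv
      have : g (v w) = 0 := indicator_of_notMem (by simpa using hw) _
      rw [Finset.prod_eq_zero (Finset.mem_univ w) this, ENNReal.ofReal_zero]
  simp_rw [h]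
  rw [← ofReal_integral_eq_lintegral_ofReal]
  · congr 1
    have := integral_fintype_prod_volume_eq_prod (ι := {w : InfinitePlace K // w ≠ w₀})
      (fun _ ↦ g)
    rw [this]
    simp [hgi, hcard]
  · exact Integrable.fintype_prod fun _ ↦ hg
  · exact Filter.Eventually.of_forall fun v ↦ Finset.prod_nonneg fun w _ ↦ hg0 _

theorem lintegral_simplexVol_mul_rpow {N s : ℝ} (hN : 1 ≤ N) (hs : 0 < s) :
    ∫⁻ x in Ioi 1, simplexVol K (Real.log x - Real.log N) * ENNReal.ofReal (x ^ (-s - 1)) =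
      ENNReal.ofReal (N ^ (-s)) * ENNReal.ofReal ((s ^ (rank K + 1))⁻¹) := by
  have hN0 : 0 < N := one_pos.trans_le hN
  let S : Set (ℝ × logSpace K) :=
    {p | (∀ w, p.2 w < 0) ∧ -∑ w, p.2 w < Real.log p.1 - Real.log N}
  have hS : MeasurableSet S := by
    have h2 : MeasurableSet {p : ℝ × logSpace K |
        -∑ w, p.2 w < Real.log p.1 - Real.log N} :=
      measurableSet_lt (by fun_prop) (by fun_prop)
    have h3 : MeasurableSet (⋂ w, {p : ℝ × logSpace K | p.2 w < 0}) :=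
      MeasurableSet.iInter fun w ↦ measurableSet_lt (by fun_prop) (by fun_prop)
    convert h3.inter h2
    ext p
    simp [S]
  have h1 : ∀ x : ℝ, simplexVol K (Real.log x - Real.log N) * ENNReal.ofReal (x ^ (-s - 1)) =
      ∫⁻ v : logSpace K, S.indicator (fun p ↦ ENNReal.ofReal (p.1 ^ (-s - 1))) (x, v) := by
    intro x
    have : ∀ v : logSpace K, S.indicator (fun p ↦ ENNReal.ofReal (p.1 ^ (-s - 1))) (x, v) =
        (Prod.mk x ⁻¹' S).indicator (fun _ ↦ ENNReal.ofReal (x ^ (-s - 1))) v := fun v ↦ rfl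
    simp_rw [this]
    rw [lintegral_indicator_const (measurable_prodMk_left hS), mul_comm]
    rfl
  simp_rw [h1]
  rw [lintegral_lintegral_swap]
  · have h2 : ∀ v : logSpace K, ∫⁻ x in Ioi 1,
        S.indicator (fun p ↦ ENNReal.ofReal (p.1 ^ (-s - 1))) (x, v) =
        ENNReal.ofReal (N ^ (-s) / s) *
          if ∀ w, v w < 0 then ENNReal.ofReal (Real.exp (s * ∑ w, v w)) else 0 := by
      intro v
      split_ifs with hv
      · set c := N * Real.exp (-∑ w, v w) with hc
        have hc0 : 0 < c := by positivity
        have hc1 : 1 ≤ c := by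
          refine one_le_mul_of_one_le_of_one_le hN (Real.one_le_exp ?_)
          exact neg_nonneg.mpr (Finset.sum_nonpos fun w _ ↦ (hv w).le)
        have : ∀ x ∈ Ioi (1 : ℝ), S.indicator (fun p ↦ ENNReal.ofReal (p.1 ^ (-s - 1))) (x, v) =
            (Ioi c).indicator (fun x ↦ ENNReal.ofReal (x ^ (-s - 1))) x := by
          intro x hx
          have hx0 : (0 : ℝ) < x := one_pos.trans hx
          have hiff : (x, v) ∈ S ↔ x ∈ Ioi c := by
            rw [mem_Ioi, ← Real.log_lt_log_iff hc0 hx0, hc,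
              Real.log_mul hN0.ne' (Real.exp_pos _).ne', Real.log_exp]
            change ((∀ w, v w < 0) ∧ -∑ w, v w < Real.log x - Real.log N) ↔ _
            rw [and_iff_right hv, lt_sub_iff_add_lt, add_comm]
          simp only [indicator, hiff]
        rw [setLIntegral_congr_fun measurableSet_Ioi this, lintegral_indicator measurableSet_Ioi,
          Measure.restrict_restrict measurableSet_Ioi,
          inter_eq_left.mpr (Ioi_subset_Ioi hc1), lintegral_Ioi_rpow_neg_sub_one hc0 hs,
          ← ENNReal.ofReal_mul (by positivity)]
        congr 1
        rw [hc, Real.mul_rpow hN0.le (Real.exp_pos _).le, ← Real.exp_mul]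
        rw [show -(∑ w, v w) * -s = s * ∑ w, v w by ring]
        ring
      · have : ∀ x, S.indicator (fun p ↦ ENNReal.ofReal (p.1 ^ (-s - 1))) (x, v) = 0 := fun x ↦
          indicator_of_notMem (fun h ↦ hv h.1) _
        simp [this]
    simp_rw [h2]
    rw [lintegral_const_mul', lintegral_logSpace_exp hs, ← ENNReal.ofReal_mul (by positivity),
      ← ENNReal.ofReal_mul (by positivity)]
    · congr 1
      field_simp
      ring
    · simp
  · exact (Measurable.indicator (by fun_prop) hS).aemeasurable

variable (K) in
/-- The Dedekind zeta function at a real argument, as an extended nonnegative number. -/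
noncomputable def zetaSum (s : ℝ) : ENNReal :=
  ∑' a : (Ideal (𝓞 K))⁰, ENNReal.ofReal ((Ideal.absNorm (a : Ideal (𝓞 K)) : ℝ) ^ (-s))

theorem one_le_absNorm_nonZeroDivisors (a : (Ideal (𝓞 K))⁰) :
    (1 : ℝ) ≤ Ideal.absNorm (a : Ideal (𝓞 K)) := by
  rw [Nat.one_le_cast, Nat.one_le_iff_ne_zero]
  simpa [Ideal.absNorm_eq_zero_iff] using nonZeroDivisors.coe_ne_zero a

instance countable_nonZeroDivisors_ideal : Countable (Ideal (𝓞 K))⁰ := by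
  have h0 : Countable (𝓞 K) := (RingOfIntegers.basis K).equivFun.injective.countable
  have h1 : Function.Surjective fun s : Finset (𝓞 K) ↦ Ideal.span (s : Set (𝓞 K)) := fun I ↦
    (isNoetherian_def.mp inferInstance I)
  have := h1.countable
  infer_instance

theorem idealSimplexSum_mono : Monotone (idealSimplexSum K) := fun _ _ h ↦
  ENNReal.tsum_le_tsum fun _ ↦ simplexVol_mono (sub_le_sub_right h _)

theorem lintegral_idealSimplexSum_mul_rpow {s : ℝ} (hs : 0 < s) :
    ∫⁻ x in Ioi 1, idealSimplexSum K (Real.log x) * ENNReal.ofReal (x ^ (-s - 1)) =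
      zetaSum K s * ENNReal.ofReal ((s ^ (rank K + 1))⁻¹) := by
  simp_rw [idealSimplexSum, ← ENNReal.tsum_mul_right]
  rw [lintegral_tsum fun a ↦ Measurable.aemeasurable ?_]
  · simp_rw [lintegral_simplexVol_mul_rpow (one_le_absNorm_nonZeroDivisors _) hs]
    rw [ENNReal.tsum_mul_right]
    rfl
  · exact (simplexVol_mono.measurable.comp (by fun_prop)).mul (by fun_prop)

theorem simplexVol_le_idealSimplexSum (y : ℝ) : simplexVol K y ≤ idealSimplexSum K y := by
  refine le_trans (le_of_eq ?_) (ENNReal.le_tsum (1 : (Ideal (𝓞 K))⁰))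
  simp

end LaplaceTransform

section Counting

open NumberField.mixedEmbedding NumberField.InfinitePlace MeasureTheory Module Set
  NumberField.Units NumberField.Units.dirichletUnitTheorem
open scoped nonZeroDivisors

theorem add_pow_le_pow_add_mul_pow {u E : ℝ} (hu : 1 ≤ u) (hE : 0 ≤ E) (k : ℕ) :
    (u + E) ^ (k + 1) ≤ u ^ (k + 1) + ((1 + E) ^ (k + 1) - 1) * u ^ k := by
  induction k with
  | zero => simp
  | succ k ih =>
    have h1 : (1 : ℝ) ≤ (1 + E) ^ (k + 1) := one_le_pow₀ (by linarith)
    have hu0 : 0 ≤ u ^ k := by positivity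
    calc (u + E) ^ (k + 1 + 1) = (u + E) ^ (k + 1) * (u + E) := pow_succ _ _
      _ ≤ (u ^ (k + 1) + ((1 + E) ^ (k + 1) - 1) * u ^ k) * (u + E) :=
        mul_le_mul_of_nonneg_right ih (by linarith)
      _ = u ^ (k + 1 + 1) + ((1 + E) ^ (k + 1) - 1 + E) * u ^ (k + 1) +
        E * ((1 + E) ^ (k + 1) - 1) * u ^ k := by ring
      _ ≤ u ^ (k + 1 + 1) + ((1 + E) ^ (k + 1) - 1 + E) * u ^ (k + 1) +
        E * ((1 + E) ^ (k + 1) - 1) * u ^ (k + 1) := by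
        have : u ^ k ≤ u ^ (k + 1) := pow_le_pow_right₀ hu (by omega)
        have : 0 ≤ E * ((1 + E) ^ (k + 1) - 1) := mul_nonneg hE (by linarith)
        gcongr
      _ = _ := by ring

theorem pow_sub_le_sub_pow {u E : ℝ} (hu : 0 < u) (hE : E ≤ u) (k : ℕ) :
    u ^ (k + 1) - (k + 1) * E * u ^ k ≤ (u - E) ^ (k + 1) := by
  have h : -2 ≤ -(E / u) := by
    have : E / u ≤ 1 := (div_le_one hu).mpr hE
    linarith
  have := one_add_mul_le_pow h (k + 1)
  calc u ^ (k + 1) - (k + 1) * E * u ^ k = u ^ (k + 1) * (1 + ((k + 1 : ℕ) : ℝ) * -(E / u)) := by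
        push_cast
        field_simp
        ring
    _ ≤ u ^ (k + 1) * (1 + -(E / u)) ^ (k + 1) := by gcongr
    _ = (u - E) ^ (k + 1) := by
      rw [← mul_pow]
      congr 1
      field_simp
      ring

variable (K : Type*) [Field K] [NumberField K]

/-- The main term constant in the asymptotics of `idealSimplexSum`. -/
noncomputable def zetaDensity : ℝ :=
  classNumber K * regulator K * boxFactor K / (torsionOrder K * √|(discr K : ℝ)|)

/-- The relative error constant in the asymptotics of `idealSimplexSum`. -/
noncomputable def errConst : ℝ := (finrank ℚ K + 1) * (1 + coverBound K) ^ finrank ℚ K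

theorem abs_discr_real_pos : (0 : ℝ) < |(discr K : ℝ)| :=
  abs_pos.mpr (Int.cast_ne_zero.mpr (discr_ne_zero K))

theorem one_le_boxFactor : (1 : ℝ) ≤ boxFactor K := by
  have : (1 : NNReal) ≤ boxFactor K :=
    one_le_mul (one_le_convexBodyLTFactor K) (one_le_pow₀ (by norm_num))
  exact_mod_cast this

theorem zetaDensity_pos : 0 < zetaDensity K := by
  have h1 : (0 : ℝ) < classNumber K := by exact_mod_cast classNumber_pos K
  have h2 := regulator_pos K
  have h3 : (0 : ℝ) < torsionOrder K := by exact_mod_cast torsionOrder_pos K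
  have h4 := abs_discr_real_pos K
  have h5 := one_le_boxFactor K
  rw [zetaDensity]
  positivity

theorem sqrt_abs_discr_le_coverBound : √|(discr K : ℝ)| ≤ coverBound K := by
  have h2 : (NNReal.sqrt ‖discr K‖₊ : ℝ) = √|(discr K : ℝ)| := by
    rw [Real.coe_sqrt, coe_nnnorm, Int.norm_eq_abs]
  have h1 : (1 : NNReal) ≤ NNReal.sqrt ‖discr K‖₊ := by
    rw [← NNReal.coe_le_coe, h2]
    exact one_le_sqrt_abs_discr
  have h : NNReal.sqrt ‖discr K‖₊ ≤ coverBound K := by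
    rw [coverBound]
    have hd : (1 : NNReal) ≤ finrank ℚ K := by exact_mod_cast finrank_pos
    calc NNReal.sqrt ‖discr K‖₊ ≤ 2 ^ (finrank ℚ K + 2) * NNReal.sqrt ‖discr K‖₊ :=
          le_mul_of_one_le_left' (one_le_pow₀ (by norm_num))
      _ ≤ (2 ^ (finrank ℚ K + 2) * NNReal.sqrt ‖discr K‖₊) ^ finrank ℚ K :=
        le_self_pow₀ (one_le_mul (one_le_pow₀ (by norm_num)) h1) finrank_pos.ne'
      _ ≤ _ := le_mul_of_one_le_left' hd
  rw [← h2]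
  exact_mod_cast h

theorem two_le_errConst : 2 ≤ errConst K := by
  have hd : (1 : ℝ) ≤ finrank ℚ K := by exact_mod_cast finrank_pos
  have : (1 : ℝ) ≤ (1 + coverBound K) ^ finrank ℚ K :=
    one_le_pow₀ (by linarith [(coverBound K).coe_nonneg])
  rw [errConst]
  nlinarith

variable {K}

theorem toReal_idealSimplexSum_bounds {t : ℝ} (ht : 0 < t) :
    idealSimplexSum K (finrank ℚ K * Real.log t) ≠ ⊤ ∧
    (idealSimplexSum K (finrank ℚ K * Real.log t)).toReal ≤
      zetaDensity K * (t + coverBound K) ^ finrank ℚ K ∧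
    (coverBound K < t → zetaDensity K * (t - coverBound K) ^ finrank ℚ K ≤
      (idealSimplexSum K (finrank ℚ K * Real.log t)).toReal +
        zetaDensity K * √|(discr K : ℝ)|) := by
  have h1 : (0 : ℝ) < classNumber K := by exact_mod_cast classNumber_pos K
  have h2 := regulator_pos K
  have h3 : (0 : ℝ) < torsionOrder K := by exact_mod_cast torsionOrder_pos K
  have h4 := Real.sqrt_pos.mpr (abs_discr_real_pos K)
  have h5 := one_le_boxFactor K
  have hsq : (NNReal.sqrt ‖discr K‖₊ : ENNReal) = ENNReal.ofReal √|(discr K : ℝ)| := by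
    rw [← ENNReal.ofReal_coe_nnreal, Real.coe_sqrt, coe_nnnorm, Int.norm_eq_abs]
  have hb : (boxFactor K : ENNReal) = ENNReal.ofReal (boxFactor K) := by
    rw [ENNReal.ofReal_coe_nnreal]
  have hdef : zetaDensity K * (torsionOrder K * √|(discr K : ℝ)|) =
      classNumber K * regulator K * boxFactor K := by
    rw [zetaDensity, div_mul_cancel₀ _ (by positivity)]
  have key : ∀ u : ℝ, 0 < u → ∀ V : ENNReal, V = idealSimplexSum K (finrank ℚ K * Real.log u) →
      V ≠ ⊤ ∧ (classNumber K * regulator K + torsionOrder K * V.toReal) * √|(discr K : ℝ)| ≤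
        classNumber K * regulator K * (boxFactor K * (u + coverBound K) ^ finrank ℚ K) := by
    intro u hu V hV
    lift u to NNReal using hu.le
    have h := (idealSimplexSum_bounds (K := K) (t := u) (by exact_mod_cast hu)).1
    rw [← hV] at h
    have hVt : V ≠ ⊤ := by
      rintro rfl
      rw [ENNReal.mul_top (by exact_mod_cast h3.ne'), add_top, ENNReal.top_mul] at h
      · refine absurd (top_le_iff.mp h) (ENNReal.mul_ne_top ?_ ?_)
        · exact ENNReal.mul_ne_top (by simp) (by simp)
        · exact ENNReal.mul_ne_top (by simp) (by finiteness)
      · rw [hsq]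
        simpa using h4
    refine ⟨hVt, ?_⟩
    have h' := ENNReal.toReal_mono ?_ h
    · rw [hsq] at h'
      rw [ENNReal.toReal_mul, ENNReal.toReal_add (by finiteness) (by finiteness),
        ENNReal.toReal_mul, ENNReal.toReal_mul, ENNReal.toReal_mul, ENNReal.toReal_mul,
        ENNReal.toReal_mul, ENNReal.toReal_pow, ENNReal.toReal_ofReal h2.le,
        ENNReal.toReal_ofReal h4.le, ENNReal.toReal_add (by finiteness) (by finiteness)] at h'
      simpa using h'
    · finiteness
  obtain ⟨hfin, hup⟩ := key t ht _ rfl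
  refine ⟨hfin, ?_, fun hlt ↦ ?_⟩
  · set V := (idealSimplexSum K (finrank ℚ K * Real.log t)).toReal
    have : V * (torsionOrder K * √|(discr K : ℝ)|) ≤
        zetaDensity K * (t + coverBound K) ^ finrank ℚ K *
          (torsionOrder K * √|(discr K : ℝ)|) := by
      calc V * (torsionOrder K * √|(discr K : ℝ)|) ≤
          (classNumber K * regulator K + torsionOrder K * V) * √|(discr K : ℝ)| := by
            have : 0 ≤ classNumber K * regulator K * √|(discr K : ℝ)| := by positivity
            linarith
        _ ≤ _ := hup
        _ = classNumber K * regulator K * boxFactor K * (t + coverBound K) ^ finrank ℚ K := by ring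
        _ = _ := by rw [← hdef]; ring
    exact le_of_mul_le_mul_right this (by positivity)
  · have hu : 0 < t - coverBound K := by linarith
    obtain ⟨u, hu'⟩ : ∃ u : NNReal, (u : ℝ) = t - coverBound K := ⟨⟨_, hu.le⟩, rfl⟩
    have hu0 : 0 < u := by
      rw [← hu'] at hu
      exact_mod_cast hu
    have h := (idealSimplexSum_bounds (K := K) hu0).2
    rw [hu', sub_add_cancel] at h
    set V := idealSimplexSum K (finrank ℚ K * Real.log t) with hV
    have h' := ENNReal.toReal_mono ?_ h
    · rw [hsq] at h'
      rw [ENNReal.toReal_mul, ENNReal.toReal_mul, ENNReal.toReal_mul, ENNReal.toReal_pow,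
        ENNReal.toReal_mul, ENNReal.toReal_add (by finiteness) (by finiteness),
        ENNReal.toReal_mul, ENNReal.toReal_mul, ENNReal.toReal_ofReal h2.le,
        ENNReal.toReal_ofReal h4.le] at h'
      simp only [ENNReal.toReal_natCast, ENNReal.coe_toReal, hu'] at h'
      have : zetaDensity K * (t - coverBound K) ^ finrank ℚ K *
          (torsionOrder K * √|(discr K : ℝ)|) ≤ (V.toReal + zetaDensity K * √|(discr K : ℝ)|) *
          (torsionOrder K * √|(discr K : ℝ)|) := by
        calc zetaDensity K * (t - coverBound K) ^ finrank ℚ K *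
              (torsionOrder K * √|(discr K : ℝ)|) =
            (zetaDensity K * (torsionOrder K * √|(discr K : ℝ)|)) *
              (t - coverBound K) ^ finrank ℚ K := by ring
          _ = classNumber K * regulator K * (boxFactor K * (t - coverBound K) ^ finrank ℚ K) := by
            rw [hdef]; ring
          _ ≤ _ := h'
          _ = torsionOrder K * V.toReal * √|(discr K : ℝ)| +
              classNumber K * regulator K * 1 * √|(discr K : ℝ)| := by ring
          _ ≤ torsionOrder K * V.toReal * √|(discr K : ℝ)| +
              classNumber K * regulator K * boxFactor K * √|(discr K : ℝ)| := by gcongr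
          _ = _ := by rw [← hdef]; ring
      exact le_of_mul_le_mul_right this (by positivity)
    · finiteness

theorem abs_idealSimplexSum_sub_le {x : ℝ} (hx : 1 ≤ x) :
    idealSimplexSum K (Real.log x) ≠ ⊤ ∧
    |(idealSimplexSum K (Real.log x)).toReal - zetaDensity K * x| ≤
      zetaDensity K * errConst K * x ^ (1 - 1 / finrank ℚ K : ℝ) := by
  obtain ⟨k, hk⟩ : ∃ k, finrank ℚ K = k + 1 := Nat.exists_eq_succ_of_ne_zero finrank_pos.ne'
  have hd : (finrank ℚ K : ℝ) ≠ 0 := by exact_mod_cast finrank_pos.ne'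
  set u : ℝ := x ^ (1 / finrank ℚ K : ℝ) with hu
  have hx0 : 0 < x := by linarith
  have hu1 : 1 ≤ u := Real.one_le_rpow hx (by positivity)
  have hu0 : 0 < u := by linarith
  have hlog : finrank ℚ K * Real.log u = Real.log x := by
    rw [hu, Real.log_rpow hx0, ← mul_assoc, mul_one_div_cancel hd, one_mul]
  have hxu : x = u ^ (k + 1) := by
    rw [← hk, hu, ← Real.rpow_natCast, ← Real.rpow_mul hx0.le, one_div_mul_cancel hd,
      Real.rpow_one]
  have hpow : x ^ (1 - 1 / finrank ℚ K : ℝ) = u ^ k := by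
    rw [Real.rpow_sub hx0, Real.rpow_one, ← hu, hxu, pow_succ, mul_div_cancel_right₀ _ hu0.ne']
  have h := toReal_idealSimplexSum_bounds (K := K) hu0
  rw [hlog] at h
  obtain ⟨hfin, hup, hlow⟩ := h
  refine ⟨hfin, ?_⟩
  rw [hpow]
  set V := (idealSimplexSum K (Real.log x)).toReal
  set E : ℝ := (coverBound K : ℝ) with hE
  have hκ := zetaDensity_pos K
  set κ := zetaDensity K
  have hsE : √|(discr K : ℝ)| ≤ E := sqrt_abs_discr_le_coverBound K
  have hE0 : 0 ≤ E := (Real.sqrt_nonneg _).trans hsE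
  have hM : errConst K = (k + 2) * (1 + E) ^ (k + 1) := by
    rw [errConst, hk]
    push_cast
    ring
  have hE1 : 1 + E ≤ (1 + E) ^ (k + 1) := le_self_pow₀ (by linarith) (by omega)
  have huk : 1 ≤ u ^ k := one_le_pow₀ hu1
  rw [abs_le]
  constructor
  · by_cases hlt : E < u
    · have h1 := hlow hlt
      rw [hk] at h1
      have h2 := pow_sub_le_sub_pow hu0 hlt.le k
      have h3 : κ * (u ^ (k + 1) - (k + 1) * E * u ^ k) ≤ V + κ * (E * u ^ k) := by
        refine (mul_le_mul_of_nonneg_left h2 hκ.le).trans (h1.trans ?_)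
        have : √|(discr K : ℝ)| ≤ E * u ^ k := hsE.trans (le_mul_of_one_le_right hE0 huk)
        gcongr
      have h4 : κ * ((k + 2) * E * u ^ k) ≤ κ * errConst K * u ^ k := by
        rw [hM, mul_assoc κ]
        have : E ≤ (1 + E) ^ (k + 1) := by linarith
        gcongr
      rw [hxu]
      nlinarith
    · push Not at hlt
      have h1 : κ * x ≤ κ * errConst K * u ^ k := by
        rw [hxu, hM, mul_assoc κ, pow_succ, mul_comm (u ^ k)]
        have : u ≤ (k + 2) * (1 + E) ^ (k + 1) := by
          have : (0 : ℝ) ≤ k := by positivity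
          nlinarith
        gcongr
      have : 0 ≤ V := ENNReal.toReal_nonneg
      linarith
  · rw [hk] at hup
    have h1 := add_pow_le_pow_add_mul_pow hu1 hE0 k
    have h2 : κ * (((1 + E) ^ (k + 1) - 1) * u ^ k) ≤ κ * errConst K * u ^ k := by
      rw [hM, mul_assoc κ]
      have h0 : (0 : ℝ) ≤ k := by positivity
      have : (1 + E) ^ (k + 1) - 1 ≤ (k + 2) * (1 + E) ^ (k + 1) := by nlinarith
      gcongr
    have h3 := mul_le_mul_of_nonneg_left h1 hκ.le
    rw [hxu]
    linarith

end Counting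

section Landau

open NumberField.InfinitePlace MeasureTheory Module Set NumberField.Units
open scoped nonZeroDivisors

variable (K : Type*) [Field K] [NumberField K]

/-- The remainder in the asymptotics of `idealSimplexSum`. -/
noncomputable def sumError (x : ℝ) : ℝ :=
  (idealSimplexSum K (Real.log x)).toReal - zetaDensity K * x

/-- The Mellin transform of the remainder at a real argument. -/
noncomputable def errorMellin (s : ℝ) : ℝ := ∫ x in Ioi 1, sumError K x * x ^ (-s - 1)

/-- The abscissa up to which `(s - 1) ζ_K(s)` is continued. -/
noncomputable def contAbscissa : ℝ := 1 - 1 / finrank ℚ K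

variable {K}

theorem measurable_toReal_idealSimplexSum_log :
    Measurable fun x ↦ (idealSimplexSum K (Real.log x)).toReal :=
  (idealSimplexSum_mono.measurable.comp Real.measurable_log).ennreal_toReal

theorem measurable_sumError : Measurable (sumError K) :=
  measurable_toReal_idealSimplexSum_log.sub (by fun_prop)

theorem abs_sumError_le {x : ℝ} (hx : 1 ≤ x) :
    |sumError K x| ≤ zetaDensity K * errConst K * x ^ contAbscissa K :=
  (abs_idealSimplexSum_sub_le hx).2

theorem errConst_pos : 0 < errConst K := two_pos.trans_le (two_le_errConst K)

theorem contAbscissa_lt_one : contAbscissa K < 1 := by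
  have : (0 : ℝ) < finrank ℚ K := by exact_mod_cast finrank_pos
  rw [contAbscissa]
  have : 0 < 1 / (finrank ℚ K : ℝ) := by positivity
  linarith

theorem contAbscissa_nonneg : 0 ≤ contAbscissa K := by
  have : (1 : ℝ) ≤ finrank ℚ K := by exact_mod_cast finrank_pos
  rw [contAbscissa, sub_nonneg]
  exact (div_le_one (by linarith)).mpr this

theorem abs_sumError_mul_rpow_le {s x : ℝ} (hx : 1 ≤ x) :
    |sumError K x * x ^ (-s - 1)| ≤
      zetaDensity K * errConst K * x ^ (contAbscissa K - s - 1) := by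
  have hx0 : 0 < x := by linarith
  rw [abs_mul, abs_of_nonneg (Real.rpow_nonneg hx0.le _), show contAbscissa K - s - 1 =
    contAbscissa K + (-s - 1) by ring, Real.rpow_add hx0, ← mul_assoc]
  exact mul_le_mul_of_nonneg_right (abs_sumError_le hx) (Real.rpow_nonneg hx0.le _)

theorem integrableOn_sumError_mul_rpow {s : ℝ} (hs : contAbscissa K < s) :
    IntegrableOn (fun x ↦ sumError K x * x ^ (-s - 1)) (Ioi 1) := by
  refine Integrable.mono' (g := fun x ↦
    zetaDensity K * errConst K * x ^ (contAbscissa K - s - 1)) ?_ ?_ ?_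
  · exact (integrableOn_Ioi_rpow_of_lt (by linarith) one_pos).const_mul _
  · exact (measurable_sumError.mul (by fun_prop)).aestronglyMeasurable
  · filter_upwards [ae_restrict_mem measurableSet_Ioi] with x hx
    exact abs_sumError_mul_rpow_le (le_of_lt hx)

theorem toReal_sum_mul_rpow_eq {s x : ℝ} (hx : 0 < x) :
    (idealSimplexSum K (Real.log x)).toReal * x ^ (-s - 1) =
      sumError K x * x ^ (-s - 1) + zetaDensity K * x ^ (-s) := by
  have h : x ^ (-s) = x * x ^ (-s - 1) := by
    rw [Real.rpow_sub_one hx.ne', mul_div_cancel₀ _ hx.ne']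
  rw [h, sumError]
  ring

theorem integrableOn_sum_mul_rpow {s : ℝ} (hs : 1 < s) :
    IntegrableOn (fun x ↦ (idealSimplexSum K (Real.log x)).toReal * x ^ (-s - 1)) (Ioi 1) := by
  have h1 := integrableOn_sumError_mul_rpow (K := K) (contAbscissa_lt_one.trans hs)
  have h2 : IntegrableOn (fun x : ℝ ↦ zetaDensity K * x ^ (-s)) (Ioi 1) :=
    (integrableOn_Ioi_rpow_of_lt (by linarith) one_pos).const_mul _
  refine (h1.add h2).congr_fun (fun x hx ↦ ?_) measurableSet_Ioi
  exact (toReal_sum_mul_rpow_eq (one_pos.trans hx)).symm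

theorem integral_sum_mul_rpow {s : ℝ} (hs : 1 < s) :
    ∫ x in Ioi 1, (idealSimplexSum K (Real.log x)).toReal * x ^ (-s - 1) =
      errorMellin K s + zetaDensity K / (s - 1) := by
  rw [setIntegral_congr_fun measurableSet_Ioi
    (fun x hx ↦ toReal_sum_mul_rpow_eq (K := K) (one_pos.trans hx)),
    integral_add (integrableOn_sumError_mul_rpow (contAbscissa_lt_one.trans hs))
      ((integrableOn_Ioi_rpow_of_lt (by linarith) one_pos).const_mul _),
    integral_const_mul, integral_Ioi_rpow_of_lt (by linarith) one_pos, errorMellin, Real.one_rpow,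
    neg_div, ← div_neg, mul_one_div, neg_add_eq_sub, neg_sub]

theorem zetaSum_eq {s : ℝ} (hs : 1 < s) :
    zetaSum K s = ENNReal.ofReal
      (s ^ (rank K + 1) * (errorMellin K s + zetaDensity K / (s - 1))) := by
  have hs0 : 0 < s := by linarith
  have hp : 0 < s ^ (rank K + 1) := by positivity
  rw [← integral_sum_mul_rpow hs, ENNReal.ofReal_mul hp.le, ofReal_integral_eq_lintegral_ofReal
    (integrableOn_sum_mul_rpow hs)]
  · have : ∀ x ∈ Ioi (1 : ℝ), ENNReal.ofReal
        ((idealSimplexSum K (Real.log x)).toReal * x ^ (-s - 1)) =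
        idealSimplexSum K (Real.log x) * ENNReal.ofReal (x ^ (-s - 1)) := fun x hx ↦ by
      rw [ENNReal.ofReal_mul ENNReal.toReal_nonneg,
        ENNReal.ofReal_toReal (abs_idealSimplexSum_sub_le (le_of_lt hx)).1]
    rw [setLIntegral_congr_fun measurableSet_Ioi this, lintegral_idealSimplexSum_mul_rpow hs0,
      mul_comm, mul_assoc, ← ENNReal.ofReal_mul (by positivity), inv_mul_cancel₀ hp.ne',
      ENNReal.ofReal_one, mul_one]
  · filter_upwards [ae_restrict_mem measurableSet_Ioi] with x hx
    exact mul_nonneg ENNReal.toReal_nonneg (Real.rpow_nonneg (one_pos.trans hx).le _)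

theorem zetaSum_ne_top {s : ℝ} (hs : 1 < s) : zetaSum K s ≠ ⊤ := by
  rw [zetaSum_eq hs]
  exact ENNReal.ofReal_ne_top

theorem sub_one_mul_toReal_zetaSum {s : ℝ} (hs : 1 < s) :
    (s - 1) * (zetaSum K s).toReal =
      s ^ (rank K + 1) * (zetaDensity K + (s - 1) * errorMellin K s) := by
  have hs0 : 0 < s := by linarith
  have hs1 : 0 < s - 1 := by linarith
  rw [zetaSum_eq hs, ENNReal.toReal_ofReal]
  · field_simp
    ring
  · rw [← integral_sum_mul_rpow hs]
    refine mul_nonneg (by positivity) (setIntegral_nonneg measurableSet_Ioi fun x hx ↦ ?_)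
    exact mul_nonneg ENNReal.toReal_nonneg (Real.rpow_nonneg (one_pos.trans hx).le _)

theorem zetaDensity_le {η : ℝ} (hη : 0 < η) :
    zetaDensity K ≤ 2 * η * (2 * errConst K) ^ (finrank ℚ K * η) *
      (zetaSum K (1 + η)).toReal := by
  have hs : 1 < 1 + η := by linarith
  have hd : (0 : ℝ) < finrank ℚ K := by exact_mod_cast finrank_pos
  have hM := two_le_errConst K
  have hM0 := errConst_pos (K := K)
  have hκ := zetaDensity_pos K
  set X : ℝ := (2 * errConst K) ^ (finrank ℚ K : ℝ) with hX
  have hX1 : 1 ≤ X := Real.one_le_rpow (by linarith) hd.le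
  have hX0 : 0 < X := by linarith
  have h_integ := integrableOn_sum_mul_rpow (K := K) hs
  have h1 : zetaDensity K / 2 * (X ^ (-η) / η) ≤
      ∫ x in Ioi 1, (idealSimplexSum K (Real.log x)).toReal * x ^ (-(1 + η) - 1) := by
    have h2 : ∫ x in Ioi X, zetaDensity K / 2 * x ^ (-η - 1) =
        zetaDensity K / 2 * (X ^ (-η) / η) := by
      rw [integral_const_mul, integral_Ioi_rpow_of_lt (by linarith) hX0, sub_add_cancel,
        neg_div_neg_eq]
    rw [← h2]
    refine le_trans ?_ (setIntegral_mono_set h_integ ?_ (Ioi_subset_Ioi hX1).eventuallyLE)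
    · refine setIntegral_mono_on ?_ (h_integ.mono_set (Ioi_subset_Ioi hX1)) measurableSet_Ioi ?_
      · exact (integrableOn_Ioi_rpow_of_lt (by linarith) hX0).const_mul _
      · intro x hx
        have hx1 : 1 ≤ x := hX1.trans (le_of_lt hx)
        have hx0 : 0 < x := by linarith
        have h3 := (abs_le.mp (abs_sumError_le (K := K) hx1)).1
        have h4 : errConst K * x ^ contAbscissa K ≤ x / 2 := by
          have : 2 * errConst K ≤ x ^ (1 / finrank ℚ K : ℝ) := by
            have h5 := Real.rpow_le_rpow hX0.le (le_of_lt hx)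
              (z := 1 / finrank ℚ K) (by positivity)
            rwa [hX, ← Real.rpow_mul (by positivity), mul_one_div_cancel hd.ne',
              Real.rpow_one] at h5
          rw [contAbscissa, Real.rpow_sub hx0, Real.rpow_one, mul_div_assoc',
            div_le_iff₀ (by positivity)]
          nlinarith
        have h5 : zetaDensity K / 2 * x ≤ (idealSimplexSum K (Real.log x)).toReal := by
          rw [sumError] at h3
          nlinarith
        have h6 : x ^ (-η - 1) = x * x ^ (-(1 + η) - 1) := by
          rw [← Real.rpow_one_add' hx0.le (by linarith)]
          congr 1
          ring
        rw [h6, ← mul_assoc]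
        exact mul_le_mul_of_nonneg_right h5 (Real.rpow_nonneg hx0.le _)
    · filter_upwards [ae_restrict_mem measurableSet_Ioi] with x hx
      exact mul_nonneg ENNReal.toReal_nonneg (Real.rpow_nonneg (one_pos.trans hx).le _)
  have h7 : ∫ x in Ioi 1, (idealSimplexSum K (Real.log x)).toReal * x ^ (-(1 + η) - 1) ≤
      (zetaSum K (1 + η)).toReal := by
    rw [zetaSum_eq hs, ← integral_sum_mul_rpow hs, ENNReal.toReal_ofReal]
    · refine le_mul_of_one_le_left ?_ (one_le_pow₀ hs.le)
      exact le_trans (by positivity) h1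
    · exact mul_nonneg (by positivity) (le_trans (by positivity) h1)
  have h8 := h1.trans h7
  have h9 : (2 * errConst K) ^ (finrank ℚ K * η) = X ^ η := by
    rw [hX, ← Real.rpow_mul (by positivity)]
  rw [h9]
  calc zetaDensity K = 2 * η * X ^ η * (zetaDensity K / 2 * (X ^ (-η) / η)) := by
        rw [Real.rpow_neg hX0.le]
        have : 0 < X ^ η := by positivity
        field_simp
    _ ≤ _ := by gcongr

theorem le_zetaDensity_of_nonneg {s : ℝ} (hs : 1 - 1 / (2 * finrank ℚ K) ≤ s) (hs1 : s < 1)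
    (h0 : 0 ≤ zetaDensity K + (s - 1) * errorMellin K s) :
    (1 / (3 * (rank K + 1)) : ℝ) ^ rank K / 8 * (1 - s) ≤
      2 * zetaDensity K * errConst K ^ (2 * finrank ℚ K * (1 - s)) := by
  have hd : (1 : ℝ) ≤ finrank ℚ K := by exact_mod_cast finrank_pos
  have hM := two_le_errConst K
  have hM0 := errConst_pos (K := K)
  have hκ := zetaDensity_pos K
  set d : ℝ := (finrank ℚ K : ℝ) with hd'
  set θ := contAbscissa K with hθ'
  have hθ : θ = 1 - 1 / d := rfl
  have hθs : 1 / (2 * d) ≤ s - θ := by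
    have : 1 / d = 1 / (2 * d) + 1 / (2 * d) := by field_simp; norm_num
    linarith
  have hθs0 : 0 < s - θ := lt_of_lt_of_le (by positivity) hθs
  have hs0 : 0 ≤ s := by linarith [contAbscissa_nonneg (K := K)]
  set X : ℝ := errConst K ^ (2 * d) with hX
  have hX2 : 2 ≤ X := hM.trans (Real.self_le_rpow_of_one_le (by linarith) (by linarith))
  have hX0 : 0 < X := by linarith
  have hX1 : 1 ≤ X := by linarith
  have h_integ := integrableOn_sumError_mul_rpow (K := K) (s := s) (by linarith)
  have hsplit : errorMellin K s = (∫ x in Ioc 1 X, sumError K x * x ^ (-s - 1)) +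
      ∫ x in Ioi X, sumError K x * x ^ (-s - 1) := by
    rw [errorMellin, ← Ioc_union_Ioi_eq_Ioi hX1, setIntegral_union (Ioc_disjoint_Ioi le_rfl)
      measurableSet_Ioi (h_integ.mono_set Ioc_subset_Ioi_self) (h_integ.mono_set (Ioi_subset_Ioi hX1))]
  have htail : -(zetaDensity K * (2 * d)) ≤ ∫ x in Ioi X, sumError K x * x ^ (-s - 1) := by
    have h_integ2 : IntegrableOn (fun x ↦ zetaDensity K * errConst K * x ^ (θ - s - 1)) (Ioi X) :=
      (integrableOn_Ioi_rpow_of_lt (by linarith) hX0).const_mul _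
    have h1 : ∫ x in Ioi X, -(zetaDensity K * errConst K * x ^ (θ - s - 1)) ≤
        ∫ x in Ioi X, sumError K x * x ^ (-s - 1) := by
      refine setIntegral_mono_on h_integ2.neg (h_integ.mono_set (Ioi_subset_Ioi hX1))
        measurableSet_Ioi fun x hx ↦ ?_
      exact (abs_le.mp (abs_sumError_mul_rpow_le (hX1.trans (le_of_lt hx)))).1
    refine le_trans ?_ h1
    rw [integral_neg, neg_le_neg_iff, integral_const_mul, integral_Ioi_rpow_of_lt (by linarith) hX0,
      sub_add_cancel, mul_assoc]
    refine mul_le_mul_of_nonneg_left ?_ hκ.le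
    have h2 : errConst K * X ^ (θ - s) ≤ 1 := by
      have h3 : X ^ (θ - s) ≤ errConst K ^ (-1 : ℝ) := by
        rw [hX, ← Real.rpow_mul hM0.le]
        refine Real.rpow_le_rpow_of_exponent_le (by linarith) ?_
        have : 2 * d * (1 / (2 * d)) ≤ 2 * d * (s - θ) := by gcongr
        rw [mul_one_div_cancel (by positivity)] at this
        linarith
      calc errConst K * X ^ (θ - s) ≤ errConst K * errConst K ^ (-1 : ℝ) := by gcongr
        _ = 1 := by rw [Real.rpow_neg_one, mul_inv_cancel₀ hM0.ne']
    have h3 : -X ^ (θ - s) / (θ - s) = X ^ (θ - s) / (s - θ) := by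
      rw [← neg_sub s θ, neg_div_neg_eq]
    rw [h3, mul_div_assoc', div_le_iff₀ hθs0]
    have : 1 ≤ 2 * d * (s - θ) := by
      have : 2 * d * (1 / (2 * d)) ≤ 2 * d * (s - θ) := by gcongr
      rwa [mul_one_div_cancel (by positivity)] at this
    linarith
  have hmain : ∫ x in Ioc 1 X, sumError K x * x ^ (-s - 1) =
      (∫ x in Ioc 1 X, (idealSimplexSum K (Real.log x)).toReal * x ^ (-s - 1)) -
        zetaDensity K * ((X ^ (1 - s) - 1) / (1 - s)) := by
    have hii : IntegrableOn (fun x : ℝ ↦ zetaDensity K * x ^ (-s)) (Ioc 1 X) := by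
      refine Integrable.const_mul ?_ _
      exact (intervalIntegral.intervalIntegrable_rpow' (by linarith)).1
    have h1 : ∫ x in Ioc 1 X, zetaDensity K * x ^ (-s) =
        zetaDensity K * ((X ^ (1 - s) - 1) / (1 - s)) := by
      rw [integral_const_mul, ← intervalIntegral.integral_of_le hX1,
        integral_rpow (Or.inl (by linarith)), Real.one_rpow, neg_add_eq_sub]
    rw [← h1, setIntegral_congr_fun measurableSet_Ioc
      (fun x hx ↦ toReal_sum_mul_rpow_eq (K := K) (one_pos.trans hx.1)),
      integral_add (h_integ.mono_set Ioc_subset_Ioi_self) hii, add_sub_cancel_right]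
  have hlow : (1 / (3 * (rank K + 1)) : ℝ) ^ rank K / 8 ≤
      ∫ x in Ioc 1 X, (idealSimplexSum K (Real.log x)).toReal * x ^ (-s - 1) := by
    have hii : IntegrableOn (fun x ↦
        (idealSimplexSum K (Real.log x)).toReal * x ^ (-s - 1)) (Ioc 1 X) := by
      have h1 : IntegrableOn (fun x : ℝ ↦ zetaDensity K * x ^ (-s)) (Ioc 1 X) := by
        refine Integrable.const_mul ?_ _
        exact (intervalIntegral.intervalIntegrable_rpow' (by linarith)).1
      refine ((h_integ.mono_set Ioc_subset_Ioi_self).add h1).congr_fun (fun x hx ↦ ?_)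
        measurableSet_Ioc
      exact (toReal_sum_mul_rpow_eq (one_pos.trans hx.1)).symm
    have hsub : Ioc (3 / 2 : ℝ) 2 ⊆ Ioc 1 X := Ioc_subset_Ioc (by norm_num) hX2
    refine le_trans ?_ (setIntegral_mono_set hii ?_ hsub.eventuallyLE)
    · have h1 : ∫ x in Ioc (3 / 2 : ℝ) 2, (1 / (3 * (rank K + 1)) : ℝ) ^ rank K / 4 =
          (1 / (3 * (rank K + 1)) : ℝ) ^ rank K / 8 := by
        rw [setIntegral_const, smul_eq_mul, Measure.real, Real.volume_Ioc,
          ENNReal.toReal_ofReal (by norm_num)]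
        ring
      rw [← h1]
      refine setIntegral_mono_on (integrableOn_const (by simp)) (hii.mono_set hsub)
        measurableSet_Ioc fun x hx ↦ ?_
      have hx0 : 0 < x := lt_trans (by norm_num) hx.1
      have hlog : 1 / 3 ≤ Real.log x := by
        have h2 := Real.one_sub_inv_le_log_of_pos hx0
        have h3 : x⁻¹ ≤ 2 / 3 := by
          rw [inv_le_comm₀ hx0 (by norm_num)]
          linarith [hx.1]
        linarith
      have h4 : (1 / (3 * (rank K + 1)) : ℝ) ^ rank K ≤
          (idealSimplexSum K (Real.log x)).toReal := by
        have hx1 : 1 ≤ x := le_trans (by norm_num) hx.1.le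
        rw [← ENNReal.ofReal_le_iff_le_toReal (abs_idealSimplexSum_sub_le hx1).1]
        refine le_trans (ENNReal.ofReal_le_ofReal ?_) ((pow_le_simplexVol (by linarith)).trans
          (simplexVol_le_idealSimplexSum _))
        refine pow_le_pow_left₀ (by positivity) ?_ _
        rw [← div_div]
        gcongr
      have h5 : (1 / 4 : ℝ) ≤ x ^ (-s - 1) := by
        calc (1 / 4 : ℝ) = 2 ^ (-2 : ℝ) := by
              rw [Real.rpow_neg (by norm_num)]
              norm_num
          _ ≤ 2 ^ (-s - 1) := Real.rpow_le_rpow_of_exponent_le (by norm_num) (by linarith)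
          _ ≤ x ^ (-s - 1) := Real.rpow_le_rpow_of_nonpos hx0 hx.2 (by linarith)
      rw [div_eq_mul_one_div]
      exact mul_le_mul h4 h5 (by norm_num) ENNReal.toReal_nonneg
    · filter_upwards [ae_restrict_mem measurableSet_Ioc] with x hx
      exact mul_nonneg ENNReal.toReal_nonneg (Real.rpow_nonneg (one_pos.trans hx.1).le _)
  have hG : errorMellin K s * (1 - s) ≤ zetaDensity K := by linarith
  set c := (1 / (3 * (rank K + 1)) : ℝ) ^ rank K / 8
  have h1s : 0 < 1 - s := by linarith
  have h2 : c - zetaDensity K * ((X ^ (1 - s) - 1) / (1 - s)) - zetaDensity K * (2 * d) ≤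
      errorMellin K s := by
    rw [hsplit, hmain]
    linarith
  have h3 := mul_le_mul_of_nonneg_right h2 h1s.le
  have h4 : zetaDensity K * ((X ^ (1 - s) - 1) / (1 - s)) * (1 - s) =
      zetaDensity K * (X ^ (1 - s) - 1) := by
    field_simp
  have h5 : 2 * d * (1 - s) ≤ 1 := by
    have : 2 * d * (1 - s) ≤ 2 * d * (1 / (2 * d)) := by
      gcongr
      linarith
    rwa [mul_one_div_cancel (by positivity)] at this
  have h6 : 1 ≤ X ^ (1 - s) := Real.one_le_rpow hX1 h1s.le
  have h7 : errConst K ^ (2 * d * (1 - s)) = X ^ (1 - s) := by rw [hX, ← Real.rpow_mul hM0.le]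
  rw [h7]
  rw [sub_mul, sub_mul, h4] at h3
  have h8 : zetaDensity K * (2 * d) * (1 - s) ≤ zetaDensity K * X ^ (1 - s) := by
    rw [mul_assoc]
    exact mul_le_mul_of_nonneg_left (h5.trans h6) hκ.le
  linarith

end Landau

section Continuation

open NumberField.InfinitePlace MeasureTheory Module Set NumberField.Units Filter Topology
open scoped nonZeroDivisors

variable (K : Type*) [Field K] [NumberField K]

/-- The continuation of `(s - 1) ζ_K(s)` to real arguments `s > 1 - 1 / [K : ℚ]`. -/
noncomputable def zetaReg (s : ℝ) : ℝ :=
  s ^ (rank K + 1) * (zetaDensity K + (s - 1) * errorMellin K s)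

/-- The remainder in the asymptotics of `idealSimplexSum`, extended by zero to `x ≤ 1`. -/
noncomputable def sumErrorExt (x : ℝ) : ℂ := (Ioi 1).indicator (fun x ↦ (sumError K x : ℂ)) x

/-- The continuation of `(s - 1) ζ_K(s)` to complex arguments with real part at least
`1 - 1 / [K : ℚ]`. -/
noncomputable def zetaRegComplex (s : ℂ) : ℂ :=
  s ^ (rank K + 1) * (zetaDensity K + (s - 1) * mellin (sumErrorExt K) (-s))

variable {K}

theorem mellin_sumErrorExt_ofReal (s : ℝ) :
    mellin (sumErrorExt K) (-(s : ℂ)) = errorMellin K s := by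
  rw [mellin, errorMellin, ← integral_complex_ofReal]
  have h : ∀ t : ℝ, ((t : ℂ) ^ (-(s : ℂ) - 1)) • sumErrorExt K t =
      (Ioi 1).indicator (fun t : ℝ ↦ ((sumError K t * t ^ (-s - 1) : ℝ) : ℂ)) t := by
    intro t
    by_cases ht : t ∈ Ioi 1
    · rw [sumErrorExt, indicator_of_mem ht, indicator_of_mem ht, smul_eq_mul, mul_comm,
        Complex.ofReal_mul, Complex.ofReal_cpow (one_pos.trans ht).le]
      push_cast
      rfl
    · rw [sumErrorExt, indicator_of_notMem ht, indicator_of_notMem ht, smul_zero]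
  simp_rw [h]
  rw [setIntegral_indicator measurableSet_Ioi, Ioi_inter_Ioi, sup_of_le_right zero_le_one]

theorem zetaRegComplex_ofReal (s : ℝ) : zetaRegComplex K s = zetaReg K s := by
  rw [zetaRegComplex, mellin_sumErrorExt_ofReal, zetaReg]
  push_cast
  rfl

theorem differentiableOn_zetaRegComplex :
    DifferentiableOn ℂ (zetaRegComplex K) {s | contAbscissa K < s.re} := by
  intro s hs
  have hmeas : Measurable (sumErrorExt K) :=
    (Complex.measurable_ofReal.comp measurable_sumError).indicator measurableSet_Ioi
  have hbound : ∀ x : ℝ, ‖sumErrorExt K x‖ ≤ (Ioi 1).indicator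
      (fun x ↦ zetaDensity K * errConst K * x ^ contAbscissa K) x := by
    intro x
    by_cases hx : x ∈ Ioi 1
    · rw [sumErrorExt, indicator_of_mem hx, indicator_of_mem hx, Complex.norm_real]
      exact abs_sumError_le (le_of_lt hx)
    · rw [sumErrorExt, indicator_of_notMem hx, indicator_of_notMem hx, norm_zero]
  have h1 : DifferentiableAt ℂ (mellin (sumErrorExt K)) (-s) := by
    refine mellin_differentiableAt_of_isBigO_rpow (a := -contAbscissa K) (b := -s.re - 1) ?_ ?_ ?_
      ?_ ?_
    · refine LocallyIntegrableOn.mono (f := fun x : ℝ ↦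
        zetaDensity K * errConst K * x ^ contAbscissa K) ?_ hmeas.aestronglyMeasurable ?_
      · refine ContinuousOn.locallyIntegrableOn ?_ measurableSet_Ioi
        exact continuousOn_const.mul
          (continuousOn_id.rpow_const fun x hx ↦ Or.inl (ne_of_gt hx))
      · refine Eventually.of_forall fun x ↦ (hbound x).trans ?_
        refine indicator_apply_le' (fun _ ↦ le_abs_self _) fun _ ↦ norm_nonneg _
    · rw [neg_neg]
      refine Asymptotics.IsBigO.of_bound (zetaDensity K * errConst K) ?_
      filter_upwards [eventually_gt_atTop 1] with x hx
      refine (hbound x).trans ?_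
      rw [indicator_of_mem (mem_Ioi.mpr hx), Real.norm_of_nonneg (by positivity)]
    · simpa using hs
    · refine Asymptotics.IsBigO.of_bound 0 ?_
      filter_upwards [nhdsWithin_le_nhds (Iio_mem_nhds one_pos)] with x hx
      rw [sumErrorExt, indicator_of_notMem (fun h ↦ lt_asymm (mem_Ioi.mp h) hx)]
      simp
    · simp
  refine DifferentiableAt.differentiableWithinAt ?_
  unfold zetaRegComplex
  have h2 : DifferentiableAt ℂ (fun s ↦ mellin (sumErrorExt K) (-s)) s :=
    DifferentiableAt.comp (g := mellin (sumErrorExt K)) s h1 differentiable_neg.differentiableAt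
  fun_prop

theorem continuousOn_zetaReg : ContinuousOn (zetaReg K) (Ioi (contAbscissa K)) := by
  have h := (differentiableOn_zetaRegComplex (K := K)).continuousOn
  have h1 : ContinuousOn (fun s : ℝ ↦ (zetaRegComplex K s).re) (Ioi (contAbscissa K)) :=
    Complex.continuous_re.comp_continuousOn
      (h.comp Complex.continuous_ofReal.continuousOn fun s hs ↦ by simpa using hs)
  simpa only [zetaRegComplex_ofReal, Complex.ofReal_re] using h1

theorem zetaReg_of_one_lt {s : ℝ} (hs : 1 < s) :
    zetaReg K s = (s - 1) * (zetaSum K s).toReal :=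
  (sub_one_mul_toReal_zetaSum hs).symm

theorem zetaReg_one : zetaReg K 1 = zetaDensity K := by simp [zetaReg]

theorem analyticOnNhd_zetaRegComplex {σ : ℝ} (h : contAbscissa K ≤ σ) :
    AnalyticOnNhd ℂ (zetaRegComplex K) {s | σ < s.re} :=
  (differentiableOn_zetaRegComplex.mono fun _ hs ↦ h.trans_lt hs).analyticOnNhd
    (isOpen_lt continuous_const Complex.continuous_re)

theorem zetaReg_identity {E₀ E₁ E₂ E₃ L : Type*} [Field E₀] [NumberField E₀]
    [Field E₁] [NumberField E₁] [Field E₂] [NumberField E₂] [Field E₃] [NumberField E₃]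
    [Field L] [NumberField L]
    (h : ∀ s : ℝ, 1 < s → zetaSum L s * zetaSum E₀ s ^ 2 =
      zetaSum E₁ s * zetaSum E₂ s * zetaSum E₃ s) {σ : ℝ} (hσ : σ < 1) (h₀ : contAbscissa E₀ ≤ σ)
    (h₁ : contAbscissa E₁ ≤ σ) (h₂ : contAbscissa E₂ ≤ σ) (h₃ : contAbscissa E₃ ≤ σ)
    (hL : contAbscissa L ≤ σ) {s : ℝ} (hs : σ < s) :
    zetaReg L s * zetaReg E₀ s ^ 2 = zetaReg E₁ s * zetaReg E₂ s * zetaReg E₃ s := by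
  have hconn : IsPreconnected {s : ℂ | σ < s.re} := (convex_halfSpace_re_gt σ).isPreconnected
  have key := AnalyticOnNhd.eqOn_of_preconnected_of_frequently_eq
    ((analyticOnNhd_zetaRegComplex hL).mul ((analyticOnNhd_zetaRegComplex h₀).pow 2))
    (((analyticOnNhd_zetaRegComplex h₁).mul (analyticOnNhd_zetaRegComplex h₂)).mul
      (analyticOnNhd_zetaRegComplex h₃)) hconn (z₀ := ((2 : ℝ) : ℂ))
      (by change σ < _; rw [Complex.ofReal_re]; linarith) ?_
  · have h4 := key (x := (s : ℂ)) (by change σ < _; rwa [Complex.ofReal_re])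
    simp only [Pi.pow_apply, zetaRegComplex_ofReal] at h4
    exact_mod_cast h4
  · have htend : Tendsto (fun x : ℝ ↦ (x : ℂ)) (𝓝[≠] 2) (𝓝[≠] ((2 : ℝ) : ℂ)) := by
      refine tendsto_nhdsWithin_iff.mpr ⟨(Complex.continuous_ofReal.tendsto _).mono_left
        nhdsWithin_le_nhds, ?_⟩
      filter_upwards [self_mem_nhdsWithin] with x hx h
      exact hx (Complex.ofReal_injective h)
    refine htend.frequently (Eventually.frequently ?_)
    filter_upwards [nhdsWithin_le_nhds (Ioi_mem_nhds one_lt_two)] with x hx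
    have hx1 : 1 < x := hx
    simp only [Pi.pow_apply, zetaRegComplex_ofReal, zetaReg_of_one_lt hx1]
    have h4 := congr_arg ENNReal.toReal (h x hx1)
    simp only [ENNReal.toReal_mul, ENNReal.toReal_pow] at h4
    norm_cast
    linear_combination (x - 1) ^ 3 * h4

end Continuation

section EulerProduct

open MeasureTheory Module Set Filter Topology Ideal
open scoped nonZeroDivisors

variable (K : Type*) [Field K] [NumberField K]

/-- The nonzero ideals all of whose prime factors lie in `X`. -/
def idealsWithFactorsIn (X : Finset (Ideal (𝓞 K))) : Set (Ideal (𝓞 K)) :=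
  {a | a ≠ 0 ∧ ∀ P, Prime P → P ∣ a → P ∈ X}

variable {K}

theorem idealsWithFactorsIn_empty : idealsWithFactorsIn K ∅ = {1} := by
  ext a
  refine ⟨fun ⟨h0, h⟩ ↦ ?_, ?_⟩
  · by_contra h1
    obtain ⟨P, hP, hPa⟩ := WfDvdMonoid.exists_irreducible_factor
      (mt Ideal.isUnit_iff.mp (by simpa [Ideal.one_eq_top] using h1)) h0
    exact absurd (h P hP.prime hPa) (by simp)
  · rintro rfl
    exact ⟨one_ne_zero, fun P hP h ↦ absurd (isUnit_of_dvd_one h) hP.not_isUnit⟩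

theorem prime_pow_mul_injective {P : Ideal (𝓞 K)} (hP : Prime P) {n m : ℕ} {a b : Ideal (𝓞 K)}
    (ha : ¬ P ∣ a) (hb : ¬ P ∣ b) (h : P ^ n * a = P ^ m * b) : n = m ∧ a = b := by
  have aux : ∀ {n m : ℕ} {a b : Ideal (𝓞 K)}, ¬ P ∣ a → P ^ n * a = P ^ m * b → m ≤ n := by
    intro n m a b ha h
    by_contra! hnm
    obtain ⟨k, rfl⟩ := Nat.exists_eq_add_of_lt hnm
    rw [add_assoc, pow_add, mul_assoc] at h
    have h1 := mul_left_cancel₀ (pow_ne_zero n hP.ne_zero) h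
    exact ha ⟨P ^ k * b, by rw [h1]; ring⟩
  obtain rfl := le_antisymm (aux hb h.symm) (aux ha h)
  exact ⟨rfl, mul_left_cancel₀ (pow_ne_zero n hP.ne_zero) h⟩

theorem exists_prime_pow_mul {P a : Ideal (𝓞 K)} (hP : Prime P) (ha : a ≠ 0) :
    ∃ (n : ℕ) (b : Ideal (𝓞 K)), ¬ P ∣ b ∧ a = P ^ n * b := by
  obtain ⟨b, h1, h2⟩ := (FiniteMultiplicity.of_not_isUnit hP.not_isUnit
    ha).exists_eq_pow_mul_and_not_dvd
  exact ⟨_, b, h2, h1⟩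

/-- Splitting off the power of a prime outside `X`. -/
noncomputable def idealsWithFactorsInInsert {X : Finset (Ideal (𝓞 K))} {P : Ideal (𝓞 K)}
    (hP : Prime P) (hPX : P ∉ X) :
    ℕ × idealsWithFactorsIn K X ≃ idealsWithFactorsIn K (insert P X) :=
  Equiv.ofBijective (fun x ↦ ⟨P ^ x.1 * x.2.1, mul_ne_zero (pow_ne_zero _ hP.ne_zero) x.2.2.1,
    fun Q hQ hQa ↦ by
      rcases hQ.dvd_or_dvd hQa with h | h
      · rw [(hQ.dvd_prime_iff_associated hP).mp (hQ.dvd_of_dvd_pow h) |> associated_iff_eq.mp]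
        exact Finset.mem_insert_self _ _
      · exact Finset.mem_insert_of_mem (x.2.2.2 Q hQ h)⟩) <| by
    constructor
    · rintro ⟨n, a, ha0, ha⟩ ⟨m, b, hb0, hb⟩ h
      obtain ⟨rfl, rfl⟩ := prime_pow_mul_injective hP (fun h ↦ hPX (ha P hP h))
        (fun h ↦ hPX (hb P hP h)) (congr_arg Subtype.val h)
      rfl
    · rintro ⟨a, ha0, ha⟩
      obtain ⟨n, b, hb, rfl⟩ := exists_prime_pow_mul hP ha0
      refine ⟨⟨n, b, right_ne_zero_of_mul ha0, fun Q hQ hQb ↦ ?_⟩, rfl⟩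
      refine Finset.mem_of_mem_insert_of_ne (ha Q hQ (hQb.mul_left _)) ?_
      rintro rfl
      exact hb hQb

theorem tsum_idealsWithFactorsIn {f : Ideal (𝓞 K) → ENNReal} (h1 : f 1 = 1)
    (hmul : ∀ a b, f (a * b) = f a * f b) {X : Finset (Ideal (𝓞 K))} (hX : ∀ P ∈ X, Prime P) :
    ∑' a : idealsWithFactorsIn K X, f a = ∏ P ∈ X, (1 - f P)⁻¹ := by
  have hpow : ∀ P (n : ℕ), f (P ^ n) = f P ^ n := by
    intro P n
    induction n with
    | zero => simpa using h1
    | succ n ih => rw [pow_succ, hmul, ih, pow_succ]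
  induction X using Finset.induction_on with
  | empty =>
    rw [idealsWithFactorsIn_empty, Finset.prod_empty, tsum_singleton, h1]
  | insert P X hPX ih =>
    have hP := hX P (Finset.mem_insert_self _ _)
    rw [← (idealsWithFactorsInInsert hP hPX).tsum_eq, ENNReal.tsum_prod', Finset.prod_insert hPX,
      ← ih fun Q hQ ↦ hX Q (Finset.mem_insert_of_mem hQ), ← ENNReal.tsum_geometric,
      ← ENNReal.tsum_mul_right]
    refine tsum_congr fun n ↦ ?_
    rw [← ENNReal.tsum_mul_left]
    refine tsum_congr fun a ↦ ?_
    exact (hmul _ _).trans (by rw [hpow])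

/-- The summand of the Dedekind zeta function. -/
noncomputable def zetaTerm (s : ℝ) (a : Ideal (𝓞 K)) : ENNReal :=
  ENNReal.ofReal ((absNorm a : ℝ) ^ (-s))

theorem zetaTerm_one (s : ℝ) : zetaTerm s (1 : Ideal (𝓞 K)) = 1 := by
  simp [zetaTerm]

theorem zetaTerm_mul (s : ℝ) (a b : Ideal (𝓞 K)) :
    zetaTerm s (a * b) = zetaTerm s a * zetaTerm s b := by
  rw [zetaTerm, map_mul, Nat.cast_mul, Real.mul_rpow (by positivity) (by positivity),
    ENNReal.ofReal_mul (by positivity)]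
  rfl

/-- Finite Euler products over directed families of sets of primes exhausting all primes. -/
theorem tendsto_zetaSum {ι : Type*} [Preorder ι] [IsDirectedOrder ι] [Nonempty ι]
    {X : ι → Finset (Ideal (𝓞 K))}
    (hmono : Monotone X) (hprime : ∀ i, ∀ P ∈ X i, Prime P)
    (hex : ∀ P : Ideal (𝓞 K), Prime P → ∃ i, P ∈ X i) (s : ℝ) :
    Tendsto (fun i ↦ ∏ P ∈ X i, (1 - zetaTerm s P)⁻¹) atTop (𝓝 (zetaSum K s)) := by
  have hm : Monotone fun i ↦ ∏ P ∈ X i, (1 - zetaTerm s P)⁻¹ := fun i j hij ↦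
    Finset.prod_le_prod_of_subset_of_one_le' (hmono hij) fun P _ _ ↦
      ENNReal.one_le_inv.mpr tsub_le_self
  have hsum : ∀ i, ∏ P ∈ X i, (1 - zetaTerm s P)⁻¹ =
      ∑' a : idealsWithFactorsIn K (X i), zetaTerm s (a : Ideal (𝓞 K)) := fun i ↦
    (tsum_idealsWithFactorsIn (zetaTerm_one s) (zetaTerm_mul s) (hprime i)).symm
  have : zetaSum K s = ⨆ i, ∏ P ∈ X i, (1 - zetaTerm s P)⁻¹ := by
    refine le_antisymm ?_ (iSup_le fun i ↦ ?_)
    · rw [zetaSum, ENNReal.tsum_eq_iSup_sum]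
      refine iSup_le fun T ↦ ?_
      have hfin : ∃ i, ∀ a ∈ T, ∀ P, Prime P → P ∣ (a : Ideal (𝓞 K)) → P ∈ X i := by
        have hone : ∀ a : (Ideal (𝓞 K))⁰, ∃ i, ∀ P, Prime P → P ∣ (a : Ideal (𝓞 K)) →
            P ∈ X i := by
          intro a
          have ha : (a : Ideal (𝓞 K)) ≠ 0 := nonZeroDivisors.coe_ne_zero a
          choose! g hg using hex
          obtain ⟨i, hi⟩ := Finset.exists_le
            (((UniqueFactorizationMonoid.normalizedFactors (a : Ideal (𝓞 K))).toFinset).image g)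
          refine ⟨i, fun P hP hPa ↦ hmono (hi _ (Finset.mem_image_of_mem g ?_)) (hg P hP)⟩
          rw [Multiset.mem_toFinset]
          exact (Ideal.mem_normalizedFactors_iff ha).mpr ⟨Ideal.isPrime_of_prime hP,
            Ideal.le_of_dvd hPa⟩
        choose g hg using hone
        obtain ⟨i, hi⟩ := Finset.exists_le (T.image g)
        exact ⟨i, fun a ha P hP hPa ↦
          hmono (hi _ (Finset.mem_image_of_mem g ha)) (hg a P hP hPa)⟩
      obtain ⟨i, hi⟩ := hfin
      refine le_trans ?_ (le_iSup _ i)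
      rw [hsum, ← Finset.sum_coe_sort]
      let φ : T → idealsWithFactorsIn K (X i) := fun a ↦
        ⟨a.1, nonZeroDivisors.coe_ne_zero a.1, hi a.1 a.2⟩
      have hφ : Function.Injective φ := fun a b h ↦ by
        have h2 := congr_arg Subtype.val h
        exact Subtype.ext (Subtype.ext h2)
      rw [← tsum_fintype (L := .unconditional _)]
      exact ENNReal.tsum_comp_le_tsum_of_injective hφ
        (fun a : idealsWithFactorsIn K (X i) ↦ zetaTerm s (a : Ideal (𝓞 K)))
    · rw [hsum, zetaSum]
      let φ : idealsWithFactorsIn K (X i) → (Ideal (𝓞 K))⁰ := fun a ↦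
        ⟨a.1, mem_nonZeroDivisors_of_ne_zero a.2.1⟩
      have hφ : Function.Injective φ := fun a b h ↦ by
        have h2 := congr_arg Subtype.val h
        exact Subtype.ext h2
      exact ENNReal.tsum_comp_le_tsum_of_injective hφ
        (fun a : (Ideal (𝓞 K))⁰ ↦ ENNReal.ofReal ((absNorm (a : Ideal (𝓞 K)) : ℝ) ^ (-s)))
  rw [this]
  exact tendsto_atTop_iSup hm

end EulerProduct

section RelativeEulerProduct

open MeasureTheory Module Set Filter Topology Ideal
open scoped nonZeroDivisors

variable (F : Type*) [Field F] [NumberField F] (E : Type*) [Field E] [NumberField E] [Algebra F E]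

/-- The product of the Euler factors of `E` at the primes over `p`. -/
noncomputable def localFactor (p : Ideal (𝓞 F)) (s : ℝ) : ENNReal :=
  ∏ P ∈ IsDedekindDomain.primesOverFinset p (𝓞 E), (1 - zetaTerm s P)⁻¹

variable {F E}

theorem tendsto_prod_localFactor (s : ℝ) :
    Tendsto (fun i : Finset {p : Ideal (𝓞 F) // Prime p} ↦ ∏ p ∈ i, localFactor F E p s) atTop
      (𝓝 (zetaSum E s)) := by
  have hmem : ∀ (p : {p : Ideal (𝓞 F) // Prime p}) (P : Ideal (𝓞 E)),
      P ∈ IsDedekindDomain.primesOverFinset p.1 (𝓞 E) ↔ P ∈ primesOver p.1 (𝓞 E) := by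
    intro p P
    have := (Ideal.isPrime_of_prime p.2).isMaximal p.2.ne_zero
    exact IsDedekindDomain.mem_primesOverFinset_iff p.2.ne_zero _
  have h := tendsto_zetaSum (K := E) (X := fun i : Finset {p : Ideal (𝓞 F) // Prime p} ↦
    i.biUnion fun p ↦ IsDedekindDomain.primesOverFinset p.1 (𝓞 E)) ?_ ?_ ?_ s
  · refine h.congr fun i ↦ ?_
    rw [Finset.prod_biUnion]
    · rfl
    · intro p _ q _ hpq
      refine Finset.disjoint_left.mpr fun P hP hQ ↦ hpq (Subtype.ext ?_)
      rw [((hmem p P).mp hP).2.over, ((hmem q P).mp hQ).2.over]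
  · exact fun i j hij ↦ Finset.biUnion_subset_biUnion_of_subset_left _ hij
  · intro i P hP
    obtain ⟨p, -, hpP⟩ := Finset.mem_biUnion.mp hP
    have := ((hmem p P).mp hpP).1
    have := ((hmem p P).mp hpP).2
    exact Ideal.prime_of_isPrime (Ideal.ne_bot_of_liesOver_of_ne_bot p.2.ne_zero P) ‹_›
  · intro P hP
    have := Ideal.isPrime_of_prime hP
    let p : {p : Ideal (𝓞 F) // Prime p} := ⟨P.under (𝓞 F), Ideal.prime_of_isPrime
      (Ideal.under_ne_bot (𝓞 F) hP.ne_zero) inferInstance⟩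
    exact ⟨{p}, Finset.mem_biUnion.mpr ⟨p, Finset.mem_singleton_self _,
      (hmem p P).mpr ⟨this, ⟨rfl⟩⟩⟩⟩

variable (F) in
theorem tendsto_prod_zetaTerm (s : ℝ) :
    Tendsto (fun i : Finset {p : Ideal (𝓞 F) // Prime p} ↦ ∏ p ∈ i, (1 - zetaTerm s p.1)⁻¹) atTop
      (𝓝 (zetaSum F s)) := by
  have h := tendsto_zetaSum (K := F) (X := fun i : Finset {p : Ideal (𝓞 F) // Prime p} ↦
    i.image Subtype.val) ?_ ?_ ?_ s
  · refine h.congr fun i ↦ ?_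
    rw [Finset.prod_image Subtype.val_injective.injOn]
  · exact fun i j hij ↦ Finset.image_subset_image hij
  · intro i P hP
    obtain ⟨p, -, rfl⟩ := Finset.mem_image.mp hP
    exact p.2
  · exact fun P hP ↦ ⟨{⟨P, hP⟩}, by simp⟩

theorem zetaTerm_of_liesOver {p : Ideal (𝓞 F)} (hp : Prime p) (P : Ideal (𝓞 E)) [P.IsPrime]
    [P.LiesOver p] (s : ℝ) : zetaTerm s P = zetaTerm s p ^ P.inertiaDeg (𝓞 F) := by
  have := (Ideal.isPrime_of_prime hp).isMaximal hp.ne_zero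
  have : P.IsMaximal := Ideal.IsPrime.isMaximal inferInstance
    (Ideal.ne_bot_of_liesOver_of_ne_bot hp.ne_zero P)
  rw [zetaTerm, absNorm_eq_pow_inertiaDeg'_of_liesOver P p inferInstance hp.ne_zero,
    inertiaDeg'_eq_inertiaDeg, zetaTerm, ← ENNReal.ofReal_pow (by positivity),
    Nat.cast_pow, ← Real.rpow_natCast, ← Real.rpow_natCast, ← Real.rpow_mul (by positivity),
    ← Real.rpow_mul (by positivity), mul_comm]

theorem zetaTerm_le_one {s : ℝ} (hs : 0 < s) {a : Ideal (𝓞 F)} (ha : a ≠ 0) :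
    zetaTerm s a ≤ 1 := by
  rw [zetaTerm, ENNReal.ofReal_le_one]
  refine Real.rpow_le_one_of_one_le_of_nonpos ?_ (by linarith)
  exact_mod_cast one_le_absNorm_nonZeroDivisors (K := F) ⟨a, mem_nonZeroDivisors_of_ne_zero ha⟩

theorem card_primesOverFinset_le {p : Ideal (𝓞 F)} (hp : Prime p) :
    (IsDedekindDomain.primesOverFinset p (𝓞 E)).card ≤ finrank F E := by
  have := (Ideal.isPrime_of_prime hp).isMaximal hp.ne_zero
  have h := sum_ramification_inertia_eq_finrank p (𝓞 E)
  rw [← IsFractionRing.finrank_eq (𝓞 F) F (𝓞 E) E] at h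
  rw [← h]
  have h2 : (IsDedekindDomain.primesOverFinset p (𝓞 E)).card =
      ∑ q : primesOver p (𝓞 E), 1 := by
    rw [Finset.sum_const, smul_eq_mul, mul_one, Finset.card_univ, ← Set.toFinset_card]
    congr 1
    ext P
    rw [IsDedekindDomain.mem_primesOverFinset_iff hp.ne_zero, Set.mem_toFinset]
  rw [h2]
  refine Finset.sum_le_sum fun q _ ↦ ?_
  have := q.2.1
  exact Nat.mul_pos (ramificationIdx_pos _ _) (inertiaDeg_pos _ _)

theorem localFactor_le {p : Ideal (𝓞 F)} (hp : Prime p) {s : ℝ} (hs : 0 < s) :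
    localFactor F E p s ≤ (1 - zetaTerm s p)⁻¹ ^ finrank F E := by
  have := (Ideal.isPrime_of_prime hp).isMaximal hp.ne_zero
  refine (Finset.prod_le_pow_card _ _ _ fun P hP ↦ ?_).trans
    (pow_le_pow_right₀ (ENNReal.one_le_inv.mpr tsub_le_self) (card_primesOverFinset_le hp))
  have hP' := (IsDedekindDomain.mem_primesOverFinset_iff hp.ne_zero _).mp hP
  have := hP'.1
  have := hP'.2
  refine ENNReal.inv_le_inv.mpr (tsub_le_tsub_left ?_ _)
  rw [zetaTerm_of_liesOver hp P]
  exact pow_le_of_le_one zero_le (zetaTerm_le_one hs hp.ne_zero) (inertiaDeg_pos _ _).ne'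

theorem zetaSum_le_pow {s : ℝ} (hs : 0 < s) : zetaSum E s ≤ zetaSum F s ^ finrank F E := by
  refine le_of_tendsto_of_tendsto' (tendsto_prod_localFactor (F := F) s)
    (ENNReal.Tendsto.pow (tendsto_prod_zetaTerm F s)) fun i ↦ ?_
  rw [← Finset.prod_pow]
  exact Finset.prod_le_prod' fun p _ ↦ localFactor_le p.2 hs

theorem zetaSum_ne_zero (s : ℝ) : zetaSum F s ≠ 0 := by
  refine (ENNReal.tsum_eq_zero.not.mpr ?_)
  push Not
  refine ⟨1, ?_⟩
  simp

/-- Local relations between Euler factors imply the relation between zeta functions. -/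
theorem zetaSum_relation {E₁ E₂ E₃ : Type*}
    [Field E₁] [NumberField E₁] [Algebra F E₁] [Field E₂] [NumberField E₂] [Algebra F E₂]
    [Field E₃] [NumberField E₃] [Algebra F E₃]
    (h : ∀ p : Ideal (𝓞 F), Prime p → ∀ s : ℝ, localFactor F E p s * (1 - zetaTerm s p)⁻¹ ^ 2 =
      localFactor F E₁ p s * localFactor F E₂ p s * localFactor F E₃ p s) {s : ℝ} (hs : 1 < s) :
    zetaSum E s * zetaSum F s ^ 2 = zetaSum E₁ s * zetaSum E₂ s * zetaSum E₃ s := by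
  have h1 := ENNReal.Tendsto.mul (tendsto_prod_localFactor (F := F) (E := E) s)
    (Or.inl (zetaSum_ne_zero s)) (ENNReal.Tendsto.pow (n := 2) (tendsto_prod_zetaTerm F s))
    (Or.inr (zetaSum_ne_top hs))
  have h2 := ENNReal.Tendsto.mul (ENNReal.Tendsto.mul (tendsto_prod_localFactor (F := F) (E := E₁) s)
    (Or.inl (zetaSum_ne_zero s)) (tendsto_prod_localFactor (F := F) (E := E₂) s)
    (Or.inr (zetaSum_ne_top hs))) (Or.inl (mul_ne_zero (zetaSum_ne_zero s) (zetaSum_ne_zero s)))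
    (tendsto_prod_localFactor (F := F) (E := E₃) s)
    (Or.inr (ENNReal.mul_ne_top (zetaSum_ne_top hs) (zetaSum_ne_top hs)))
  refine tendsto_nhds_unique (h1.congr fun i ↦ ?_) h2
  rw [← Finset.prod_pow, ← Finset.prod_mul_distrib, ← Finset.prod_mul_distrib,
    ← Finset.prod_mul_distrib]
  exact Finset.prod_congr rfl fun p _ ↦ h p p.2 s

end RelativeEulerProduct

section BiquadraticRelation

open Module Ideal
open scoped Pointwise

attribute [local instance] Ideal.Quotient.field in
/-- In a Galois extension with group of exponent two, inertia degrees divide two. -/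
theorem inertiaDeg_dvd_two {R S G : Type*} [CommRing R] [CommRing S] [Algebra R S] [Group G]
    [MulSemiringAction G S] [IsGaloisGroup G R S] [Finite G] (hG : ∀ g : G, g ^ 2 = 1)
    (p : Ideal R) [p.IsPrime] (P : Ideal S) [P.LiesOver p] [P.IsPrime] [PerfectField p.ResidueField]
    [Finite P.ResidueField] :
    P.inertiaDeg R ∣ 2 := by
  let := Localization.AtPrime.algebraOfLiesOver p P
  have heq : (algebraMap (S ⧸ P) P.ResidueField).comp (algebraMap (R ⧸ p) (S ⧸ P)) =
      (algebraMap p.ResidueField P.ResidueField).comp (algebraMap (R ⧸ p) p.ResidueField) := by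
    ext
    simp [← IsScalarTower.algebraMap_apply]
  let := ((algebraMap (S ⧸ P) P.ResidueField).comp (algebraMap (R ⧸ p) (S ⧸ P))).toAlgebra
  have : IsScalarTower (R ⧸ p) (S ⧸ P) P.ResidueField := .of_algebraMap_eq' rfl
  have : IsScalarTower (R ⧸ p) p.ResidueField P.ResidueField := .of_algebraMap_eq' heq
  have : IsGalois p.ResidueField P.ResidueField :=
    { __ := Ideal.IsFractionRing.normal G p P p.ResidueField P.ResidueField }
  have : Module.Finite p.ResidueField P.ResidueField :=
    Ideal.IsFractionRing.finite_of_isInvariant G p P p.ResidueField P.ResidueField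
  have hfin : Finite p.ResidueField :=
    Finite.of_injective _ (algebraMap p.ResidueField P.ResidueField).injective
  obtain ⟨g, hg⟩ := IsCyclic.exists_zpow_surjective (G := Gal(P.ResidueField/p.ResidueField))
  obtain ⟨τ, hτ⟩ := IsFractionRing.stabilizerHom_surjective G p P p.ResidueField P.ResidueField g
  have hτ2 : τ ^ 2 = 1 := Subtype.ext (hG τ)
  rw [inertiaDeg_eq p P, ← IsGalois.card_aut_eq_finrank p.ResidueField P.ResidueField,
    ← orderOf_eq_card_of_forall_mem_zpowers hg, orderOf_dvd_iff_pow_eq_one, ← hτ, ← map_pow, hτ2,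
    map_one]

variable {F L : Type*} [Field F] [NumberField F] [Field L] [NumberField L] [Algebra F L]
  [IsGalois F L]

theorem localFactor_eq_pow {p : Ideal (𝓞 F)} (hp : Prime p) (P : Ideal (𝓞 L)) [P.IsPrime]
    [P.LiesOver p] (s : ℝ) :
    localFactor F L p s =
      (1 - zetaTerm s p ^ P.inertiaDeg (𝓞 F))⁻¹ ^ (primesOver p (𝓞 L)).ncard := by
  have := (Ideal.isPrime_of_prime hp).isMaximal hp.ne_zero
  have h2 : (IsDedekindDomain.primesOverFinset p (𝓞 L)).card = (primesOver p (𝓞 L)).ncard := by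
    rw [← Set.ncard_coe_finset]
    congr 1
    ext Q
    exact IsDedekindDomain.mem_primesOverFinset_iff hp.ne_zero _
  rw [localFactor, ← h2, ← Finset.prod_const]
  refine Finset.prod_congr rfl fun Q hQ ↦ ?_
  have hQ' := (IsDedekindDomain.mem_primesOverFinset_iff hp.ne_zero _).mp hQ
  have := hQ'.1
  have := hQ'.2
  rw [zetaTerm_of_liesOver hp Q, inertiaDeg_eq_of_isGaloisGroup p Q P Gal(L/F)]

section Subfield

variable {E : Type*} [Field E] [NumberField E] [Algebra F E] [Algebra E L] [IsScalarTower F E L]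
  [IsGalois F E] (H : Subgroup Gal(L/F)) [IsGaloisGroup H E L]

omit [NumberField F] [IsGalois F L] [Algebra F E] [IsScalarTower F E L] [IsGalois F E] in
variable (E) in
theorem isGaloisGroup_ringOfIntegers_subgroup : IsGaloisGroup H (𝓞 E) (𝓞 L) :=
  instIsGaloisGroupRingOfIntegersOfNumberField E L H

omit [IsGalois F L] [Algebra F E] [IsScalarTower F E L] [IsGalois F E] in
theorem card_stabilizer_subgroupOf (P : Ideal (𝓞 L)) [P.IsPrime] (Q : Ideal (𝓞 E)) [Q.IsMaximal]
    [P.LiesOver Q] [PerfectField Q.ResidueField] :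
    Nat.card ((MulAction.stabilizer Gal(L/F) P).subgroupOf H) =
      Nat.card ((inertia Gal(L/F) P).subgroupOf H) * P.inertiaDeg (𝓞 E) := by
  have := isGaloisGroup_ringOfIntegers_subgroup E H
  have h := card_stabilizer_eq_card_inertia_mul_finrank (G := H) Q P
  have h1 : MulAction.stabilizer H P = (MulAction.stabilizer Gal(L/F) P).subgroupOf H := by
    simp [Subgroup.ext_iff, Subgroup.mem_subgroupOf]
  rw [AddSubgroup.subgroupOf_inertia]
  exact (congr_arg (fun S : Subgroup H ↦ Nat.card S) h1.symm).trans h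

theorem ncard_primesOver_mul_card_stabilizer {p : Ideal (𝓞 F)} (hp : Prime p) (P : Ideal (𝓞 L))
    [P.IsPrime] [P.LiesOver p] :
    (primesOver p (𝓞 L)).ncard * Nat.card (MulAction.stabilizer Gal(L/F) P) = Nat.card Gal(L/F) := by
  have := (Ideal.isPrime_of_prime hp).isMaximal hp.ne_zero
  rw [card_stabilizer_eq_card_inertia_mul_finrank p P, ← mul_assoc]
  exact ncard_primesOver_mul_card_inertia_mul_finrank (G := Gal(L/F)) p P

include H in
theorem ncard_primesOver_subfield {p : Ideal (𝓞 F)} (hp : Prime p) (P : Ideal (𝓞 L))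
    [P.IsPrime] [P.LiesOver p] :
    (primesOver p (𝓞 E)).ncard * Nat.card H * Nat.card (MulAction.stabilizer Gal(L/F) P) =
      Nat.card Gal(L/F) * Nat.card ((MulAction.stabilizer Gal(L/F) P).subgroupOf H) := by
  have := (Ideal.isPrime_of_prime hp).isMaximal hp.ne_zero
  let Q := P.under (𝓞 E)
  have : Q.LiesOver p := inferInstance
  have hQ0 : Q ≠ ⊥ := Ideal.ne_bot_of_liesOver_of_ne_bot hp.ne_zero Q
  have : Q.IsMaximal := Ideal.IsPrime.isMaximal inferInstance hQ0
  have := isGaloisGroup_ringOfIntegers_subgroup E H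
  have h1 := ncard_primesOver_mul_card_stabilizer hp P
  have h2 : (Q.primesOver (𝓞 L)).ncard *
      Nat.card ((MulAction.stabilizer Gal(L/F) P).subgroupOf H) = Nat.card H := by
    rw [card_stabilizer_subgroupOf H P Q, AddSubgroup.subgroupOf_inertia, ← mul_assoc]
    exact ncard_primesOver_mul_card_inertia_mul_finrank (G := H) Q P
  have h3 := ncard_primesOver_mul_ncard_primesOver (p := p) Q Gal(E/F) (𝓞 L) Gal(L/F)
  rw [← h1, ← h3, ← h2]
  ring

omit [IsGalois F E] in
include H in
theorem inertiaDeg_subfield {p : Ideal (𝓞 F)} (hp : Prime p) (P : Ideal (𝓞 L))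
    [P.IsPrime] [P.LiesOver p] :
    (P.under (𝓞 E)).inertiaDeg (𝓞 F) * Nat.card ((MulAction.stabilizer Gal(L/F) P).subgroupOf H) *
      Nat.card (inertia Gal(L/F) P) =
    Nat.card (MulAction.stabilizer Gal(L/F) P) * Nat.card ((inertia Gal(L/F) P).subgroupOf H) := by
  have := (Ideal.isPrime_of_prime hp).isMaximal hp.ne_zero
  let Q := P.under (𝓞 E)
  have : Q.LiesOver p := inferInstance
  have hQ0 : Q ≠ ⊥ := Ideal.ne_bot_of_liesOver_of_ne_bot hp.ne_zero Q
  have : Q.IsMaximal := Ideal.IsPrime.isMaximal inferInstance hQ0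
  rw [card_stabilizer_eq_card_inertia_mul_finrank p P, card_stabilizer_subgroupOf H P Q,
    inertiaDeg_tower (R := 𝓞 F) Q P]
  ring

end Subfield

section KleinFour

variable {G : Type*} [Group G]

theorem card_subgroupOf_zpowers (S : Subgroup G) {σ : G} (h1 : σ ≠ 1) (h2 : σ ^ 2 = 1) :
    Nat.card (S.subgroupOf (Subgroup.zpowers σ)) = if σ ∈ S then 2 else 1 := by
  have ho : orderOf σ = 2 := orderOf_eq_prime h2 h1
  split_ifs with h
  · rw [Subgroup.subgroupOf_eq_top.mpr (Subgroup.zpowers_le.mpr h), Subgroup.card_top,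
      Nat.card_zpowers, ho]
  · rw [Subgroup.card_eq_one, Subgroup.subgroupOf_eq_bot, disjoint_comm, Subgroup.disjoint_def]
    intro x hx hxS
    obtain ⟨k, hk, rfl⟩ := Finset.mem_image.mp
      ((isOfFinOrder_iff_pow_eq_one.mpr ⟨2, two_pos, h2⟩).mem_zpowers_iff_mem_range_orderOf.mp hx)
    rw [ho] at hk
    have : k < 2 := Finset.mem_range.mp hk
    interval_cases k
    · simp
    · simp only [pow_one] at hxS
      exact absurd hxS h

theorem univ_eq_of_klein (hG : Nat.card G = 4) {a b : G} (ha : a ≠ 1) (hb : b ≠ 1) (hab : a ≠ b)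
    (hb2 : b ^ 2 = 1) (g : G) : g = 1 ∨ g = a ∨ g = b ∨ g = a * b := by
  have : Finite G := Nat.finite_of_card_ne_zero (by simp [hG])
  have := Fintype.ofFinite G
  have hc : ({1, a, b, a * b} : Finset G).card = 4 := by
    have h1 : a * b ≠ 1 := fun h ↦ hab (by
      rw [pow_two] at hb2; exact mul_right_cancel (h.trans hb2.symm))
    have h2 : a * b ≠ a := fun h ↦ hb (mul_left_cancel (h.trans (mul_one a).symm))
    have h3 : a * b ≠ b := fun h ↦ ha (mul_right_cancel (h.trans (one_mul b).symm))
    rw [Finset.card_insert_of_notMem, Finset.card_insert_of_notMem, Finset.card_insert_of_notMem,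
      Finset.card_singleton]
    · simpa using h3.symm
    · simpa using ⟨hab, hb⟩
    · simpa using ⟨ha.symm, hb.symm, h1.symm⟩
  have hu : ({1, a, b, a * b} : Finset G) = Finset.univ := by
    rw [← Finset.card_eq_iff_eq_univ, hc, ← hG, Nat.card_eq_fintype_card]
  simpa using (hu ▸ Finset.mem_univ g : g ∈ ({1, a, b, a * b} : Finset G))

theorem card_subgroup_of_klein (hG : Nat.card G = 4) {a b : G} (ha : a ≠ 1) (hb : b ≠ 1)
    (hab : a ≠ b) (hb2 : b ^ 2 = 1) (S : Subgroup G) :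
    Nat.card S = 1 + (if a ∈ S then 1 else 0) + (if b ∈ S then 1 else 0) +
      (if a * b ∈ S then 1 else 0) := by
  have h1 : a * b ≠ 1 := fun h ↦ hab (by
    rw [pow_two] at hb2; exact mul_right_cancel (h.trans hb2.symm))
  have h2 : a * b ≠ a := fun h ↦ hb (mul_left_cancel (h.trans (mul_one a).symm))
  have h3 : a * b ≠ b := fun h ↦ ha (mul_right_cancel (h.trans (one_mul b).symm))
  have hS : (S : Set G) = (({1, a, b, a * b} : Finset G).filter (· ∈ S) : Finset G) := by
    ext g
    simp only [SetLike.mem_coe, Finset.coe_filter, Set.mem_ofPred_eq]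
    have := univ_eq_of_klein hG ha hb hab hb2 g
    simp [this]
  rw [← SetLike.coe_sort_coe, Nat.card_coe_set_eq, hS, Set.ncard_coe_finset, Finset.card_filter,
    Finset.sum_insert, Finset.sum_insert, Finset.sum_insert, Finset.sum_singleton]
  · simp only [S.one_mem, if_true]; ring
  · simpa using h3.symm
  · simpa using ⟨hab, hb⟩
  · simpa using ⟨ha.symm, hb.symm, h1.symm⟩

end KleinFour

section Relation

variable {E₁ E₂ E₃ : Type*} [Field E₁] [NumberField E₁] [Algebra F E₁] [Algebra E₁ L]
  [IsScalarTower F E₁ L] [IsGalois F E₁] [Field E₂] [NumberField E₂] [Algebra F E₂] [Algebra E₂ L]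
  [IsScalarTower F E₂ L] [IsGalois F E₂] [Field E₃] [NumberField E₃] [Algebra F E₃] [Algebra E₃ L]
  [IsScalarTower F E₃ L] [IsGalois F E₃]

theorem localFactor_klein (hG : Nat.card Gal(L/F) = 4) {a b : Gal(L/F)} (ha : a ≠ 1) (hb : b ≠ 1)
    (hab : a ≠ b) (ha2 : a ^ 2 = 1) (hb2 : b ^ 2 = 1)
    [IsGaloisGroup (Subgroup.zpowers a) E₁ L] [IsGaloisGroup (Subgroup.zpowers b) E₂ L]
    [IsGaloisGroup (Subgroup.zpowers (a * b)) E₃ L] (p : Ideal (𝓞 F)) (hp : Prime p) (s : ℝ) :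
    localFactor F L p s * (1 - zetaTerm s p)⁻¹ ^ 2 =
      localFactor F E₁ p s * localFactor F E₂ p s * localFactor F E₃ p s := by
  have := (Ideal.isPrime_of_prime hp).isMaximal hp.ne_zero
  obtain ⟨⟨P, _, _⟩⟩ := (inferInstance : Nonempty (primesOver p (𝓞 L)))
  have hP0 : P ≠ ⊥ := Ideal.ne_bot_of_liesOver_of_ne_bot hp.ne_zero P
  have : P.IsMaximal := Ideal.IsPrime.isMaximal inferInstance hP0
  have hab1 : a * b ≠ 1 := fun h ↦ hab (by
    rw [pow_two] at hb2; exact mul_right_cancel (h.trans hb2.symm))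
  have hcomm : b * a = a * b := by
    have h1 : a * a = 1 := by rw [← pow_two, ha2]
    have h2 : b * b = 1 := by rw [← pow_two, hb2]
    rcases univ_eq_of_klein hG ha hb hab hb2 (b * a) with h | h | h | h
    · exact absurd (mul_right_cancel (h.trans h1.symm)).symm hab
    · exact absurd (mul_right_cancel (h.trans (one_mul a).symm)) hb
    · exact absurd (mul_left_cancel (h.trans (mul_one b).symm)) ha
    · exact h
  have hab2 : (a * b) ^ 2 = 1 := by
    rw [pow_two, mul_assoc, ← mul_assoc b, hcomm, mul_assoc, ← pow_two, hb2, mul_one, ← pow_two,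
      ha2]
  have hexp : ∀ g : Gal(L/F), g ^ 2 = 1 := by
    intro g
    rcases univ_eq_of_klein hG ha hb hab hb2 g with rfl | rfl | rfl | rfl <;> simp [*]
  have hf := inertiaDeg_dvd_two hexp p P
  have hD := card_stabilizer_eq_card_inertia_mul_finrank (G := Gal(L/F)) p P
  have hg := ncard_primesOver_mul_card_stabilizer hp P
  have g₁ := ncard_primesOver_subfield (E := E₁) (Subgroup.zpowers a) hp P
  have g₂ := ncard_primesOver_subfield (E := E₂) (Subgroup.zpowers b) hp P
  have g₃ := ncard_primesOver_subfield (E := E₃) (Subgroup.zpowers (a * b)) hp P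
  have f₁ := inertiaDeg_subfield (E := E₁) (Subgroup.zpowers a) hp P
  have f₂ := inertiaDeg_subfield (E := E₂) (Subgroup.zpowers b) hp P
  have f₃ := inertiaDeg_subfield (E := E₃) (Subgroup.zpowers (a * b)) hp P
  rw [localFactor_eq_pow hp P, localFactor_eq_pow hp (P.under (𝓞 E₁)),
    localFactor_eq_pow hp (P.under (𝓞 E₂)), localFactor_eq_pow hp (P.under (𝓞 E₃))]
  rw [card_subgroupOf_zpowers _ ha ha2, Nat.card_zpowers, orderOf_eq_prime ha2 ha, hG] at g₁
  rw [card_subgroupOf_zpowers _ hb hb2, Nat.card_zpowers, orderOf_eq_prime hb2 hb, hG] at g₂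
  rw [card_subgroupOf_zpowers _ hab1 hab2, Nat.card_zpowers, orderOf_eq_prime hab2 hab1, hG] at g₃
  rw [card_subgroupOf_zpowers _ ha ha2, card_subgroupOf_zpowers _ ha ha2] at f₁
  rw [card_subgroupOf_zpowers _ hb hb2, card_subgroupOf_zpowers _ hb hb2] at f₂
  rw [card_subgroupOf_zpowers _ hab1 hab2, card_subgroupOf_zpowers _ hab1 hab2] at f₃
  rw [card_subgroup_of_klein hG ha hb hab hb2] at g₁ g₂ g₃ hg
  rw [card_subgroup_of_klein hG ha hb hab hb2, card_subgroup_of_klein hG ha hb hab hb2]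
    at f₁ f₂ f₃ hD
  rw [hG] at hg
  have hle : inertia Gal(L/F) P ≤ MulAction.stabilizer Gal(L/F) P := inertia_le_stabilizer P
  generalize MulAction.stabilizer Gal(L/F) P = D at *
  generalize inertia Gal(L/F) P = I at *
  generalize P.inertiaDeg (𝓞 F) = f at *
  generalize (P.under (𝓞 E₁)).inertiaDeg (𝓞 F) = f1 at *
  generalize (P.under (𝓞 E₂)).inertiaDeg (𝓞 F) = f2 at *
  generalize (P.under (𝓞 E₃)).inertiaDeg (𝓞 F) = f3 at *
  generalize (primesOver p (𝓞 L)).ncard = n at *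
  generalize (primesOver p (𝓞 E₁)).ncard = n1 at *
  generalize (primesOver p (𝓞 E₂)).ncard = n2 at *
  generalize (primesOver p (𝓞 E₃)).ncard = n3 at *
  have iaD := @hle a
  have ibD := @hle b
  have icD := @hle (a * b)
  have dab : a ∈ D → b ∈ D → a * b ∈ D := D.mul_mem
  have dac : a ∈ D → a * b ∈ D → b ∈ D := fun h h' ↦ (D.mul_mem_cancel_left h).mp h'
  have dbc : b ∈ D → a * b ∈ D → a ∈ D := fun h h' ↦ (D.mul_mem_cancel_right h).mp h'
  have iab : a ∈ I → b ∈ I → a * b ∈ I := I.mul_mem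
  have iac : a ∈ I → a * b ∈ I → b ∈ I := fun h h' ↦ (I.mul_mem_cancel_left h).mp h'
  have ibc : b ∈ I → a * b ∈ I → a ∈ I := fun h h' ↦ (I.mul_mem_cancel_right h).mp h'
  have hf' : f = 1 ∨ f = 2 := (Nat.dvd_prime Nat.prime_two).mp hf
  generalize zetaTerm s p = x at *
  clear hf
  by_cases da : a ∈ D <;> by_cases db : b ∈ D <;> by_cases dc : a * b ∈ D <;>
    first
    | exact absurd (dab da db) dc
    | exact absurd (dac da dc) db
    | exact absurd (dbc db dc) da
    | skip
  all_goals
    by_cases ia : a ∈ I <;> by_cases ib : b ∈ I <;> by_cases ic : a * b ∈ I <;>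
      first
      | exact absurd (iab ia ib) ic
      | exact absurd (iac ia ic) ib
      | exact absurd (ibc ib ic) ia
      | exact absurd (iaD ia) da
      | exact absurd (ibD ib) db
      | exact absurd (icD ic) dc
      | skip
  all_goals
    clear hle iaD ibD icD dab dac dbc iab iac ibc
    simp only [da, db, dc, ia, ib, ic, if_true, if_false, Nat.add_zero, Nat.reduceAdd,
      Nat.mul_assoc, Nat.reduceMul, Nat.mul_one] at hD hg g₁ g₂ g₃ f₁ f₂ f₃
    rcases hf' with rfl | rfl <;> try omega
  all_goals
    have h : f1 = 1 ∨ f1 = 2 := by omega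
    rcases h with rfl | rfl <;> try omega
  all_goals
    have h : f2 = 1 ∨ f2 = 2 := by omega
    rcases h with rfl | rfl <;> try omega
  all_goals
    have h : f3 = 1 ∨ f3 = 2 := by omega
    rcases h with rfl | rfl <;> try omega
  all_goals
    have h : n = 1 ∨ n = 2 ∨ n = 4 := by omega
    rcases h with rfl | rfl | rfl <;> try omega
  all_goals
    have h : n1 = 1 ∨ n1 = 2 := by omega
    rcases h with rfl | rfl <;> try omega
  all_goals
    have h : n2 = 1 ∨ n2 = 2 := by omega
    rcases h with rfl | rfl <;> try omega
  all_goals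
    have h : n3 = 1 ∨ n3 = 2 := by omega
    rcases h with rfl | rfl <;> try omega
  all_goals
    simp only [pow_one]
    try ring

end Relation

end BiquadraticRelation

section BiquadraticFields

open Module IntermediateField

theorem isGaloisGroup_fixingSubgroup_fieldRange {F E L : Type*} [Field F] [Field E] [Field L]
    [Algebra F E] [Algebra E L] [Algebra F L] [IsScalarTower F E L] [FiniteDimensional F L]
    [IsGalois F L] :
    IsGaloisGroup (IsScalarTower.toAlgHom F E L).fieldRange.fixingSubgroup E L where
  faithful := inferInstance
  commutes := ⟨fun g e x ↦ by
    have h : g • algebraMap E L e = algebraMap E L e :=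
      (mem_fixingSubgroup_iff _ _).mp g.2 _ ⟨e, rfl⟩
    rw [Algebra.smul_def, Algebra.smul_def, smul_mul', h]⟩
  isInvariant := ⟨fun b hb ↦ by
    have h : b ∈ fixedField (IsScalarTower.toAlgHom F E L).fieldRange.fixingSubgroup := fun g ↦ hb g
    rw [IsGalois.fixedField_fixingSubgroup] at h
    exact h⟩

theorem exists_eq_zpowers_of_card_eq_two {G : Type*} [Group G] (H : Subgroup G)
    (hH : Nat.card H = 2) : ∃ σ : G, σ ≠ 1 ∧ σ ^ 2 = 1 ∧ H = Subgroup.zpowers σ := by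
  have : Finite H := Nat.finite_of_card_ne_zero (by simp [hH])
  have : Nontrivial H := Finite.one_lt_card_iff_nontrivial.mp (by simp [hH])
  obtain ⟨σ, hσ⟩ := exists_ne (1 : H)
  have h2 : (σ : G) ^ 2 = 1 := by
    have := pow_card_eq_one' (x := σ)
    rw [hH] at this
    exact_mod_cast congr_arg Subtype.val this
  have h1 : (σ : G) ≠ 1 := fun h ↦ hσ (Subtype.ext h)
  refine ⟨σ, h1, h2, (Subgroup.eq_of_le_of_card_ge (Subgroup.zpowers_le.mpr σ.2) ?_).symm⟩
  rw [hH, Nat.card_zpowers, orderOf_eq_prime h2 h1]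

/-- The relation between the zeta functions of the subfields of a biquadratic extension. -/
theorem exists_zetaSum_relation {F E₁ E₂ L : Type*} [Field F] [NumberField F] [Field L]
    [NumberField L] [Algebra F L] [IsGalois F L] [Field E₁] [NumberField E₁] [Algebra F E₁]
    [Algebra E₁ L] [IsScalarTower F E₁ L] [Field E₂] [NumberField E₂] [Algebra F E₂] [Algebra E₂ L]
    [IsScalarTower F E₂ L] (hL : finrank F L = 4) (h₁ : finrank F E₁ = 2) (h₂ : finrank F E₂ = 2)
    (hne : (IsScalarTower.toAlgHom F E₁ L).fieldRange ≠ (IsScalarTower.toAlgHom F E₂ L).fieldRange) :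
    ∃ E₃ : IntermediateField F L, finrank F E₃ = 2 ∧ ∀ s : ℝ, 1 < s →
      zetaSum L s * zetaSum F s ^ 2 = zetaSum E₁ s * zetaSum E₂ s * zetaSum E₃ s := by
  have hG : Nat.card Gal(L/F) = 4 := (IsGalois.card_aut_eq_finrank F L).trans hL
  have g₁ := isGaloisGroup_fixingSubgroup_fieldRange (F := F) (E := E₁) (L := L)
  have g₂ := isGaloisGroup_fixingSubgroup_fieldRange (F := F) (E := E₂) (L := L)
  have c₁ : Nat.card (IsScalarTower.toAlgHom F E₁ L).fieldRange.fixingSubgroup = 2 := by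
    have h4 := finrank_mul_finrank F E₁ L
    rw [IsGaloisGroup.card_eq_finrank _ E₁ L]
    lia
  have c₂ : Nat.card (IsScalarTower.toAlgHom F E₂ L).fieldRange.fixingSubgroup = 2 := by
    have h4 := finrank_mul_finrank F E₂ L
    rw [IsGaloisGroup.card_eq_finrank _ E₂ L]
    lia
  obtain ⟨a, ha, ha2, hHa⟩ := exists_eq_zpowers_of_card_eq_two _ c₁
  obtain ⟨b, hb, hb2, hHb⟩ := exists_eq_zpowers_of_card_eq_two _ c₂
  have hab : a ≠ b := by
    rintro rfl
    apply hne
    rw [← IsGalois.fixedField_fixingSubgroup (IsScalarTower.toAlgHom F E₁ L).fieldRange,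
      ← IsGalois.fixedField_fixingSubgroup (IsScalarTower.toAlgHom F E₂ L).fieldRange, hHa, hHb]
  rw [hHa] at g₁
  rw [hHb] at g₂
  have hab1 : a * b ≠ 1 := fun h ↦ hab (by
    rw [pow_two] at hb2; exact mul_right_cancel (h.trans hb2.symm))
  have hab2 : (a * b) ^ 2 = 1 := by
    have : IsMulCommutative Gal(L/F) :=
      IsPGroup.isMulCommutative_of_card_eq_prime_sq (p := 2) (by rw [hG]; norm_num)
    rw [Commute.mul_pow (this.is_comm.comm a b), ha2, hb2, one_mul]
  have : Algebra.IsQuadraticExtension F E₁ := ⟨h₁⟩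
  have : Algebra.IsQuadraticExtension F E₂ := ⟨h₂⟩
  let E₃ : IntermediateField F L := fixedField (Subgroup.zpowers (a * b))
  have g₃ : IsGaloisGroup (Subgroup.zpowers (a * b)) E₃ L :=
    IsGaloisGroup.subgroup Gal(L/F) F L _
  have h₃ : finrank F E₃ = 2 := by
    have h4 := finrank_mul_finrank F E₃ L
    rw [← IsGaloisGroup.card_eq_finrank (Subgroup.zpowers (a * b)) E₃ L, Nat.card_zpowers,
      orderOf_eq_prime hab2 hab1] at h4
    lia
  have : Algebra.IsQuadraticExtension F E₃ := ⟨h₃⟩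
  exact ⟨E₃, h₃, fun s hs ↦ zetaSum_relation (localFactor_klein hG ha hb hab ha2 hb2) hs⟩

end BiquadraticFields

section Compositum

open Module Polynomial

attribute [local instance] FractionRing.liftAlgebra in
theorem absNorm_differentIdeal_le {E₁ E L : Type*} [Field E₁] [NumberField E₁] [Field E]
    [NumberField E] [Field L] [NumberField L] [Algebra E L] [Algebra E₁ L]
    (hL : Algebra.adjoin E (Set.range (algebraMap E₁ L)) = ⊤) (α : 𝓞 E₁)
    (hα : IntermediateField.adjoin ℚ {(α : E₁)} = ⊤) :
    Ideal.absNorm (differentIdeal (𝓞 E) (𝓞 L)) ≤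
      Ideal.absNorm (Ideal.span {aeval α (derivative (minpoly ℤ α))}) ^ finrank E₁ L := by
  set β : 𝓞 L := algebraMap (𝓞 E₁) (𝓞 L) α with hβdef
  have hβ : (β : L) = algebraMap E₁ L α := rfl
  have hα' : Algebra.adjoin ℚ {(α : E₁)} = ⊤ := by
    rw [← IntermediateField.adjoin_simple_toSubalgebra_of_isAlgebraic
      (Algebra.IsAlgebraic.isAlgebraic _), hα, IntermediateField.top_toSubalgebra]
  have hβtop : Algebra.adjoin E {algebraMap (𝓞 L) L β} = ⊤ := by
    rw [eq_top_iff, ← hL, Algebra.adjoin_le_iff]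
    rintro _ ⟨x, rfl⟩
    have hx : x ∈ Algebra.adjoin ℚ {(α : E₁)} := hα' ▸ Algebra.mem_top
    induction hx using Algebra.adjoin_induction with
    | mem y hy =>
      rw [Set.mem_singleton_iff] at hy
      subst hy
      exact Algebra.subset_adjoin rfl
    | algebraMap q =>
      have := algebraMap_mem (Algebra.adjoin E {algebraMap (𝓞 L) L β}) (q : E)
      simpa using this
    | add _ _ _ _ h h' => rw [map_add]; exact add_mem h h'
    | mul _ _ _ _ h h' => rw [map_mul]; exact mul_mem h h'
  have h_integ : IsIntegral ℤ α := RingOfIntegers.isIntegral α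
  obtain ⟨q, hq⟩ : minpoly (𝓞 E) β ∣ (minpoly ℤ α).map (algebraMap ℤ (𝓞 E)) := by
    apply minpoly.isIntegrallyClosed_dvd (Algebra.IsIntegral.isIntegral _)
    rw [aeval_map_algebraMap, hβdef, aeval_algebraMap_apply, minpoly.aeval, map_zero]
  have hmem : algebraMap (𝓞 E₁) (𝓞 L) (aeval α (derivative (minpoly ℤ α))) ∈
      differentIdeal (𝓞 E) (𝓞 L) := by
    rw [← aeval_algebraMap_apply, ← hβdef, ← aeval_map_algebraMap (𝓞 E), ← derivative_map, hq,
      derivative_mul, map_add, map_mul, map_mul, minpoly.aeval, zero_mul, add_zero]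
    exact Ideal.mul_mem_right _ _ (aeval_derivative_mem_differentIdeal (𝓞 E) E L β hβtop)
  have hne : aeval α (derivative (minpoly ℤ α)) ≠ 0 := by
    have hsep := (minpoly.irreducible (Algebra.IsIntegral.isIntegral (R := ℚ) (α : E₁))).separable
    have h0 := hsep.aeval_derivative_ne_zero (minpoly.aeval ℚ (α : E₁))
    intro h
    apply h0
    rw [minpoly.isIntegrallyClosed_eq_field_fractions ℚ E₁ h_integ, derivative_map,
      aeval_map_algebraMap, aeval_algebraMap_apply, h, map_zero]
  rw [IsFractionRing.finrank_eq (𝓞 E₁) E₁ (𝓞 L) L, ← Ideal.absNorm_algebraMap,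
    Ideal.map_span, Set.image_singleton]
  refine Nat.le_of_dvd ?_ (Ideal.absNorm_dvd_absNorm_of_le ?_)
  · rw [Nat.pos_iff_ne_zero, Ne, Ideal.absNorm_eq_zero_iff, Ideal.span_singleton_eq_bot]
    exact (map_ne_zero_iff _ (FaithfulSMul.algebraMap_injective _ _)).mpr hne
  · rwa [Ideal.span_singleton_le_iff_mem]

theorem exists_abs_discr_le (E₁ : Type*) [Field E₁] [NumberField E₁] :
    ∃ C : ℕ, ∀ (E L : Type*) [Field E] [NumberField E] [Field L] [NumberField L] [Algebra E L]
      [Algebra E₁ L], Algebra.adjoin E (Set.range (algebraMap E₁ L)) = ⊤ →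
      (discr L).natAbs ≤ C ^ finrank E₁ L * (discr E).natAbs ^ finrank E L := by
  obtain ⟨a, ha⟩ := Field.exists_primitive_element ℚ E₁
  obtain ⟨α, n, hn, h⟩ : ∃ (α : 𝓞 E₁) (n : ℤ), n ≠ 0 ∧ (α : E₁) = n • a := by
    obtain ⟨n, hn, h⟩ := IsAlgebraic.exists_integral_multiple (R := ℤ) (A := E₁) (z := a)
      ((IsFractionRing.isAlgebraic_iff ℤ ℚ E₁).mpr (Algebra.IsAlgebraic.isAlgebraic a))
    exact ⟨⟨n • a, h⟩, n, hn, rfl⟩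
  have hα : IntermediateField.adjoin ℚ {(α : E₁)} = ⊤ := by
    rw [eq_top_iff, ← ha, IntermediateField.adjoin_simple_le_iff]
    have : a = (n : ℚ)⁻¹ • (α : E₁) := by
      rw [h, ← Int.cast_smul_eq_zsmul ℚ, smul_smul, inv_mul_cancel₀ (by exact_mod_cast hn), one_smul]
    rw [this]
    exact IntermediateField.smul_mem _ (IntermediateField.mem_adjoin_simple_self ℚ _)
  refine ⟨Ideal.absNorm (Ideal.span {aeval α (derivative (minpoly ℤ α))}), ?_⟩
  intro E L _ _ _ _ _ _ hL
  rw [natAbs_discr_eq_absNorm_differentIdeal_mul_natAbs_discr_pow E (𝓞 E) L (𝓞 L)]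
  exact Nat.mul_le_mul_right _ (absNorm_differentIdeal_le hL α hα)

section

variable {F Ω : Type*} [Field F] [NumberField F] [Field Ω] [Algebra F Ω]
  {E₁ E₂ : IntermediateField F Ω}

omit [NumberField F] in
theorem finrank_sup_of_quadratic (h₁ : finrank F E₁ = 2) (h₂ : finrank F E₂ = 2) (h : E₁ ≠ E₂) :
    finrank F ↥(E₁ ⊔ E₂) = 4 := by
  have : FiniteDimensional F E₁ := FiniteDimensional.of_finrank_pos (by lia)
  have : FiniteDimensional F E₂ := FiniteDimensional.of_finrank_pos (by lia)
  have hle := IntermediateField.finrank_sup_le E₁ E₂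
  obtain ⟨k, hk⟩ := IntermediateField.finrank_dvd_of_le_right (le_sup_left : E₁ ≤ E₁ ⊔ E₂)
  have hne : finrank F ↥(E₁ ⊔ E₂) ≠ 2 := by
    intro h2
    have e1 := IntermediateField.eq_of_le_of_finrank_eq (le_sup_left : E₁ ≤ E₁ ⊔ E₂) (by lia)
    have e2 := IntermediateField.eq_of_le_of_finrank_eq (le_sup_right : E₂ ≤ E₁ ⊔ E₂) (by lia)
    exact h (e1.trans e2.symm)
  have : 0 < finrank F ↥(E₁ ⊔ E₂) := finrank_pos
  rw [h₁, h₂] at hle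
  rw [h₁] at hk
  lia

theorem isGalois_sup_of_quadratic (h₁ : finrank F E₁ = 2) (h₂ : finrank F E₂ = 2) :
    IsGalois F ↥(E₁ ⊔ E₂) := by
  have : FiniteDimensional F E₁ := FiniteDimensional.of_finrank_pos (by lia)
  have : FiniteDimensional F E₂ := FiniteDimensional.of_finrank_pos (by lia)
  have : Algebra.IsQuadraticExtension F E₁ := ⟨h₁⟩
  have : Algebra.IsQuadraticExtension F E₂ := ⟨h₂⟩
  exact ⟨⟩

end

end Compositum

section DiscriminantBounds

open Module NumberField.Units NumberField.InfinitePlace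

/-- A constant such that `errConst K ≤ errBase d * |discr K| ^ (d ^ 2)` in degree `d`. -/
noncomputable def errBase (d : ℕ) : ℝ := (d + 1) * (1 + d * (2 ^ (d + 2)) ^ d) ^ d

theorem one_le_errBase (d : ℕ) : 1 ≤ errBase d := by
  have h1 : (1 : ℝ) ≤ 1 + d * (2 ^ (d + 2)) ^ d := le_add_of_nonneg_right (by positivity)
  exact one_le_mul_of_one_le_of_one_le (by simp) (one_le_pow₀ h1)

variable (K : Type*) [Field K] [NumberField K]

theorem one_le_abs_discr_real : (1 : ℝ) ≤ |(discr K : ℝ)| := by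
  exact_mod_cast Int.one_le_abs (discr_ne_zero K)

theorem errConst_le : errConst K ≤ errBase (finrank ℚ K) * |(discr K : ℝ)| ^ (finrank ℚ K) ^ 2 := by
  set d := finrank ℚ K
  have hΔ := one_le_abs_discr_real K
  have hs : (NNReal.sqrt ‖discr K‖₊ : ℝ) ≤ |(discr K : ℝ)| := by
    rw [Real.coe_sqrt, coe_nnnorm, Int.norm_eq_abs]
    rw [Real.sqrt_le_left (by positivity)]
    nlinarith
  have hc : (coverBound K : ℝ) ≤ d * (2 ^ (d + 2)) ^ d * |(discr K : ℝ)| ^ d := by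
    rw [coverBound, mul_assoc, ← mul_pow]
    push_cast at hs ⊢
    gcongr
  have hc' : 1 + (coverBound K : ℝ) ≤ (1 + d * (2 ^ (d + 2)) ^ d) * |(discr K : ℝ)| ^ d := by
    have := one_le_pow₀ hΔ (n := d)
    rw [add_mul]
    linarith
  have hpow : |(discr K : ℝ)| ^ d ^ 2 = (|(discr K : ℝ)| ^ d) ^ d := by rw [← pow_mul, sq]
  rw [errConst, errBase, hpow, mul_assoc, ← mul_pow]
  gcongr

theorem rank_add_one_le : rank K + 1 ≤ finrank ℚ K := by
  have h1 : rank K + 1 = Fintype.card (InfinitePlace K) := by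
    have : 0 < Fintype.card (InfinitePlace K) := Fintype.card_pos
    rw [rank]
    lia
  have h2 := card_eq_nrRealPlaces_add_nrComplexPlaces K
  have h3 := card_add_two_mul_card_eq_rank K
  lia

variable {K}

theorem errConst_rpow_le {t : ℝ} (ht : 0 ≤ t) :
    errConst K ^ t ≤ errBase (finrank ℚ K) ^ t *
      |(discr K : ℝ)| ^ ((finrank ℚ K : ℝ) ^ 2 * t) := by
  have hΔ := abs_discr_real_pos K
  have hA := one_le_errBase (finrank ℚ K)
  refine (Real.rpow_le_rpow errConst_pos.le (errConst_le K) ht).trans_eq ?_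
  rw [Real.mul_rpow (by linarith) (by positivity), ← Real.rpow_natCast_mul hΔ.le]
  push_cast
  rfl

universe u

theorem exists_zetaDensity_le (d : ℕ) {η : ℝ} (hη : 0 < η) :
    ∃ C : ℝ, 0 < C ∧ ∀ (K : Type u) [Field K] [NumberField K], finrank ℚ K = d →
      zetaDensity K ≤ C * |(discr K : ℝ)| ^ (d ^ 3 * η) * (zetaSum K (1 + η)).toReal := by
  have hA := one_le_errBase d
  refine ⟨2 * η * (2 ^ (d * η) * errBase d ^ (d * η)), by positivity, ?_⟩
  rintro K _ _ rfl
  refine (zetaDensity_le (K := K) hη).trans ?_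
  have h := errConst_rpow_le (K := K) (t := finrank ℚ K * η) (by positivity)
  rw [Real.mul_rpow (by norm_num) errConst_pos.le]
  calc _ ≤ 2 * η * (2 ^ (finrank ℚ K * η) * (errBase (finrank ℚ K) ^ (finrank ℚ K * η) *
      |(discr K : ℝ)| ^ ((finrank ℚ K : ℝ) ^ 2 * (finrank ℚ K * η)))) *
      (zetaSum K (1 + η)).toReal := by gcongr
    _ = _ := by
      rw [show ((finrank ℚ K : ℝ) ^ 2 * (finrank ℚ K * η)) = (finrank ℚ K : ℝ) ^ 3 * η by ring]
      ring

theorem exists_le_zetaDensity (d : ℕ) {δ : ℝ} (hδ : 0 < δ) (hδd : δ ≤ 1 / (2 * d)) :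
    ∃ c : ℝ, 0 < c ∧ ∀ (K : Type u) [Field K] [NumberField K], finrank ℚ K = d →
      ∀ s : ℝ, 1 - δ ≤ s → s < 1 → 0 ≤ zetaReg K s →
      c * (1 - s) * |(discr K : ℝ)| ^ (-(2 * d ^ 3 * δ)) ≤ zetaDensity K := by
  have hA := one_le_errBase d
  rcases Nat.eq_zero_or_pos d with rfl | hd
  · refine ⟨1, one_pos, fun K _ _ hK ↦ absurd hK finrank_pos.ne'⟩
  refine ⟨(1 / (3 * d)) ^ d / 16 * (errBase d ^ (2 * d * δ))⁻¹, by positivity, ?_⟩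
  rintro K _ _ rfl s hs hs1 h0
  set d := finrank ℚ K with hddef
  have hd1 : (1 : ℝ) ≤ d := by exact_mod_cast hd
  have hδ1 : 1 / (2 * d : ℝ) < 1 := by
    rw [div_lt_one (by positivity)]; linarith
  have hs0 : 0 < s := by linarith
  have h0' : 0 ≤ zetaDensity K + (s - 1) * errorMellin K s :=
    nonneg_of_mul_nonneg_right h0 (by positivity)
  have hκ := zetaDensity_pos K
  have h1 := le_zetaDensity_of_nonneg (by linarith) hs1 h0'
  have hM : 1 ≤ errConst K := by linarith [two_le_errConst K]
  have h2 : errConst K ^ (2 * d * (1 - s)) ≤ errBase d ^ (2 * d * δ) *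
      |(discr K : ℝ)| ^ (2 * d ^ 3 * δ) := by
    refine (Real.rpow_le_rpow_of_exponent_le hM (z := 2 * d * δ) ?_).trans ?_
    · gcongr; linarith
    refine (errConst_rpow_le (by positivity)).trans_eq ?_
    congr 2; ring
  have hr : (rank K : ℝ) + 1 ≤ d := by exact_mod_cast rank_add_one_le K
  have h3 : (1 / (3 * d) : ℝ) ^ d ≤ (1 / (3 * (rank K + 1)) : ℝ) ^ rank K := by
    have hr' : rank K ≤ d := by have := rank_add_one_le K; lia
    calc (1 / (3 * d) : ℝ) ^ d ≤ (1 / (3 * d) : ℝ) ^ rank K :=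
          pow_le_pow_of_le_one (by positivity) (by
            rw [div_le_one (by positivity)]; linarith) hr'
      _ ≤ _ := by gcongr
  have hΔ := abs_discr_real_pos K
  set P := |(discr K : ℝ)| ^ (2 * d ^ 3 * δ) with hP
  set B := errBase d ^ (2 * d * δ) with hB
  have hPpos : 0 < P := by positivity
  have hBpos : 0 < B := by positivity
  rw [Real.rpow_neg hΔ.le, ← hP]
  have h4 : (1 / (3 * d) : ℝ) ^ d / 8 * (1 - s) ≤ 2 * zetaDensity K * (B * P) :=
    calc _ ≤ (1 / (3 * (rank K + 1)) : ℝ) ^ rank K / 8 * (1 - s) := by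
          gcongr
      _ ≤ _ := h1.trans (by gcongr)
  rw [show (1 / (3 * d) : ℝ) ^ d / 16 * B⁻¹ * (1 - s) * P⁻¹ =
    (1 / (3 * d) : ℝ) ^ d / 8 * (1 - s) / (2 * (B * P)) by field_simp; ring,
    div_le_iff₀ (by positivity)]
  linarith

end DiscriminantBounds

section QuadraticFamily

open Module

universe u v

variable {F : Type u} {Ω : Type v} [Field F] [NumberField F] [Field Ω] [Algebra F Ω]

omit [NumberField F] in
theorem adjoin_range_eq_top {E₁ E₂ L : Type*} [Field E₁] [Field E₂] [Field L] [Algebra F E₁]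
    [Algebra F E₂] [Algebra F L] [FiniteDimensional F L] [Algebra E₁ L] [Algebra E₂ L]
    [IsScalarTower F E₁ L] [IsScalarTower F E₂ L] (h₁ : finrank F E₁ = 2) (h₂ : finrank F E₂ = 2)
    (hL₂ : finrank E₂ L = 2)
    (hne : (IsScalarTower.toAlgHom F E₁ L).fieldRange ≠ (IsScalarTower.toAlgHom F E₂ L).fieldRange) :
    Algebra.adjoin E₂ (Set.range (algebraMap E₁ L)) = ⊤ := by
  have := Subalgebra.isSimpleOrder_of_finrank hL₂
  refine (eq_bot_or_eq_top _).resolve_left fun h ↦ hne ?_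
  refine IntermediateField.eq_of_le_of_finrank_eq ?_ ?_
  · rintro _ ⟨x, rfl⟩
    have hx : algebraMap E₁ L x ∈ Algebra.adjoin E₂ (Set.range (algebraMap E₁ L)) :=
      Algebra.subset_adjoin ⟨x, rfl⟩
    rw [h, Algebra.mem_bot] at hx
    exact hx
  · have e₁ := (AlgEquiv.ofInjectiveField (IsScalarTower.toAlgHom F E₁ L)).toLinearEquiv.finrank_eq
    have e₂ := (AlgEquiv.ofInjectiveField (IsScalarTower.toAlgHom F E₂ L)).toLinearEquiv.finrank_eq
    exact e₁.symm.trans ((h₁.trans h₂.symm).trans e₂)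

theorem exists_relation_of_fieldRange_ne (F : Type u) [Field F] [NumberField F] (E₁ : Type v)
    [Field E₁] [NumberField E₁] [Algebra F E₁] (h₁ : finrank F E₁ = 2) :
    ∃ C : ℕ, 0 < C ∧ ∀ (E₂ L : Type v) [Field E₂] [NumberField E₂] [Field L] [NumberField L]
      [Algebra F E₂] [Algebra F L] [Algebra E₁ L] [Algebra E₂ L] [IsScalarTower F E₁ L]
      [IsScalarTower F E₂ L] [IsGalois F L], finrank F L = 4 → finrank F E₂ = 2 →
      (IsScalarTower.toAlgHom F E₁ L).fieldRange ≠ (IsScalarTower.toAlgHom F E₂ L).fieldRange →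
      ∃ E₃ : IntermediateField F L, ∃ _ : NumberField E₃, finrank F E₃ = 2 ∧
        (∀ s : ℝ, 1 < s → zetaSum L s * zetaSum F s ^ 2 =
          zetaSum E₁ s * zetaSum E₂ s * zetaSum E₃ s) ∧
        |(discr E₃ : ℝ)| ≤ |(discr L : ℝ)| ∧ |(discr L : ℝ)| ≤ C * |(discr E₂ : ℝ)| ^ 2 := by
  obtain ⟨C, hC⟩ := exists_abs_discr_le.{v, v, v} E₁
  refine ⟨C ^ 2 + 1, by positivity, ?_⟩
  intro E₂ L _ _ _ _ _ _ _ _ _ _ _ hL h₂ hrange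
  have hL₁ : finrank E₁ L = 2 := by
    have := finrank_mul_finrank F E₁ L
    lia
  have hL₂ : finrank E₂ L = 2 := by
    have := finrank_mul_finrank F E₂ L
    lia
  have hadj := adjoin_range_eq_top h₁ h₂ hL₂ hrange
  obtain ⟨E₃, h₃, hrel⟩ := exists_zetaSum_relation hL h₁ h₂ hrange
  have : NumberField E₃ := NumberField.of_module_finite F E₃
  refine ⟨E₃, this, h₃, hrel, ?_, ?_⟩
  · have : (discr E₃) ∣ discr L := discr_dvd_discr E₃ L
    have h := Nat.le_of_dvd (Int.natAbs_pos.mpr (discr_ne_zero L)) (Int.natAbs_dvd_natAbs.mpr this)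
    have h' : ((discr E₃).natAbs : ℝ) ≤ (discr L).natAbs := by exact_mod_cast h
    rw [Nat.cast_natAbs, Nat.cast_natAbs] at h'
    exact_mod_cast h'
  · have := hC E₂ L hadj
    rw [hL₁, hL₂] at this
    have h' : ((discr L).natAbs : ℝ) ≤ (C : ℝ) ^ 2 * ((discr E₂).natAbs : ℝ) ^ 2 := by
      exact_mod_cast this
    rw [Nat.cast_natAbs, Nat.cast_natAbs] at h'
    push_cast at h' ⊢
    nlinarith [sq_nonneg |(discr E₂ : ℝ)|]

theorem exists_compositum_relation {E₁ : IntermediateField F Ω} [NumberField E₁]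
    (h₁ : finrank F E₁ = 2) :
    ∃ C : ℕ, 0 < C ∧ ∀ (E₂ : IntermediateField F Ω) [NumberField E₂], finrank F E₂ = 2 →
      E₁ ≠ E₂ →
      ∃ (L E₃ : Type v) (_ : Field L) (_ : NumberField L) (_ : Field E₃) (_ : NumberField E₃)
        (_ : Algebra F E₃), finrank ℚ L = 4 * finrank ℚ F ∧ finrank F E₃ = 2 ∧
        (∀ s : ℝ, 1 < s → zetaSum L s * zetaSum F s ^ 2 =
          zetaSum E₁ s * zetaSum E₂ s * zetaSum E₃ s) ∧
        |(discr E₃ : ℝ)| ≤ |(discr L : ℝ)| ∧ |(discr L : ℝ)| ≤ C * |(discr E₂ : ℝ)| ^ 2 := by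
  obtain ⟨C, hC0, hC⟩ := exists_relation_of_fieldRange_ne F E₁ h₁
  refine ⟨C, hC0, fun E₂ _ h₂ hne ↦ ?_⟩
  have : CharZero Ω := charZero_of_injective_algebraMap (algebraMap F Ω).injective
  have : FiniteDimensional F E₁ := FiniteDimensional.of_finrank_pos (by lia)
  have : FiniteDimensional F E₂ := FiniteDimensional.of_finrank_pos (by lia)
  have hL := finrank_sup_of_quadratic h₁ h₂ hne
  have : NumberField ↥(E₁ ⊔ E₂) := NumberField.of_module_finite F _
  have : IsGalois F ↥(E₁ ⊔ E₂) := isGalois_sup_of_quadratic h₁ h₂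
  let i₁ : E₁ →ₐ[F] ↥(E₁ ⊔ E₂) := IntermediateField.inclusion le_sup_left
  let i₂ : E₂ →ₐ[F] ↥(E₁ ⊔ E₂) := IntermediateField.inclusion le_sup_right
  let a₁ : Algebra E₁ ↥(E₁ ⊔ E₂) := i₁.toRingHom.toAlgebra
  let a₂ : Algebra E₂ ↥(E₁ ⊔ E₂) := i₂.toRingHom.toAlgebra
  have t₁ : IsScalarTower F E₁ ↥(E₁ ⊔ E₂) := IsScalarTower.of_algebraMap_eq fun x ↦ rfl
  have t₂ : IsScalarTower F E₂ ↥(E₁ ⊔ E₂) := IsScalarTower.of_algebraMap_eq fun x ↦ rfl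
  have hrange : (IsScalarTower.toAlgHom F E₁ ↥(E₁ ⊔ E₂)).fieldRange ≠
      (IsScalarTower.toAlgHom F E₂ ↥(E₁ ⊔ E₂)).fieldRange := by
    intro h
    refine hne (IntermediateField.eq_of_le_of_finrank_eq (fun x hx ↦ ?_) (h₁.trans h₂.symm))
    have hx' : i₁ ⟨x, hx⟩ ∈ (IsScalarTower.toAlgHom F E₁ ↥(E₁ ⊔ E₂)).fieldRange := ⟨⟨x, hx⟩, rfl⟩
    rw [h] at hx'
    obtain ⟨y, hy⟩ := hx'
    have : (y : Ω) = x := congrArg Subtype.val hy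
    exact this ▸ y.2
  obtain ⟨E₃, n₃, h₃, hrel, hd⟩ := hC E₂ ↥(E₁ ⊔ E₂) hL h₂ hrange
  refine ⟨↥(E₁ ⊔ E₂), E₃, inferInstance, inferInstance, inferInstance, n₃, inferInstance, ?_, h₃,
    hrel, hd⟩
  rw [← finrank_mul_finrank ℚ F ↥(E₁ ⊔ E₂), hL, mul_comm]

end QuadraticFamily

section Siegel

open Module

universe u v

theorem contAbscissa_mono {K K' : Type*} [Field K] [NumberField K] [Field K'] [NumberField K']
    (h : finrank ℚ K ≤ finrank ℚ K') : contAbscissa K ≤ contAbscissa K' := by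
  have : (0 : ℝ) < finrank ℚ K := by exact_mod_cast finrank_pos
  rw [contAbscissa, contAbscissa]
  gcongr

variable {F : Type u} {Ω : Type v} [Field F] [NumberField F] [Field Ω] [Algebra F Ω]

theorem exists_le_zetaDensity_of_zero {E₁ : IntermediateField F Ω} [NumberField E₁]
    (h₁ : finrank F E₁ = 2) {δ s : ℝ} (hδ : 0 < δ) (hδF : δ ≤ 1 / (8 * finrank ℚ F))
    (hs : 1 - δ ≤ s) (hs1 : s < 1) (hE₁ : zetaReg E₁ s = 0) (hF : zetaReg F s ≠ 0) :
    ∃ c : ℝ, 0 < c ∧ ∀ (E : IntermediateField F Ω) [NumberField E], finrank F E = 2 → E₁ ≠ E →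
      c * |(discr E : ℝ)| ^ (-(6 * (4 * finrank ℚ F : ℝ) ^ 3 * δ)) ≤ zetaDensity E := by
  set n := finrank ℚ F with hn
  have hn0 : 0 < n := finrank_pos
  have hn1 : (1 : ℝ) ≤ n := by exact_mod_cast hn0
  obtain ⟨C, hC0, hC⟩ := exists_compositum_relation h₁
  obtain ⟨a, ha, hlow⟩ := exists_le_zetaDensity.{v} (4 * n) hδ (by
    push_cast
    rwa [← mul_assoc, show (2 * 4 : ℝ) = 8 by norm_num])
  obtain ⟨b, hb, hup⟩ := exists_zetaDensity_le.{v} (2 * n) hδ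
  set Z := (zetaSum F (1 + δ)).toReal with hZ
  have hδ1 : 1 < 1 + δ := by linarith
  have hZpos : 0 < Z := ENNReal.toReal_pos (zetaSum_ne_zero _) (zetaSum_ne_top hδ1)
  have hκF := zetaDensity_pos F
  have hκ₁ := zetaDensity_pos E₁
  set e : ℝ := 3 * (4 * n : ℝ) ^ 3 * δ with he
  have hepos : 0 < e := by positivity
  have hC0' : (0 : ℝ) < C := by exact_mod_cast hC0
  have hs1' : 0 < 1 - s := by linarith
  refine ⟨a * (1 - s) * zetaDensity F ^ 2 / (zetaDensity E₁ * (b * Z ^ 2) * C ^ e), by positivity, ?_⟩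
  intro E _ hE hne
  obtain ⟨L, E₃, _, _, _, _, _, hL, h₃, hrel, hd₃, hdL⟩ := hC E hE hne
  have hfin (K : Type v) [Field K] [NumberField K] [Algebra F K] (hK : finrank F K = 2) :
      finrank ℚ K = 2 * n := by
    rw [← finrank_mul_finrank ℚ F K, hK, mul_comm]
  have hid {t : ℝ} (ht : contAbscissa L < t) := zetaReg_identity hrel (contAbscissa_lt_one (K := L))
    (contAbscissa_mono (by lia)) (contAbscissa_mono (by have := hfin E₁ h₁; lia))
    (contAbscissa_mono (by have := hfin E hE; lia)) (contAbscissa_mono (by have := hfin E₃ h₃; lia))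
    le_rfl ht
  have hσs : contAbscissa L < s := by
    rw [contAbscissa, hL]
    have : 1 / (8 * n : ℝ) < 1 / ((4 * n : ℕ) : ℝ) := by
      push_cast
      gcongr
      norm_num
    linarith
  have hL0 : zetaReg L s = 0 := by
    have := hid hσs
    rw [hE₁, zero_mul, zero_mul] at this
    exact (mul_eq_zero.mp this).resolve_right (pow_ne_zero 2 hF)
  have hκ := hid contAbscissa_lt_one
  simp only [zetaReg_one] at hκ
  have h1 := hlow L hL s hs hs1 hL0.ge
  have h2 := hup E₃ (hfin E₃ h₃)
  have hζ : (zetaSum E₃ (1 + δ)).toReal ≤ Z ^ 2 := by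
    rw [hZ, ← ENNReal.toReal_pow]
    refine ENNReal.toReal_mono (ENNReal.pow_ne_top (zetaSum_ne_top hδ1)) ?_
    exact h₃ ▸ zetaSum_le_pow (F := F) (E := E₃) (by linarith)
  have hΔL := one_le_abs_discr_real L
  have hΔE := one_le_abs_discr_real E
  have hΔ₃ := one_le_abs_discr_real E₃
  have hκE := zetaDensity_pos E
  push_cast at h1 h2
  set α : ℝ := 2 * (4 * n : ℝ) ^ 3 * δ with hα
  set β : ℝ := (2 * n : ℝ) ^ 3 * δ with hβ
  have hβ0 : 0 ≤ β := by positivity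
  set P := |(discr L : ℝ)| with hP
  have hP0 : 0 < P := by linarith
  have h3 : zetaDensity E₃ ≤ b * P ^ β * Z ^ 2 := h2.trans (by gcongr)
  have h4 : a * (1 - s) * P ^ (-α) * zetaDensity F ^ 2 ≤
      zetaDensity E₁ * zetaDensity E * (b * P ^ β * Z ^ 2) :=
    calc _ ≤ zetaDensity L * zetaDensity F ^ 2 := by gcongr
      _ = zetaDensity E₁ * zetaDensity E * zetaDensity E₃ := hκ
      _ ≤ _ := by gcongr
  have h5 : P ^ (β + α) ≤ (C : ℝ) ^ e * |(discr E : ℝ)| ^ (2 * e) := by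
    calc P ^ (β + α) ≤ P ^ e := by
          apply Real.rpow_le_rpow_of_exponent_le hΔL
          have : (2 * n : ℝ) ^ 3 ≤ (4 * n : ℝ) ^ 3 := by gcongr; norm_num
          rw [hα, hβ, he]
          nlinarith
      _ ≤ (C * |(discr E : ℝ)| ^ 2) ^ e := by gcongr
      _ = _ := by
        rw [Real.mul_rpow hC0'.le (by positivity), ← Real.rpow_natCast_mul (by positivity)]
        push_cast
        rfl
  have h6 : a * (1 - s) * zetaDensity F ^ 2 ≤
      zetaDensity E₁ * zetaDensity E * (b * Z ^ 2) * (C ^ e * |(discr E : ℝ)| ^ (2 * e)) :=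
    calc _ = (a * (1 - s) * P ^ (-α) * zetaDensity F ^ 2) * P ^ α := by
          rw [Real.rpow_neg hP0.le]
          field_simp
      _ ≤ (zetaDensity E₁ * zetaDensity E * (b * P ^ β * Z ^ 2)) * P ^ α := by gcongr
      _ = zetaDensity E₁ * zetaDensity E * (b * Z ^ 2) * P ^ (β + α) := by
          rw [Real.rpow_add hP0]
          ring
      _ ≤ _ := by gcongr
  rw [show 6 * (4 * n : ℝ) ^ 3 * δ = 2 * e by rw [he]; ring, Real.rpow_neg (by positivity),
    ← div_eq_mul_inv, div_div, div_le_iff₀ (by positivity)]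
  linarith

/-- Siegel's lower bound for the residues of the Dedekind zeta functions of the quadratic
extensions of a fixed number field. -/
theorem exists_le_zetaDensity_of_quadratic (F : Type u) (Ω : Type v) [Field F] [NumberField F]
    [Field Ω] [Algebra F Ω] {ε : ℝ} (hε : 0 < ε) :
    ∃ c : ℝ, 0 < c ∧ ∀ (E : IntermediateField F Ω) [NumberField E], finrank F E = 2 →
      c * |(discr E : ℝ)| ^ (-ε) ≤ zetaDensity E := by
  set n := finrank ℚ F with hn
  have hn0 : 0 < n := finrank_pos
  have hn1 : (1 : ℝ) ≤ n := by exact_mod_cast hn0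
  obtain ⟨δ₀, hδ₀, hF⟩ : ∃ δ₀ > 0, ∀ s : ℝ, 1 - δ₀ < s → s < 1 → zetaReg F s ≠ 0 := by
    have hc := continuousOn_zetaReg (K := F)
    have hc1 := hc.continuousAt (Ioi_mem_nhds contAbscissa_lt_one)
    have := hc1.eventually_ne (y := 0) (by rw [zetaReg_one]; exact (zetaDensity_pos F).ne')
    obtain ⟨δ₀, h0, h⟩ := Metric.eventually_nhds_iff.mp this
    refine ⟨δ₀, h0, fun s hs hs1 ↦ h ?_⟩
    rw [Real.dist_eq, abs_lt]
    constructor <;> linarith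
  set δ : ℝ := min (min δ₀ (1 / (8 * n))) (ε / (6 * (4 * n) ^ 3)) with hδ
  have hδpos : 0 < δ := by positivity
  have hδ₁ : δ ≤ δ₀ := (min_le_left _ _).trans (min_le_left _ _)
  have hδ₂ : δ ≤ 1 / (8 * n) := (min_le_left _ _).trans (min_le_right _ _)
  have hδ₃ : 6 * (4 * n) ^ 3 * δ ≤ ε := by
    have : δ ≤ ε / (6 * (4 * n) ^ 3) := min_le_right _ _
    rwa [le_div_iff₀' (by positivity)] at this
  have hpow (E : IntermediateField F Ω) [NumberField E] {t : ℝ} (ht : t ≤ ε) :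
      |(discr E : ℝ)| ^ (-ε) ≤ |(discr E : ℝ)| ^ (-t) :=
    Real.rpow_le_rpow_of_exponent_le (one_le_abs_discr_real E) (by linarith)
  have hfin (K : Type v) [Field K] [NumberField K] [Algebra F K] (hK : finrank F K = 2) :
      finrank ℚ K = 2 * n := by
    rw [← finrank_mul_finrank ℚ F K, hK, mul_comm]
  by_cases hneg : ∃ (E₁ : IntermediateField F Ω) (_ : NumberField E₁), finrank F E₁ = 2 ∧
      zetaReg E₁ (1 - δ / 2) < 0
  · obtain ⟨E₁, _, h₁, hE₁⟩ := hneg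
    obtain ⟨s, hs, hs0⟩ : ∃ s ∈ Set.Ioo (1 - δ / 2) 1, zetaReg E₁ s = 0 := by
      refine intermediate_value_Ioo (by linarith) ((continuousOn_zetaReg (K := E₁)).mono ?_)
        ⟨hE₁, by rw [zetaReg_one]; exact zetaDensity_pos E₁⟩
      intro x hx
      have hx1 : 1 - δ / 2 ≤ x := hx.1
      change contAbscissa E₁ < x
      rw [contAbscissa, hfin E₁ h₁]
      have : 1 / (8 * n : ℝ) < 1 / ((2 * n : ℕ) : ℝ) := by
        push_cast
        gcongr
        norm_num
      linarith
    have hsl : 1 - δ / 2 < s := hs.1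
    have hsr : s < 1 := hs.2
    obtain ⟨c, hc, h⟩ := exists_le_zetaDensity_of_zero h₁ hδpos hδ₂ (by linarith) hsr hs0
      (hF s (by linarith) hsr)
    refine ⟨min c (zetaDensity E₁), lt_min hc (zetaDensity_pos E₁), fun E _ hE ↦ ?_⟩
    have hΔ := abs_discr_real_pos E
    by_cases hne : E₁ = E
    · subst hne
      have h1 : |(discr E₁ : ℝ)| ^ (-ε) ≤ 1 :=
        Real.rpow_le_one_of_one_le_of_nonpos (one_le_abs_discr_real E₁) (by linarith)
      calc _ ≤ zetaDensity E₁ * 1 := by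
            gcongr
            · exact (zetaDensity_pos E₁).le
            · exact min_le_right _ _
        _ = _ := mul_one _
    · refine le_trans ?_ (h E hE hne)
      exact mul_le_mul (min_le_left _ _) (hpow E hδ₃) (by positivity) hc.le
  · push Not at hneg
    obtain ⟨c, hc, h⟩ := exists_le_zetaDensity.{v} (2 * n) hδpos (by
      refine hδ₂.trans ?_
      push_cast
      rw [← mul_assoc]
      gcongr
      norm_num)
    refine ⟨c * (δ / 2), by positivity, fun E _ hE ↦ ?_⟩
    have h1 := h E (hfin E hE) (1 - δ / 2) (by linarith) (by linarith) (hneg E _ hE)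
    rw [sub_sub_cancel] at h1
    refine le_trans ?_ h1
    refine mul_le_mul_of_nonneg_left (hpow E (le_trans ?_ hδ₃)) (by positivity)
    push_cast
    gcongr <;> norm_num

end Siegel

section ClassNumberBounds

open Module NumberField.Units NumberField.InfinitePlace nonZeroDivisors

open NumberField.Units.dirichletUnitTheorem in
theorem regulator_le_of_quadratic (F K : Type*) [Field F] [NumberField F] [Field K] [NumberField K]
    [Algebra F K] [IsTotallyReal F] [IsTotallyComplex K] (h2 : finrank F K = 2) :
    regulator K ≤ 2 ^ rank K * regulator F := by
  have hcard : Fintype.card (InfinitePlace F) = Fintype.card (InfinitePlace K) := by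
    rw [card_eq_nrRealPlaces_add_nrComplexPlaces, card_eq_nrRealPlaces_add_nrComplexPlaces,
      IsTotallyComplex.nrRealPlaces_eq_zero K, IsTotallyReal.nrComplexPlaces_eq_zero, zero_add,
      add_zero, ← IsTotallyReal.finrank, ← Nat.mul_left_cancel_iff zero_lt_two,
      ← IsTotallyComplex.finrank, ← Module.finrank_mul_finrank ℚ F K, mul_comm, h2]
  let p : InfinitePlace K ≃ InfinitePlace F :=
    Equiv.ofBijective (fun w ↦ w.comap (algebraMap F K)) <|
      (Fintype.bijective_iff_surjective_and_card _).mpr ⟨comap_surjective, hcard.symm⟩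
  have hp (w : InfinitePlace F) (x : F) : p.symm w (algebraMap F K x) = w x := by
    rw [← comap_apply]
    exact DFunLike.congr_fun (p.apply_symm_apply w) x
  have hrank : rank F = rank K := by rw [rank, rank, hcard]
  let u (i : Fin (rank K)) : (𝓞 K)ˣ :=
    Units.map (algebraMap (𝓞 F) (𝓞 K)).toMonoidHom (fundSystem F (finCongr hrank.symm i))
  have hreg : regOfFamily u = 2 ^ rank K * regulator F := by
    let W₀ := p.symm w₀
    let f : {w : InfinitePlace K // w ≠ W₀} ≃ {w : InfinitePlace F // w ≠ w₀} :=
      p.subtypeEquiv fun w ↦ by rw [not_iff_not, Equiv.eq_symm_apply]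
    let g := ((finCongr hrank.symm).trans (equivFinRank F)).trans f.symm
    rw [show (2 : ℝ) ^ rank K = |∏ w : {w : InfinitePlace F // w ≠ w₀}, 2| by
      rw [Finset.prod_const, abs_pow, abs_of_pos zero_lt_two, ← hrank, rank]
      simp]
    rw [regulator_eq_regOfFamily_fundSystem, regOfFamily_eq_det _ W₀ g.symm, regOfFamily_eq_det',
      ← abs_mul, ← Matrix.det_mul_column, ← Matrix.det_reindex_self f, Matrix.reindex_apply]
    congr; ext i w
    rw [Matrix.submatrix_apply, Matrix.of_apply, Matrix.of_apply,
      show f.symm w = p.symm w.1 by rfl,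
      show algebraMap (𝓞 K) K _ = algebraMap F K _ by rfl, hp]
    simp [f, g, IsTotallyComplex.mult_eq]
  have hpos : 0 < regOfFamily u := by
    rw [hreg]
    exact mul_pos (by positivity) (regulator_pos F)
  have hdiv := regOfFamily_div_regulator u
  have hR := regulator_pos K
  rw [← hreg, ← one_le_div hR, hdiv]
  have : (0 : ℝ) < (Subgroup.closure (Set.range u) ⊔ torsion K).index := hdiv ▸ div_pos hpos hR
  exact_mod_cast this

theorem classNumber_le (K : Type*) [Field K] [NumberField K] {s : ℝ} (hs : 1 < s) :
    (classNumber K : ℝ) ≤ (2 ^ finrank ℚ K * √|(discr K : ℝ)|) ^ s * (zetaSum K s).toReal := by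
  set X := 2 ^ finrank ℚ K * √|(discr K : ℝ)| with hX
  have hΔ := one_le_abs_discr_real K
  have hX1 : 0 < X := by positivity
  choose I hI hIX using exists_ideal_in_class_of_norm_le (K := K)
  have hIX' (C : ClassGroup (𝓞 K)) : ((I C : Ideal (𝓞 K)).absNorm : ℝ) ≤ X := by
    refine (hIX C).trans ?_
    rw [hX, ← mul_assoc]
    gcongr
    have h1 : ((finrank ℚ K).factorial : ℝ) / (finrank ℚ K) ^ finrank ℚ K ≤ 1 := by
      refine div_le_one_of_le₀ ?_ (by positivity)
      exact_mod_cast Nat.factorial_le_pow _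
    have h2 : (4 / Real.pi) ^ nrComplexPlaces K ≤ 2 ^ finrank ℚ K := by
      have h3 : 4 / Real.pi ≤ 2 := by
        rw [div_le_iff₀ Real.pi_pos]
        linarith [Real.two_le_pi]
      have := card_add_two_mul_card_eq_rank K
      calc (4 / Real.pi) ^ nrComplexPlaces K ≤ 2 ^ nrComplexPlaces K := by gcongr
        _ ≤ 2 ^ finrank ℚ K := by
          gcongr
          · norm_num
          · lia
    calc _ ≤ 2 ^ finrank ℚ K * (1 : ℝ) := by gcongr
      _ = _ := mul_one _
  have hinj : Function.Injective I := fun C D h ↦ by rw [← hI C, ← hI D, h]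
  have key : (classNumber K : ENNReal) ≤ ENNReal.ofReal (X ^ s) * zetaSum K s :=
    calc (classNumber K : ENNReal) = ∑ _C : ClassGroup (𝓞 K), 1 := by
          rw [Finset.sum_const, Finset.card_univ, nsmul_one, classNumber]
      _ ≤ ∑ C : ClassGroup (𝓞 K), ENNReal.ofReal (X ^ s) *
          ENNReal.ofReal (((I C : Ideal (𝓞 K)).absNorm : ℝ) ^ (-s)) := by
        refine Finset.sum_le_sum fun C _ ↦ ?_
        have h1 : (1 : ℝ) ≤ (I C : Ideal (𝓞 K)).absNorm := one_le_absNorm_nonZeroDivisors (I C)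
        rw [← ENNReal.ofReal_mul (by positivity), ← ENNReal.ofReal_one]
        refine ENNReal.ofReal_le_ofReal ?_
        rw [Real.rpow_neg (by positivity), ← div_eq_mul_inv, one_le_div (by positivity)]
        gcongr
        exact hIX' C
      _ = ENNReal.ofReal (X ^ s) * ∑' C : ClassGroup (𝓞 K),
          ENNReal.ofReal (((I C : Ideal (𝓞 K)).absNorm : ℝ) ^ (-s)) := by
        rw [← Finset.mul_sum, tsum_fintype]
      _ ≤ _ := by
        gcongr
        exact ENNReal.tsum_comp_le_tsum_of_injective hinj
          fun a : (Ideal (𝓞 K))⁰ ↦ ENNReal.ofReal (((a : Ideal (𝓞 K)).absNorm : ℝ) ^ (-s))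
  have := ENNReal.toReal_mono (ENNReal.mul_ne_top ENNReal.ofReal_ne_top (zetaSum_ne_top hs)) key
  rwa [ENNReal.toReal_mul, ENNReal.toReal_ofReal (by positivity), ENNReal.toReal_natCast] at this

end ClassNumberBounds

section BrauerSiegel

open Module NumberField.Units NumberField.InfinitePlace

universe u v

theorem boxFactor_le (K : Type*) [Field K] [NumberField K] :
    (boxFactor K : ℝ) ≤ 8 ^ finrank ℚ K := by
  have h := card_add_two_mul_card_eq_rank K
  rw [boxFactor, mixedEmbedding.convexBodyLTFactor]
  push_cast
  have hπ : (NNReal.pi : ℝ) ≤ 4 := Real.pi_le_four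
  calc (2 : ℝ) ^ nrRealPlaces K * (NNReal.pi : ℝ) ^ nrComplexPlaces K * 2 ^ nrComplexPlaces K
      ≤ 8 ^ nrRealPlaces K * 4 ^ nrComplexPlaces K * 2 ^ nrComplexPlaces K := by gcongr; norm_num
    _ = 8 ^ (nrRealPlaces K + nrComplexPlaces K) := by
      rw [mul_assoc, ← mul_pow, pow_add]
      norm_num
    _ ≤ 8 ^ finrank ℚ K := by
      gcongr
      · norm_num
      · lia

theorem zetaDensity_mul_le_classNumber (K : Type*) [Field K] [NumberField K] :
    zetaDensity K * √|(discr K : ℝ)| ≤ classNumber K * regulator K * 8 ^ finrank ℚ K := by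
  have hR := regulator_pos K
  have hs := Real.sqrt_pos.mpr (abs_discr_real_pos K)
  have ht : (1 : ℝ) ≤ torsionOrder K := by exact_mod_cast torsionOrder_pos K
  have hb := boxFactor_le K
  have hb1 := one_le_boxFactor K
  rw [zetaDensity, div_mul_eq_mul_div, div_le_iff₀ (by positivity)]
  have h0 : (0 : ℝ) ≤ classNumber K * regulator K := by positivity
  calc (classNumber K * regulator K * boxFactor K) * √|(discr K : ℝ)|
      ≤ (classNumber K * regulator K * 8 ^ finrank ℚ K) * (1 * √|(discr K : ℝ)|) := by
        rw [one_mul]; gcongr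
    _ ≤ _ := by gcongr

theorem exists_classNumber_bounds (F : Type u) (Ω : Type v) [Field F] [NumberField F]
    [IsTotallyReal F] [Field Ω] [Algebra F Ω] {ε : ℝ} (hε : 0 < ε) :
    ∃ c C : ℝ, 0 < c ∧ 0 < C ∧ ∀ (E : IntermediateField F Ω) [NumberField E], finrank F E = 2 →
      IsTotallyComplex E → c * |(discr E : ℝ)| ^ (1 / 2 - ε) ≤ classNumber E ∧
        (classNumber E : ℝ) ≤ C * |(discr E : ℝ)| ^ (1 / 2 + ε) := by
  obtain ⟨c, hc, h⟩ := exists_le_zetaDensity_of_quadratic F Ω hε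
  have hR := regulator_pos F
  set n := finrank ℚ F with hn
  have hs : 1 < 1 + 2 * ε := by linarith
  have hZ : 0 < (zetaSum F (1 + 2 * ε)).toReal :=
    ENNReal.toReal_pos (zetaSum_ne_zero _) (zetaSum_ne_top hs)
  refine ⟨c / (2 ^ (2 * n) * regulator F * 8 ^ (2 * n)),
    (2 ^ (2 * n)) ^ (1 + 2 * ε) * (zetaSum F (1 + 2 * ε)).toReal ^ 2, by positivity,
    by positivity, ?_⟩
  intro E _ hE _
  have hfin : finrank ℚ E = 2 * n := by
    rw [← finrank_mul_finrank ℚ F E, hE, mul_comm]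
  have hΔ := abs_discr_real_pos E
  constructor
  · have h1 := h E hE
    have h2 := zetaDensity_mul_le_classNumber E
    have h3 : regulator E ≤ 2 ^ (2 * n) * regulator F := by
      refine (regulator_le_of_quadratic F E hE).trans ?_
      gcongr
      · norm_num
      · have := rank_add_one_le E
        lia
    rw [div_mul_eq_mul_div, div_le_iff₀ (by positivity)]
    calc c * |(discr E : ℝ)| ^ (1 / 2 - ε) = c * |(discr E : ℝ)| ^ (-ε) * √|(discr E : ℝ)| := by
          rw [Real.sqrt_eq_rpow, mul_assoc, ← Real.rpow_add hΔ]
          ring_nf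
      _ ≤ zetaDensity E * √|(discr E : ℝ)| := by gcongr
      _ ≤ classNumber E * regulator E * 8 ^ finrank ℚ E := h2
      _ ≤ classNumber E * (2 ^ (2 * n) * regulator F) * 8 ^ finrank ℚ E := by gcongr
      _ = _ := by rw [hfin]; ring
  · have hζ : (zetaSum E (1 + 2 * ε)).toReal ≤ (zetaSum F (1 + 2 * ε)).toReal ^ 2 := by
      rw [← ENNReal.toReal_pow]
      refine ENNReal.toReal_mono (ENNReal.pow_ne_top (zetaSum_ne_top hs)) ?_
      exact hE ▸ zetaSum_le_pow (F := F) (E := E) (by linarith)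
    refine (classNumber_le E hs).trans ?_
    rw [hfin, Real.mul_rpow (by positivity) (by positivity), Real.sqrt_eq_rpow,
      ← Real.rpow_mul hΔ.le, show 1 / 2 * (1 + 2 * ε) = 1 / 2 + ε by ring]
    calc _ ≤ (2 ^ (2 * n)) ^ (1 + 2 * ε) * |(discr E : ℝ)| ^ (1 / 2 + ε) *
          (zetaSum F (1 + 2 * ε)).toReal ^ 2 := by gcongr
      _ = _ := by ring

theorem exists_log_abs_discr_le (F : Type u) (Ω : Type v) [Field F] [NumberField F]
    [IsTotallyReal F] [Field Ω] [Algebra F Ω] {ε : ℝ} (hε : 0 < ε) :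
    ∃ B : ℝ, ∀ (E : IntermediateField F Ω) [NumberField E], finrank F E = 2 →
      IsTotallyComplex E →
      ε * Real.log |(discr E : ℝ)| <
        |Real.log (classNumber E) - 1 / 2 * Real.log (|(discr E : ℝ)|)| →
      Real.log |(discr E : ℝ)| ≤ B := by
  obtain ⟨c, C, hc, hC, h⟩ := exists_classNumber_bounds F Ω (half_pos hε)
  refine ⟨max |Real.log c| |Real.log C| / (ε / 2), fun E _ hE hE' hlt ↦ ?_⟩
  obtain ⟨h1, h2⟩ := h E hE hE'
  have hΔ := abs_discr_real_pos E
  have hh : (0 : ℝ) < classNumber E := by exact_mod_cast classNumber_pos E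
  have l1 := Real.log_le_log (by positivity) h1
  have l2 := Real.log_le_log hh h2
  rw [Real.log_mul (by positivity) (by positivity), Real.log_rpow hΔ] at l1 l2
  rw [le_div_iff₀ (by positivity)]
  have m1 := le_max_left |Real.log c| |Real.log C|
  have m2 := le_max_right |Real.log c| |Real.log C|
  have a1 := neg_abs_le (Real.log c)
  have a2 := le_abs_self (Real.log C)
  rcases lt_abs.mp hlt with h3 | h3 <;> linarith

end BrauerSiegel

/-- fix a totally real number field `K₀` of class number one. Over the family of
all CM-fields `K` with maximal totally real subfield `K₀`, one has
`log h_K ∼ (1/2)·log Δ_K` as `Δ_K → ∞`: for every `ε > 0` there are only finitely many such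
CM-fields with `|log h_K − (1/2)·log Δ_K| > ε·log Δ_K`. -/
theorem stmt_0 (K₀ : IntermediateField ℚ ℂ) [FiniteDimensional ℚ K₀]
    (hTR : ∀ φ : K₀ →+* ℂ, ∀ z : K₀, (φ z).im = 0)
    (hcl : clsNum K₀ = 1)
    (ε : ℝ) (hε : 0 < ε) :
    {K : IntermediateField ℚ ℂ | IsCMover K₀ K ∧
      |Real.log (clsNum K) - (1 / 2) * Real.log (absDisc K)| >
        ε * Real.log (absDisc K)}.Finite := by
  have : NumberField K₀ := ⟨⟩
  have : IsTotallyReal K₀ := by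
    refine ⟨fun w ↦ ?_⟩
    rw [InfinitePlace.isReal_iff, ComplexEmbedding.isReal_iff]
    ext z
    exact Complex.conj_eq_iff_im.mpr (hTR _ z)
  obtain ⟨B, hB⟩ := exists_log_abs_discr_le K₀ ℂ hε
  have hfin := (NumberField.finite_of_discr_bdd ℂ ⌊Real.exp B⌋₊).image Subtype.val
  refine hfin.subset ?_
  rintro K ⟨⟨hK, hle, hrank, hreal⟩, hgt⟩
  obtain ⟨E, rfl⟩ : ∃ E : IntermediateField K₀ ℂ, E.restrictScalars ℚ = K :=
    ⟨IntermediateField.extendScalars hle, IntermediateField.extendScalars_restrictScalars hle⟩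
  have hN : NumberField E := @NumberField.mk _ _ _ hK
  have hE : Module.finrank K₀ E = 2 := by
    have h1 := Module.finrank_mul_finrank ℚ K₀ E
    have h2 : Module.finrank ℚ E = 2 * Module.finrank ℚ K₀ := hrank
    have h3 : 0 < Module.finrank ℚ K₀ := Module.finrank_pos
    rw [h2, mul_comm 2] at h1
    exact Nat.eq_of_mul_eq_mul_left h3 h1
  have hcomplex : IsTotallyComplex E := by
    refine ⟨fun w ↦ ?_⟩
    rw [← InfinitePlace.not_isReal_iff_isComplex]
    exact fun hw ↦ hreal.false (InfinitePlace.embedding_of_isReal hw)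
  have hcls : clsNum (E.restrictScalars ℚ) = classNumber E := dif_pos hK
  have hdisc : absDisc (E.restrictScalars ℚ) = (discr E).natAbs := dif_pos hK
  rw [hcls, hdisc, Nat.cast_natAbs, Int.cast_abs] at hgt
  have hlog := hB E hE hcomplex hgt
  rw [Real.log_le_iff_le_exp (abs_discr_real_pos E)] at hlog
  refine ⟨⟨E.restrictScalars ℚ, hK⟩, ?_, rfl⟩
  have h4 : (discr E).natAbs ≤ ⌊Real.exp B⌋₊ := by
    rw [Nat.le_floor_iff (Real.exp_pos B).le, Nat.cast_natAbs, Int.cast_abs]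
    exact hlog
  have h5 : |discr E| ≤ (⌊Real.exp B⌋₊ : ℤ) := by
    rw [Int.abs_eq_natAbs]
    exact_mod_cast h4
  exact h5
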